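/- Let 2 ≤ e < ∞, let K be a field containing an element ξ ∈ K^× of quantum characteristic e (that is, [e]_ξ = 0 and [k]_ξ ≠ 0 for 1 ≤ k < e), let κ ∈ Z^ℓ be a multicharge with κ_l − κ_{l+1} ≥ n for 1 ≤ l < ℓ, and set Λ = Σ_{l=1}^ℓ Λ_{κ_l mod e}. Then in the cyclotomic quiver Hecke algebra R_n^Λ(K), for every i ∈ I^n and 1 ≤ r ≤ n, y_r^{d_r(i)} e(i) = 0, where d_r(i) = #{ c_r(t) − î_r : t ∈ Std(i) } is the number of distinct values of c_r(t) − î_r as t ranges over the standard tableaux with residue sequence i. -/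

import Mathlib

open scoped BigOperators
open scoped Classical

namespace Paper

/-! ## Quantum integers -/

/-- The quantum integer `[d]_x` in a field, for `d ∈ ℤ`. -/
noncomputable def qint {K : Type*} [Field K] (x : K) (d : ℤ) : K :=
  if 0 ≤ d then ∑ k ∈ Finset.range d.toNat, x ^ k
  else -∑ k ∈ Finset.range (-d).toNat, x ^ (-((k : ℤ) + 1))

/-- The quantum integer `[d]_t` in a commutative ring, for an invertible `t` and `d ∈ ℤ`. -/
def qintU {O : Type*} [CommRing O] (t : Oˣ) (d : ℤ) : O :=
  if 0 ≤ d then ∑ k ∈ Finset.range d.toNat, (t : O) ^ k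
  else -∑ k ∈ Finset.range (-d).toNat, ((t ^ (-((k : ℤ) + 1)) : Oˣ) : O)

/-! ## Nodes, multipartitions and standard tableaux -/

/-- A node `(l, r, c)`: component `l`, row `r`, column `c` (all `0`-based). -/
abbrev Node : Type := ℕ × ℕ × ℕ

/-- `nodeBelow A B` holds when `B` is strictly below `A`, i.e. `A < B` lexicographically. -/
def nodeBelow (A B : Node) : Prop :=
  A.1 < B.1 ∨ (A.1 = B.1 ∧ (A.2.1 < B.2.1 ∨ (A.2.1 = B.2.1 ∧ A.2.2 < B.2.2)))

/-- An `ℓ`-multipartition of `n`. -/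
structure Multipartition (ℓ n : ℕ) : Type where
  part : ℕ → ℕ → ℕ
  comp_bound : ∀ l, ℓ ≤ l → ∀ r, part l r = 0
  antitone : ∀ l, Antitone (part l)
  row_bound : ∀ l r, n ≤ r → part l r = 0
  size : (∑ l ∈ Finset.range ℓ, ∑ r ∈ Finset.range n, part l r) = n

/-- The diagram of a multipartition. -/
def Multipartition.diagram {ℓ n : ℕ} (μ : Multipartition ℓ n) : Set Node :=
  {A | A.2.2 < μ.part A.1 A.2.1}

/-- A standard tableau: a bijection from the diagram of its shape onto `{1, …, n}`
that increases along rows and down columns of each component (it takes the value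
`0` off the diagram, so that it is determined by its entries). -/
structure StdTableau (ℓ n : ℕ) : Type where
  shape : Multipartition ℓ n
  entry : Node → ℕ
  entry_zero : ∀ A, A ∉ shape.diagram → entry A = 0
  bijOn : Set.BijOn entry shape.diagram (Set.Icc 1 n)
  row_inc : ∀ l r c, (l, r, c + 1) ∈ shape.diagram → entry (l, r, c) < entry (l, r, c + 1)
  col_inc : ∀ l r c, (l, r + 1, c) ∈ shape.diagram → entry (l, r, c) < entry (l, r + 1, c)

/-- The node of a standard tableau containing the entry `k`. -/
noncomputable def StdTableau.node {ℓ n : ℕ} (T : StdTableau ℓ n) (k : ℕ) : Node :=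
  Function.invFunOn T.entry T.shape.diagram k

/-- The content `c_k(T) = κ_l + c - r` of the entry `k` in the tableau `T`
(`1 ≤ k ≤ n`). -/
noncomputable def content {ℓ n : ℕ} (κ : ℕ → ℤ) (T : StdTableau ℓ n) (k : ℕ) : ℤ :=
  κ (T.node k).1 + ((T.node k).2.2 : ℤ) - ((T.node k).2.1 : ℤ)

/-- The residue sequence of a standard tableau, in `I^n` with `I = ℤ/eℤ`. -/
noncomputable def resSeq {ℓ n : ℕ} (e : ℕ) (κ : ℕ → ℤ) (T : StdTableau ℓ n) :
    Fin n → ZMod e :=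
  fun k => ((content κ T (k.1 + 1) : ℤ) : ZMod e)

/-- The residue of a node. -/
def resNode (e : ℕ) (κ : ℕ → ℤ) (A : Node) : ZMod e :=
  ((κ A.1 + (A.2.2 : ℤ) - (A.2.1 : ℤ) : ℤ) : ZMod e)

/-- A set of nodes is the diagram of a multipartition (with at most `ℓ` components)
iff it is finite and downward closed in rows and columns. -/
def IsDiagramSet (ℓ : ℕ) (S : Set Node) : Prop :=
  S.Finite ∧ (∀ A ∈ S, A.1 < ℓ) ∧
    (∀ l r c, (l, r, c + 1) ∈ S → (l, r, c) ∈ S) ∧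
    (∀ l r c, (l, r + 1, c) ∈ S → (l, r, c) ∈ S)

/-- `A` is an addable node of the diagram `S`. -/
def Addable (ℓ : ℕ) (S : Set Node) (A : Node) : Prop :=
  A ∉ S ∧ IsDiagramSet ℓ (S ∪ {A})

/-- `A` is a removable node of the diagram `S`. -/
def Removable (ℓ : ℕ) (S : Set Node) (A : Node) : Prop :=
  A ∈ S ∧ IsDiagramSet ℓ (S \ {A})

/-- `d_A(S)`: the number of addable nodes of `S` of the same residue as `A` strictly
below `A`, minus the number of removable ones. -/
noncomputable def dNode (ℓ e : ℕ) (κ : ℕ → ℤ) (S : Set Node) (A : Node) : ℤ :=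
  (Set.ncard {B | Addable ℓ S B ∧ resNode e κ B = resNode e κ A ∧ nodeBelow A B} : ℤ) -
    (Set.ncard {B | Removable ℓ S B ∧ resNode e κ B = resNode e κ A ∧ nodeBelow A B} : ℤ)

/-- The Brundan–Kleshchev–Wang degree `deg_e(T)` of a standard tableau, written as the
telescoping sum of the recursion `deg_e(T) = deg_e(T↓(n-1)) + d_A(Shape(T))`. -/
noncomputable def degE {ℓ n : ℕ} (e : ℕ) (κ : ℕ → ℤ) (T : StdTableau ℓ n) : ℤ :=
  ∑ m ∈ Finset.Icc 1 n,
    dNode ℓ e κ {A | A ∈ T.shape.diagram ∧ T.entry A ≤ m} (T.node m)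

/-- The restriction of the diagram of `T` to entries `≤ m` (the diagram of `Shape(T↓m)`). -/
def restDiag {ℓ n : ℕ} (T : StdTableau ℓ n) (m : ℕ) : Set Node :=
  {A | A ∈ T.shape.diagram ∧ T.entry A ≤ m}

/-- Dominance order on standard tableaux: `domTab S T` iff `S ⊵ T`. -/
def domTab {ℓ n : ℕ} (S T : StdTableau ℓ n) : Prop :=
  ∀ m l i : ℕ,
    Set.ncard {A | A ∈ restDiag T m ∧ (A.1 < l ∨ (A.1 = l ∧ A.2.1 ≤ i))} ≤
      Set.ncard {A | A ∈ restDiag S m ∧ (A.1 < l ∨ (A.1 = l ∧ A.2.1 ≤ i))}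

/-- Interchange the entries `r` and `r + 1` in an entry function. -/
def swapEntry (f : Node → ℕ) (r : ℕ) : Node → ℕ :=
  fun A => if f A = r then r + 1 else if f A = r + 1 then r else f A

/-- `ρ_r(T) = c_r(T) - c_{r+1}(T)`, the axial distance. -/
noncomputable def rhoTab {ℓ n : ℕ} (κ : ℕ → ℤ) (T : StdTableau ℓ n) (r : ℕ) : ℤ :=
  content κ T r - content κ T (r + 1)

/-- The entry function of the row-reading initial tableau `t^λ`. -/
noncomputable def tlamEntry {ℓ n : ℕ} (μ : Multipartition ℓ n) (A : Node) : ℕ :=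
  if A ∈ μ.diagram then
    (∑ l ∈ Finset.range A.1, ∑ r ∈ Finset.range n, μ.part l r) +
      (∑ r ∈ Finset.range A.2.1, μ.part A.1 r) + A.2.2 + 1
  else 0

/-- The finite set of possible contents of standard tableaux of size `n`. -/
noncomputable def contFinset (ℓ n : ℕ) (κ : ℕ → ℤ) : Finset ℤ :=
  ((Finset.range ℓ ×ˢ Finset.range n ×ˢ Finset.range n).image
      (fun x => κ x.1 + (x.2.2 : ℤ) - (x.2.1 : ℤ))).filter
    (fun c => ∃ T : StdTableau ℓ n, ∃ k, 1 ≤ k ∧ k ≤ n ∧ content κ T k = c)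

/-- The standard tableau (if any) obtained from `T` by interchanging the entries
`r` and `r + 1`; i.e. `T·s_r` if it is standard, and `none` otherwise. -/
noncomputable def oSwapO {ℓ n : ℕ} (T : StdTableau ℓ n) (r : ℕ) :
    Option (StdTableau ℓ n) :=
  if h : ∃ V : StdTableau ℓ n, V.entry = swapEntry T.entry r then some (Classical.choose h)
  else none

/-- `oSwap` extended to `Option`. -/
noncomputable def oSwap {ℓ n : ℕ} (X : Option (StdTableau ℓ n)) (r : ℕ) :
    Option (StdTableau ℓ n) :=
  X.bind fun T => oSwapO T r

/-- Evaluate a seminormal coefficient system on an optional tableau (by `0` if none). -/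
noncomputable def aE {ℓ n : ℕ} {K : Type*} [Field K] (α : ℕ → StdTableau ℓ n → K) (r : ℕ)
    (X : Option (StdTableau ℓ n)) : K :=
  X.elim 0 (α r)

/-! ## Separation and idempotent subrings -/

/-- `(K, t)` separates `Std(P_n)` (field version):
`[n]!_t ∏_{1 ≤ l < m ≤ ℓ} ∏_{-n < d < n} [κ_l - κ_m + d]_t ≠ 0`. -/
def SeparatesF {K : Type*} [Field K] (t : Kˣ) (n ℓ : ℕ) (κ : ℕ → ℤ) : Prop :=
  ((∏ d ∈ Finset.Icc 1 n, qint (t : K) (d : ℤ)) *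
      ∏ l ∈ Finset.range ℓ, ∏ m ∈ Finset.Ioo l ℓ,
        ∏ d ∈ Finset.Ioo (-(n : ℤ)) (n : ℤ), qint (t : K) (κ l - κ m + d)) ≠ 0

/-- `(O, t)` separates `Std(P_n)` (subring version): the separation element is a unit. -/
def SeparatesU {O : Type*} [CommRing O] (t : Oˣ) (n ℓ : ℕ) (κ : ℕ → ℤ) : Prop :=
  IsUnit ((∏ d ∈ Finset.Icc 1 n, qintU t (d : ℤ)) *
      ∏ l ∈ Finset.range ℓ, ∏ m ∈ Finset.Ioo l ℓ,
        ∏ d ∈ Finset.Ioo (-(n : ℤ)) (n : ℤ), qintU t (κ l - κ m + d))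

/-- `(O, t)` is an `e`-idempotent subring of the field `K`. -/
def IsIdempotentSubring {K : Type*} [Field K] (O : Subring K) (t : Oˣ) (e n ℓ : ℕ)
    (κ : ℕ → ℤ) : Prop :=
  SeparatesU t n ℓ κ ∧
    (∀ k : ℤ, ¬(e : ℤ) ∣ k → IsUnit (qintU t k)) ∧
    (∀ k : ℤ, (e : ℤ) ∣ k → qintU t k ∈ Ideal.jacobson (⊥ : Ideal O))

/-! ## The cyclotomic Hecke algebra, by generators and relations -/

/-- Generators `L_1, …, L_n`, `T_1, …, T_{n-1}` (here `0`-based). -/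
inductive HeckeGen (n : ℕ) : Type
  | L : Fin n → HeckeGen n
  | T : Fin (n - 1) → HeckeGen n

/-- The position `r` of the pair `(r, r+1)` interchanged by the `r`-th transposition. -/
def pL {n : ℕ} (r : Fin (n - 1)) : Fin n := ⟨r.1, by have := r.2; omega⟩

/-- The position `r + 1` of the pair interchanged by the `r`-th transposition. -/
def pR {n : ℕ} (r : Fin (n - 1)) : Fin n := ⟨r.1 + 1, by have := r.2; omega⟩

/-- The position `r + 2`, used in braid relations. -/
def pM {n : ℕ} (r : Fin (n - 1)) (hr : r.1 + 1 < n - 1) : Fin n := ⟨r.1 + 2, by omega⟩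

/-- The free algebra generator `L_k`. -/
def hL (R : Type*) [CommRing R] {n : ℕ} (k : Fin n) : FreeAlgebra R (HeckeGen n) :=
  FreeAlgebra.ι R (HeckeGen.L k)

/-- The free algebra generator `T_r`. -/
def hT (R : Type*) [CommRing R] {n : ℕ} (r : Fin (n - 1)) : FreeAlgebra R (HeckeGen n) :=
  FreeAlgebra.ι R (HeckeGen.T r)

/-- The defining relations of the integral cyclotomic Hecke algebra `H_n(R, t, κ)`. -/
inductive HeckeRel (R : Type*) [CommRing R] (t : Rˣ) (n ℓ : ℕ) (κ : ℕ → ℤ) :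
    FreeAlgebra R (HeckeGen n) → FreeAlgebra R (HeckeGen n) → Prop
  | cyc (h : 0 < n) :
      HeckeRel R t n ℓ κ
        (((List.range ℓ).map fun l =>
          hL R (⟨0, h⟩ : Fin n) - algebraMap R _ (qintU t (κ l))).prod) 0
  | quad (r : Fin (n - 1)) :
      HeckeRel R t n ℓ κ ((hT R r + 1) * (hT R r - algebraMap R _ (t : R))) 0
  | LL (k m : Fin n) : HeckeRel R t n ℓ κ (hL R k * hL R m) (hL R m * hL R k)
  | TTfar (r s : Fin (n - 1)) (h : r.1 + 1 < s.1 ∨ s.1 + 1 < r.1) :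
      HeckeRel R t n ℓ κ (hT R r * hT R s) (hT R s * hT R r)
  | braid (r s : Fin (n - 1)) (h : s.1 = r.1 + 1) :
      HeckeRel R t n ℓ κ (hT R r * hT R s * hT R r) (hT R s * hT R r * hT R s)
  | TL (r : Fin (n - 1)) (k : Fin n) (h : k.1 ≠ r.1 ∧ k.1 ≠ r.1 + 1) :
      HeckeRel R t n ℓ κ (hT R r * hL R k) (hL R k * hT R r)
  | LT (r : Fin (n - 1)) :
      HeckeRel R t n ℓ κ (hL R (pR r) * (hT R r - algebraMap R _ (t : R) + 1))
        (hT R r * hL R (pL r) + 1)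

/-- The integral cyclotomic Hecke algebra of type `A`, `H_n(R, t, κ)`. -/
noncomputable abbrev CycHecke (R : Type*) [CommRing R] (t : Rˣ) (n ℓ : ℕ) (κ : ℕ → ℤ) :
    Type _ :=
  RingQuot (HeckeRel R t n ℓ κ)

/-- The generator `L_k` of the cyclotomic Hecke algebra. -/
noncomputable def Lgen (R : Type*) [CommRing R] (t : Rˣ) (n ℓ : ℕ) (κ : ℕ → ℤ)
    (k : Fin n) : CycHecke R t n ℓ κ :=
  RingQuot.mkAlgHom R (HeckeRel R t n ℓ κ) (hL R k)

/-- The generator `T_r` of the cyclotomic Hecke algebra. -/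
noncomputable def Tgen (R : Type*) [CommRing R] (t : Rˣ) (n ℓ : ℕ) (κ : ℕ → ℤ)
    (r : Fin (n - 1)) : CycHecke R t n ℓ κ :=
  RingQuot.mkAlgHom R (HeckeRel R t n ℓ κ) (hT R r)

end Paper
/-! ## Quiver Hecke (KLR) algebras, by generators and relations -/

namespace Paper

/-- Generators `e(i)` (`i ∈ I^n`), `ψ_1, …, ψ_{n-1}`, `y_1, …, y_n` (here `0`-based). -/
inductive KLRGen (n e : ℕ) : Type
  | idem : (Fin n → ZMod e) → KLRGen n e
  | psi : Fin (n - 1) → KLRGen n e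
  | y : Fin n → KLRGen n e

/-- The free algebra generator `e(i)`. -/
def kE (R : Type*) [CommRing R] {n e : ℕ} (i : Fin n → ZMod e) :
    FreeAlgebra R (KLRGen n e) :=
  FreeAlgebra.ι R (KLRGen.idem i)

/-- The free algebra generator `ψ_r`. -/
def kPsi (R : Type*) [CommRing R] {n e : ℕ} (r : Fin (n - 1)) :
    FreeAlgebra R (KLRGen n e) :=
  FreeAlgebra.ι R (KLRGen.psi r)

/-- The free algebra generator `y_k`. -/
def kY (R : Type*) [CommRing R] {n e : ℕ} (k : Fin n) : FreeAlgebra R (KLRGen n e) :=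
  FreeAlgebra.ι R (KLRGen.y k)

/-- `s_r · i`: interchange the entries of `i` at positions `r` and `r + 1`. -/
def swapSeq {n e : ℕ} (i : Fin n → ZMod e) (r : Fin (n - 1)) : Fin n → ZMod e :=
  fun k => if k = pL r then i (pR r) else if k = pR r then i (pL r) else i k

/-- The defining relations of the cyclotomic quiver Hecke algebra `R_n^Λ(R)` where
`Λ = Σ_l Λ_{κ_l mod e}`. -/
inductive KLRRel (R : Type*) [CommRing R] (n e ℓ : ℕ) [NeZero e] (κ : ℕ → ℤ) :
    FreeAlgebra R (KLRGen n e) → FreeAlgebra R (KLRGen n e) → Prop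
  | cyc (h : 0 < n) (i : Fin n → ZMod e) :
      KLRRel R n e ℓ κ
        ((kY R (⟨0, h⟩ : Fin n)) ^
            (((Finset.range ℓ).filter fun l => ((κ l : ZMod e) = i ⟨0, h⟩)).card) *
          kE R i) 0
  | orth (i j : Fin n → ZMod e) (h : i ≠ j) : KLRRel R n e ℓ κ (kE R i * kE R j) 0
  | idem (i : Fin n → ZMod e) : KLRRel R n e ℓ κ (kE R i * kE R i) (kE R i)
  | complete : KLRRel R n e ℓ κ (∑ i : Fin n → ZMod e, kE R i) 1
  | yE (k : Fin n) (i : Fin n → ZMod e) :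
      KLRRel R n e ℓ κ (kY R k * kE R i) (kE R i * kY R k)
  | psiE (r : Fin (n - 1)) (i : Fin n → ZMod e) :
      KLRRel R n e ℓ κ (kPsi R r * kE R i) (kE R (swapSeq i r) * kPsi R r)
  | yy (k m : Fin n) : KLRRel R n e ℓ κ (kY R k * kY R m) (kY R m * kY R k)
  | psiyEq (r : Fin (n - 1)) (i : Fin n → ZMod e) (h : i (pL r) = i (pR r)) :
      KLRRel R n e ℓ κ (kPsi R r * kY R (pR r) * kE R i)
        ((kY R (pL r) * kPsi R r + 1) * kE R i)
  | psiyNe (r : Fin (n - 1)) (i : Fin n → ZMod e) (h : i (pL r) ≠ i (pR r)) :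
      KLRRel R n e ℓ κ (kPsi R r * kY R (pR r) * kE R i)
        (kY R (pL r) * kPsi R r * kE R i)
  | ypsiEq (r : Fin (n - 1)) (i : Fin n → ZMod e) (h : i (pL r) = i (pR r)) :
      KLRRel R n e ℓ κ (kY R (pR r) * kPsi R r * kE R i)
        ((kPsi R r * kY R (pL r) + 1) * kE R i)
  | ypsiNe (r : Fin (n - 1)) (i : Fin n → ZMod e) (h : i (pL r) ≠ i (pR r)) :
      KLRRel R n e ℓ κ (kY R (pR r) * kPsi R r * kE R i)
        (kPsi R r * kY R (pL r) * kE R i)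
  | psiyFar (r : Fin (n - 1)) (k : Fin n) (h : k.1 ≠ r.1 ∧ k.1 ≠ r.1 + 1) :
      KLRRel R n e ℓ κ (kPsi R r * kY R k) (kY R k * kPsi R r)
  | psipsiFar (r s : Fin (n - 1)) (h : r.1 + 1 < s.1 ∨ s.1 + 1 < r.1) :
      KLRRel R n e ℓ κ (kPsi R r * kPsi R s) (kPsi R s * kPsi R r)
  | quadEq (r : Fin (n - 1)) (i : Fin n → ZMod e) (h : i (pL r) = i (pR r)) :
      KLRRel R n e ℓ κ (kPsi R r ^ 2 * kE R i) 0
  | quadR (r : Fin (n - 1)) (i : Fin n → ZMod e)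
      (h1 : i (pR r) = i (pL r) + 1) (h2 : i (pL r) ≠ i (pR r) + 1) :
      KLRRel R n e ℓ κ (kPsi R r ^ 2 * kE R i) ((kY R (pL r) - kY R (pR r)) * kE R i)
  | quadL (r : Fin (n - 1)) (i : Fin n → ZMod e)
      (h1 : i (pL r) = i (pR r) + 1) (h2 : i (pR r) ≠ i (pL r) + 1) :
      KLRRel R n e ℓ κ (kPsi R r ^ 2 * kE R i) ((kY R (pR r) - kY R (pL r)) * kE R i)
  | quadBoth (r : Fin (n - 1)) (i : Fin n → ZMod e)
      (h1 : i (pR r) = i (pL r) + 1) (h2 : i (pL r) = i (pR r) + 1) :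
      KLRRel R n e ℓ κ (kPsi R r ^ 2 * kE R i)
        ((kY R (pR r) - kY R (pL r)) * (kY R (pL r) - kY R (pR r)) * kE R i)
  | quadNone (r : Fin (n - 1)) (i : Fin n → ZMod e) (h1 : i (pL r) ≠ i (pR r))
      (h2 : i (pR r) ≠ i (pL r) + 1) (h3 : i (pL r) ≠ i (pR r) + 1) :
      KLRRel R n e ℓ κ (kPsi R r ^ 2 * kE R i) (kE R i)
  | braidR (r : Fin (n - 1)) (hr : r.1 + 1 < n - 1) (i : Fin n → ZMod e)
      (h0 : i (pM r hr) = i (pL r)) (h1 : i (pR r) = i (pL r) + 1)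
      (h2 : i (pL r) ≠ i (pR r) + 1) :
      KLRRel R n e ℓ κ (kPsi R r * kPsi R ⟨r.1 + 1, hr⟩ * kPsi R r * kE R i)
        ((kPsi R ⟨r.1 + 1, hr⟩ * kPsi R r * kPsi R ⟨r.1 + 1, hr⟩ - 1) * kE R i)
  | braidL (r : Fin (n - 1)) (hr : r.1 + 1 < n - 1) (i : Fin n → ZMod e)
      (h0 : i (pM r hr) = i (pL r)) (h1 : i (pL r) = i (pR r) + 1)
      (h2 : i (pR r) ≠ i (pL r) + 1) :
      KLRRel R n e ℓ κ (kPsi R r * kPsi R ⟨r.1 + 1, hr⟩ * kPsi R r * kE R i)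
        ((kPsi R ⟨r.1 + 1, hr⟩ * kPsi R r * kPsi R ⟨r.1 + 1, hr⟩ + 1) * kE R i)
  | braidBoth (r : Fin (n - 1)) (hr : r.1 + 1 < n - 1) (i : Fin n → ZMod e)
      (h0 : i (pM r hr) = i (pL r)) (h1 : i (pR r) = i (pL r) + 1)
      (h2 : i (pL r) = i (pR r) + 1) :
      KLRRel R n e ℓ κ (kPsi R r * kPsi R ⟨r.1 + 1, hr⟩ * kPsi R r * kE R i)
        ((kPsi R ⟨r.1 + 1, hr⟩ * kPsi R r * kPsi R ⟨r.1 + 1, hr⟩ +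
            kY R (pL r) - 2 * kY R (pR r) + kY R (pM r hr)) * kE R i)
  | braidNone (r : Fin (n - 1)) (hr : r.1 + 1 < n - 1) (i : Fin n → ZMod e)
      (h : ¬(i (pM r hr) = i (pL r) ∧
        (i (pR r) = i (pL r) + 1 ∨ i (pL r) = i (pR r) + 1))) :
      KLRRel R n e ℓ κ (kPsi R r * kPsi R ⟨r.1 + 1, hr⟩ * kPsi R r * kE R i)
        (kPsi R ⟨r.1 + 1, hr⟩ * kPsi R r * kPsi R ⟨r.1 + 1, hr⟩ * kE R i)

/-- The cyclotomic quiver Hecke algebra `R_n^Λ(R)`, `Λ = Σ_l Λ_{κ_l mod e}`. -/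
noncomputable abbrev KLR (R : Type*) [CommRing R] (n e ℓ : ℕ) [NeZero e] (κ : ℕ → ℤ) :
    Type _ :=
  RingQuot (KLRRel R n e ℓ κ)

/-- The generator `e(i)` of the cyclotomic quiver Hecke algebra. -/
noncomputable def KeGen (R : Type*) [CommRing R] (n e ℓ : ℕ) [NeZero e] (κ : ℕ → ℤ)
    (i : Fin n → ZMod e) : KLR R n e ℓ κ :=
  RingQuot.mkAlgHom R (KLRRel R n e ℓ κ) (kE R i)

/-- The generator `ψ_r` of the cyclotomic quiver Hecke algebra. -/
noncomputable def KpsiGen (R : Type*) [CommRing R] (n e ℓ : ℕ) [NeZero e] (κ : ℕ → ℤ)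
    (r : Fin (n - 1)) : KLR R n e ℓ κ :=
  RingQuot.mkAlgHom R (KLRRel R n e ℓ κ) (kPsi R r)

/-- The generator `y_k` of the cyclotomic quiver Hecke algebra. -/
noncomputable def KyGen (R : Type*) [CommRing R] (n e ℓ : ℕ) [NeZero e] (κ : ℕ → ℤ)
    (k : Fin n) : KLR R n e ℓ κ :=
  RingQuot.mkAlgHom R (KLRRel R n e ℓ κ) (kY R k)

end Paper
/-! ## The deformed cyclotomic quiver Hecke algebra -/

namespace Paper

/-- `y_k^⟨d⟩ = t^d y_k + [d]_t` in the free algebra. -/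
def ydot (R : Type*) [CommRing R] (t : Rˣ) {n e : ℕ} (d : ℤ) (k : Fin n) :
    FreeAlgebra R (KLRGen n e) :=
  algebraMap R _ ((t ^ d : Rˣ) : R) * kY R k + algebraMap R _ (qintU t d)

/-- `ρ_r(i) = î_r - î_{r+1}` for `i ∈ I^n`. -/
def rhoI {n e : ℕ} (i : Fin n → ZMod e) (r : Fin (n - 1)) : ℤ :=
  ((i (pL r)).val : ℤ) - ((i (pR r)).val : ℤ)

/-- The defining relations of the deformed cyclotomic quiver Hecke algebra `R_n(O)`. -/
inductive DefKLRRel (R : Type*) [CommRing R] (t : Rˣ) (n e ℓ : ℕ) [NeZero e] (κ : ℕ → ℤ) :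
    FreeAlgebra R (KLRGen n e) → FreeAlgebra R (KLRGen n e) → Prop
  | cyc (h : 0 < n) (i : Fin n → ZMod e) :
      DefKLRRel R t n e ℓ κ
        ((((List.range ℓ).map fun l =>
            if ((κ l : ZMod e) = i ⟨0, h⟩) then
              kY R (⟨0, h⟩ : Fin n) -
                algebraMap R _ (qintU t (κ l - ((i ⟨0, h⟩).val : ℤ)))
            else 1).prod) * kE R i) 0
  | orth (i j : Fin n → ZMod e) (h : i ≠ j) : DefKLRRel R t n e ℓ κ (kE R i * kE R j) 0
  | idem (i : Fin n → ZMod e) : DefKLRRel R t n e ℓ κ (kE R i * kE R i) (kE R i)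
  | complete : DefKLRRel R t n e ℓ κ (∑ i : Fin n → ZMod e, kE R i) 1
  | yE (k : Fin n) (i : Fin n → ZMod e) :
      DefKLRRel R t n e ℓ κ (kY R k * kE R i) (kE R i * kY R k)
  | psiE (r : Fin (n - 1)) (i : Fin n → ZMod e) :
      DefKLRRel R t n e ℓ κ (kPsi R r * kE R i) (kE R (swapSeq i r) * kPsi R r)
  | yy (k m : Fin n) : DefKLRRel R t n e ℓ κ (kY R k * kY R m) (kY R m * kY R k)
  | psiyEq (r : Fin (n - 1)) (i : Fin n → ZMod e) (h : i (pL r) = i (pR r)) :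
      DefKLRRel R t n e ℓ κ (kPsi R r * kY R (pR r) * kE R i)
        ((kY R (pL r) * kPsi R r + 1) * kE R i)
  | psiyNe (r : Fin (n - 1)) (i : Fin n → ZMod e) (h : i (pL r) ≠ i (pR r)) :
      DefKLRRel R t n e ℓ κ (kPsi R r * kY R (pR r) * kE R i)
        (kY R (pL r) * kPsi R r * kE R i)
  | ypsiEq (r : Fin (n - 1)) (i : Fin n → ZMod e) (h : i (pL r) = i (pR r)) :
      DefKLRRel R t n e ℓ κ (kY R (pR r) * kPsi R r * kE R i)
        ((kPsi R r * kY R (pL r) + 1) * kE R i)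
  | ypsiNe (r : Fin (n - 1)) (i : Fin n → ZMod e) (h : i (pL r) ≠ i (pR r)) :
      DefKLRRel R t n e ℓ κ (kY R (pR r) * kPsi R r * kE R i)
        (kPsi R r * kY R (pL r) * kE R i)
  | psiyFar (r : Fin (n - 1)) (k : Fin n) (h : k.1 ≠ r.1 ∧ k.1 ≠ r.1 + 1) :
      DefKLRRel R t n e ℓ κ (kPsi R r * kY R k) (kY R k * kPsi R r)
  | psipsiFar (r s : Fin (n - 1)) (h : r.1 + 1 < s.1 ∨ s.1 + 1 < r.1) :
      DefKLRRel R t n e ℓ κ (kPsi R r * kPsi R s) (kPsi R s * kPsi R r)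
  | quadEq (r : Fin (n - 1)) (i : Fin n → ZMod e) (h : i (pL r) = i (pR r)) :
      DefKLRRel R t n e ℓ κ (kPsi R r ^ 2 * kE R i) 0
  | quadR (r : Fin (n - 1)) (i : Fin n → ZMod e)
      (h1 : i (pR r) = i (pL r) + 1) (h2 : i (pL r) ≠ i (pR r) + 1) :
      DefKLRRel R t n e ℓ κ (kPsi R r ^ 2 * kE R i)
        ((ydot R t (1 + rhoI i r) (pL r) - kY R (pR r)) * kE R i)
  | quadL (r : Fin (n - 1)) (i : Fin n → ZMod e)
      (h1 : i (pL r) = i (pR r) + 1) (h2 : i (pR r) ≠ i (pL r) + 1) :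
      DefKLRRel R t n e ℓ κ (kPsi R r ^ 2 * kE R i)
        ((ydot R t (1 - rhoI i r) (pR r) - kY R (pL r)) * kE R i)
  | quadBoth (r : Fin (n - 1)) (i : Fin n → ZMod e)
      (h1 : i (pR r) = i (pL r) + 1) (h2 : i (pL r) = i (pR r) + 1) :
      DefKLRRel R t n e ℓ κ (kPsi R r ^ 2 * kE R i)
        ((ydot R t (1 + rhoI i r) (pL r) - kY R (pR r)) *
          (ydot R t (1 - rhoI i r) (pR r) - kY R (pL r)) * kE R i)
  | quadNone (r : Fin (n - 1)) (i : Fin n → ZMod e) (h1 : i (pL r) ≠ i (pR r))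
      (h2 : i (pR r) ≠ i (pL r) + 1) (h3 : i (pL r) ≠ i (pR r) + 1) :
      DefKLRRel R t n e ℓ κ (kPsi R r ^ 2 * kE R i) (kE R i)
  | braidBoth (r : Fin (n - 1)) (hr : r.1 + 1 < n - 1) (i : Fin n → ZMod e)
      (h0 : i (pM r hr) = i (pL r)) (h1 : i (pR r) = i (pL r) + 1)
      (h2 : i (pL r) = i (pR r) + 1) :
      DefKLRRel R t n e ℓ κ
        ((kPsi R r * kPsi R ⟨r.1 + 1, hr⟩ * kPsi R r -
            kPsi R ⟨r.1 + 1, hr⟩ * kPsi R r * kPsi R ⟨r.1 + 1, hr⟩) * kE R i)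
        ((ydot R t (1 + rhoI i r) (pL r) + ydot R t (1 + rhoI i r) (pM r hr) -
            ydot R t (1 + rhoI i r) (pR r) - ydot R t (1 - rhoI i r) (pR r)) * kE R i)
  | braidR (r : Fin (n - 1)) (hr : r.1 + 1 < n - 1) (i : Fin n → ZMod e)
      (h0 : i (pM r hr) = i (pL r)) (h1 : i (pR r) = i (pL r) + 1)
      (h2 : i (pL r) ≠ i (pR r) + 1) :
      DefKLRRel R t n e ℓ κ
        ((kPsi R r * kPsi R ⟨r.1 + 1, hr⟩ * kPsi R r -
            kPsi R ⟨r.1 + 1, hr⟩ * kPsi R r * kPsi R ⟨r.1 + 1, hr⟩) * kE R i)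
        (algebraMap R _ (-(((t ^ (1 + rhoI i r) : Rˣ) : R))) * kE R i)
  | braidL (r : Fin (n - 1)) (hr : r.1 + 1 < n - 1) (i : Fin n → ZMod e)
      (h0 : i (pM r hr) = i (pL r)) (h1 : i (pL r) = i (pR r) + 1)
      (h2 : i (pR r) ≠ i (pL r) + 1) :
      DefKLRRel R t n e ℓ κ
        ((kPsi R r * kPsi R ⟨r.1 + 1, hr⟩ * kPsi R r -
            kPsi R ⟨r.1 + 1, hr⟩ * kPsi R r * kPsi R ⟨r.1 + 1, hr⟩) * kE R i)
        (kE R i)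
  | braidNone (r : Fin (n - 1)) (hr : r.1 + 1 < n - 1) (i : Fin n → ZMod e)
      (h : ¬(i (pM r hr) = i (pL r) ∧
        (i (pR r) = i (pL r) + 1 ∨ i (pL r) = i (pR r) + 1))) :
      DefKLRRel R t n e ℓ κ
        ((kPsi R r * kPsi R ⟨r.1 + 1, hr⟩ * kPsi R r -
            kPsi R ⟨r.1 + 1, hr⟩ * kPsi R r * kPsi R ⟨r.1 + 1, hr⟩) * kE R i) 0

/-- The deformed cyclotomic quiver Hecke algebra `R_n(R)`. -/
noncomputable abbrev DefKLR (R : Type*) [CommRing R] (t : Rˣ) (n e ℓ : ℕ) [NeZero e]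
    (κ : ℕ → ℤ) : Type _ :=
  RingQuot (DefKLRRel R t n e ℓ κ)

/-- The generator `f_i` of the deformed cyclotomic quiver Hecke algebra. -/
noncomputable def DfGen (R : Type*) [CommRing R] (t : Rˣ) (n e ℓ : ℕ) [NeZero e]
    (κ : ℕ → ℤ) (i : Fin n → ZMod e) : DefKLR R t n e ℓ κ :=
  RingQuot.mkAlgHom R (DefKLRRel R t n e ℓ κ) (kE R i)

/-- The generator `ψ_r` of the deformed cyclotomic quiver Hecke algebra. -/
noncomputable def DpsiGen (R : Type*) [CommRing R] (t : Rˣ) (n e ℓ : ℕ) [NeZero e]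
    (κ : ℕ → ℤ) (r : Fin (n - 1)) : DefKLR R t n e ℓ κ :=
  RingQuot.mkAlgHom R (DefKLRRel R t n e ℓ κ) (kPsi R r)

/-- The generator `y_k` of the deformed cyclotomic quiver Hecke algebra. -/
noncomputable def DyGen (R : Type*) [CommRing R] (t : Rˣ) (n e ℓ : ℕ) [NeZero e]
    (κ : ℕ → ℤ) (k : Fin n) : DefKLR R t n e ℓ κ :=
  RingQuot.mkAlgHom R (DefKLRRel R t n e ℓ κ) (kY R k)

/-! ## Seminormal idempotents -/

/-- The seminormal idempotent `F_T` of the semisimple cyclotomic Hecke algebra: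
`F_T = ∏_{k=1}^n ∏_{c ∈ Cont(n), [c_k(T)] ≠ [c]} (L_k - [c]) / ([c_k(T)] - [c])`. -/
noncomputable def Fidem (K : Type*) [Field K] (tK : Kˣ) (n ℓ : ℕ) (κ : ℕ → ℤ)
    (T : StdTableau ℓ n) : CycHecke K tK n ℓ κ :=
  ((List.finRange n).map (fun k =>
    (((contFinset ℓ n κ).sort (· ≤ ·)).map (fun c =>
      if qint (tK : K) (content κ T (k.1 + 1)) ≠ qint (tK : K) c then
        (Lgen K tK n ℓ κ k - algebraMap K _ (qint (tK : K) c)) *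
          algebraMap K _ ((qint (tK : K) (content κ T (k.1 + 1)) - qint (tK : K) c)⁻¹)
      else 1)).prod)).prod

/-- The residue idempotent `f_i = Σ_{T ∈ Std(i)} F_T`. -/
noncomputable def fres (K : Type*) [Field K] (tK : Kˣ) (n ℓ e : ℕ) (κ : ℕ → ℤ)
    (i : Fin n → ZMod e) : CycHecke K tK n ℓ κ :=
  ∑ᶠ T : {T : StdTableau ℓ n // resSeq e κ T = i}, Fidem K tK n ℓ κ T.1

/-- The simultaneous two-sided eigenspace `H_{S,T}` of the Jucys–Murphy elements. -/
noncomputable def eigSub (K : Type*) [Field K] (tK : Kˣ) (n ℓ : ℕ) (κ : ℕ → ℤ)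
    (S T : StdTableau ℓ n) : Submodule K (CycHecke K tK n ℓ κ) where
  carrier := {h | ∀ k : Fin n,
      Lgen K tK n ℓ κ k * h = qint (tK : K) (content κ S (k.1 + 1)) • h ∧
      h * Lgen K tK n ℓ κ k = qint (tK : K) (content κ T (k.1 + 1)) • h}
  add_mem' := by
    intro a b ha hb
    intro k
    obtain ⟨h1, h2⟩ := ha k
    obtain ⟨h3, h4⟩ := hb k
    exact ⟨by rw [mul_add, h1, h3, smul_add], by rw [add_mul, h2, h4, smul_add]⟩
  zero_mem' := by intro k; simp
  smul_mem' := by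
    intro c a ha
    intro k
    obtain ⟨h1, h2⟩ := ha k
    constructor
    · rw [mul_smul_comm, h1, smul_comm]
    · rw [smul_mul_assoc, h2, smul_comm]

end Paper

namespace Paper
namespace NB

/-! ### Part 1: spanning lemma for chains -/

/-- The word `a c * a (c+1) * ... * a (c+d-1)`. -/
def Wp {S : Type*} [Ring S] (a : ℕ → S) : ℕ → ℕ → S
  | _, 0 => 1
  | c, d + 1 => a c * Wp a (c + 1) d

theorem Wp_succ_right {S : Type*} [Ring S] (a : ℕ → S) (d : ℕ) :
    ∀ c, Wp a c (d + 1) = Wp a c d * a (c + d) := by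
  induction d with
  | zero => intro c; simp [Wp]
  | succ d ih =>
    intro c
    rw [Wp, ih (c + 1), Wp, mul_assoc]
    congr 3
    omega

theorem Wp_add {S : Type*} [Ring S] (a : ℕ → S) (d d' : ℕ) :
    ∀ c, Wp a c (d + d') = Wp a c d * Wp a (c + d) d' := by
  induction d with
  | zero => intro c; simp [Wp]
  | succ d ih =>
    intro c
    rw [show d + 1 + d' = (d + d') + 1 by omega, Wp, ih (c + 1), Wp, mul_assoc]
    congr 3
    omega

theorem Wp_commute {S : Type*} [Ring S] (a : ℕ → S) (z : S) (d : ℕ) :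
    ∀ c, (∀ t, c ≤ t → t < c + d → Commute z (a t)) → Commute z (Wp a c d) := by
  induction d with
  | zero => intro c _; exact Commute.one_right z
  | succ d ih =>
    intro c h
    exact (h c le_rfl (by omega)).mul_right (ih (c + 1) fun t h1 h2 => h t (by omega) (by omega))

theorem Wp_mem {S : Type*} [Ring S] (a : ℕ → S) (B : Subring S) (d : ℕ) :
    ∀ c, (∀ t, c ≤ t → t < c + d → a t ∈ B) → Wp a c d ∈ B := by
  induction d with
  | zero => intro c _; exact B.one_mem
  | succ d ih =>
    intro c h
    exact B.mul_mem (h c le_rfl (by omega)) (ih (c + 1) fun t h1 h2 => h t (by omega) (by omega))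

/-- A chain of generators over a base subring. -/
structure Chain {S : Type*} [Ring S] (P0 : Subring S) (a : ℕ → S) (m : ℕ) : Prop where
  left : ∀ t, t < m → ∀ f ∈ P0, ∃ f' ∈ P0, ∃ g ∈ P0, f * a t = a t * f' + g
  sq : ∀ t, t < m → a t * a t ∈ P0
  far : ∀ t u, t + 1 < u → u < m → a t * a u = a u * a t
  braid : ∀ t, t + 1 < m → ∃ D ∈ P0, a (t + 1) * a t * a (t + 1) = a t * a (t + 1) * a t + D

/-- Subring generated by `P0` and `a t` for `t < m`. -/
def gen {S : Type*} [Ring S] (P0 : Subring S) (a : ℕ → S) (m : ℕ) : Subring S :=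
  Subring.closure ((P0 : Set S) ∪ a '' {t | t < m})

theorem gen_P {S : Type*} [Ring S] {P0 : Subring S} {a : ℕ → S} {m : ℕ} {f : S} (h : f ∈ P0) :
    f ∈ gen P0 a m := Subring.subset_closure (Or.inl h)

theorem gen_a {S : Type*} [Ring S] {P0 : Subring S} {a : ℕ → S} {m t : ℕ} (h : t < m) :
    a t ∈ gen P0 a m := Subring.subset_closure (Or.inr ⟨t, h, rfl⟩)

theorem gen_mono {S : Type*} [Ring S] {P0 P1 : Subring S} {a : ℕ → S} {m m' : ℕ} (hP : P0 ≤ P1)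
    (h : m ≤ m') : gen P0 a m ≤ gen P1 a m' := by
  apply Subring.closure_mono
  apply Set.union_subset_union hP
  apply Set.image_mono
  intro t ht
  exact lt_of_lt_of_le ht h

/-- The additive span of `W(c) b` with `c0 ≤ c ≤ m`. -/
def TT {S : Type*} [Ring S] (P0 : Subring S) (a : ℕ → S) (m c0 : ℕ) : AddSubgroup S :=
  AddSubgroup.closure {z | ∃ c b, c0 ≤ c ∧ c ≤ m ∧ b ∈ gen P0 a (m - 1) ∧ z = Wp a c (m - c) * b}

theorem TT_mono {S : Type*} [Ring S] (P0 : Subring S) (a : ℕ → S) (m : ℕ) {c0 c1 : ℕ}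
    (h : c0 ≤ c1) : TT P0 a m c1 ≤ TT P0 a m c0 := by
  apply AddSubgroup.closure_mono
  rintro z ⟨c, b, h1, h2⟩
  exact ⟨c, b, by omega, h2⟩

theorem TT_base {S : Type*} [Ring S] {P0 : Subring S} {a : ℕ → S} {m c0 c : ℕ} {b : S}
    (h1 : c0 ≤ c) (h2 : c ≤ m) (hb : b ∈ gen P0 a (m - 1)) :
    Wp a c (m - c) * b ∈ TT P0 a m c0 :=
  AddSubgroup.subset_closure ⟨c, b, h1, h2, hb, rfl⟩

theorem TT_right {S : Type*} [Ring S] {P0 : Subring S} {a : ℕ → S} {m c0 : ℕ} {z b : S}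
    (hz : z ∈ TT P0 a m c0) (hb : b ∈ gen P0 a (m - 1)) : z * b ∈ TT P0 a m c0 := by
  induction hz using AddSubgroup.closure_induction with
  | mem z h =>
    obtain ⟨c, b', h1, h2, h3, rfl⟩ := h
    rw [mul_assoc]
    exact TT_base h1 h2 (Subring.mul_mem _ h3 hb)
  | zero => rw [zero_mul]; exact AddSubgroup.zero_mem _
  | add x y _ _ hx hy => rw [add_mul]; exact AddSubgroup.add_mem _ hx hy
  | neg x _ hx => rw [neg_mul]; exact AddSubgroup.neg_mem _ hx

/-- General principle for left multiplication. -/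
theorem TT_left_of {S : Type*} [Ring S] {P0 : Subring S} {a : ℕ → S} {m c0 c1 : ℕ} {q z : S}
    (hq : ∀ c, c0 ≤ c → c ≤ m → q * Wp a c (m - c) ∈ TT P0 a m c1)
    (hz : z ∈ TT P0 a m c0) : q * z ∈ TT P0 a m c1 := by
  induction hz using AddSubgroup.closure_induction with
  | mem z h =>
    obtain ⟨c, b', h1, h2, h3, rfl⟩ := h
    rw [← mul_assoc]
    exact TT_right (hq c h1 h2) h3
  | zero => rw [mul_zero]; exact AddSubgroup.zero_mem _
  | add x y _ _ hx hy => rw [mul_add]; exact AddSubgroup.add_mem _ hx hy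
  | neg x _ hx => rw [mul_neg]; exact AddSubgroup.neg_mem _ hx

theorem Chain.P_W {S : Type*} [Ring S] {P0 : Subring S} {a : ℕ → S} {m : ℕ} (H : Chain P0 a m)
    (d : ℕ) : ∀ c, c + d = m → ∀ f ∈ P0, f * Wp a c (m - c) ∈ TT P0 a m c := by
  induction d with
  | zero =>
    intro c hc f hf
    have : m - c = 0 := by omega
    have h2 : f * Wp a c (m - c) = Wp a c (m - c) * f := by rw [this]; simp [Wp]
    rw [h2]
    exact TT_base le_rfl (by omega) (gen_P hf)
  | succ d ih =>
    intro c hc f hf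
    obtain ⟨f', hf', g, hg, h⟩ := H.left c (by omega) f hf
    have e1 : m - c = (m - (c + 1)) + 1 := by omega
    have e2 : f * Wp a c (m - c) =
        a c * (f' * Wp a (c + 1) (m - (c + 1))) + g * Wp a (c + 1) (m - (c + 1)) := by
      rw [e1, Wp, ← mul_assoc, h, add_mul, mul_assoc]
    rw [e2]
    refine AddSubgroup.add_mem _ ?_ (TT_mono _ _ _ (by omega) (ih (c + 1) (by omega) g hg))
    refine TT_left_of ?_ (ih (c + 1) (by omega) f' hf')
    intro c' h1 h2
    rcases Nat.lt_or_ge (c + 1) c' with h3 | h3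
    · have : a c * Wp a c' (m - c') = Wp a c' (m - c') * a c :=
        Wp_commute a (a c) _ c' (fun t h4 h5 => H.far c t (by omega) (by omega))
      rw [this]
      exact TT_base (by omega) h2 (gen_a (by omega))
    · obtain rfl : c' = c + 1 := by omega
      have : a c * Wp a (c + 1) (m - (c + 1)) = Wp a c (m - c) * 1 := by
        rw [e1, Wp, mul_one]
      rw [this]
      exact TT_base le_rfl (by omega) (Subring.one_mem _)

theorem Chain.P_TT {S : Type*} [Ring S] {P0 : Subring S} {a : ℕ → S} {m c0 : ℕ} (H : Chain P0 a m)
    {f z : S} (hf : f ∈ P0) (hz : z ∈ TT P0 a m c0) : f * z ∈ TT P0 a m c0 :=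
  TT_left_of (fun c h1 h2 => TT_mono _ _ _ h1 (H.P_W (m - c) c (by omega) f hf)) hz

/-- `a_c ⋯ a_{c+d-1}` commutes with far away words, so it preserves deep spans. -/
theorem Chain.W_TT {S : Type*} [Ring S] {P0 : Subring S} {a : ℕ → S} {m : ℕ} (H : Chain P0 a m)
    (c d : ℕ) {c0 : ℕ} (hc : c + d < c0) {z : S} (hz : z ∈ TT P0 a m c0) :
    Wp a c d * z ∈ TT P0 a m c0 := by
  refine TT_left_of ?_ hz
  intro c' h1 h2
  have : Wp a c d * Wp a c' (m - c') = Wp a c' (m - c') * Wp a c d := by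
    apply Wp_commute a _ _ c'
    intro t h4 h5
    apply Commute.symm
    apply Wp_commute
    intro u h6 h7
    exact (H.far u t (by omega) (by omega)).symm
  rw [this]
  refine TT_base h1 h2 (Wp_mem a _ d c fun t h3 h4 => gen_a (by omega))

theorem Chain.a_W {S : Type*} [Ring S] {P0 : Subring S} {a : ℕ → S} {m : ℕ} (H : Chain P0 a m)
    (r c : ℕ) (hr : r < m) (hc : c ≤ m) : a r * Wp a c (m - c) ∈ TT P0 a m 0 := by
  rcases Nat.lt_or_ge (r + 1) c with h | h
  · have : a r * Wp a c (m - c) = Wp a c (m - c) * a r :=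
        Wp_commute a (a r) _ c (fun t h4 h5 => H.far r t (by omega) (by omega))
    rw [this]
    exact TT_base (by omega) hc (gen_a (by omega))
  rcases Nat.lt_or_ge r c with h' | h'
  · obtain rfl : c = r + 1 := by omega
    have : a r * Wp a (r + 1) (m - (r + 1)) = Wp a r (m - r) * 1 := by
      rw [show m - r = (m - (r + 1)) + 1 by omega, Wp, mul_one]
    rw [this]
    exact TT_base (by omega) (by omega) (Subring.one_mem _)
  rcases Nat.lt_or_ge c r with h2 | h2
  · -- c < r
    obtain ⟨D, hD, hbr⟩ := H.braid (r - 1) (by omega)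
    have e0 : r - 1 + 1 = r := by omega
    rw [e0] at hbr
    have e1 : Wp a c (m - c) = Wp a c (r - 1 - c) * (a (r - 1) * (a r * Wp a (r + 1) (m - (r + 1)))) := by
      rw [show m - c = (r - 1 - c) + ((m - (r + 1)) + 1 + 1) by omega, Wp_add,
        show c + (r - 1 - c) = r - 1 by omega, Wp, e0, Wp]
    have e2 : Commute (a r) (Wp a c (r - 1 - c)) :=
      Wp_commute a (a r) _ c (fun t h4 h5 => (H.far t r (by omega) (by omega)).symm)
    have e3 : Commute (a (r - 1)) (Wp a (r + 1) (m - (r + 1))) :=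
      Wp_commute a _ _ _ (fun t h4 h5 => H.far (r-1) t (by omega) (by omega))
    have e4 : a r * Wp a c (m - c) = Wp a c (m - c) * a (r - 1) +
        Wp a c (r - 1 - c) * (D * Wp a (r + 1) (m - (r + 1))) := by
      rw [e1, ← mul_assoc, e2.eq, mul_assoc]
      have : a r * (a (r - 1) * (a r * Wp a (r + 1) (m - (r + 1)))) =
          (a r * a (r - 1) * a r) * Wp a (r + 1) (m - (r + 1)) := by simp only [mul_assoc]
      rw [this, hbr, add_mul, mul_add]
      congr 1
      simp only [mul_assoc]
      rw [e3.eq]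
    rw [e4]
    refine AddSubgroup.add_mem _ (TT_base (by omega) hc (gen_a (by omega))) ?_
    refine TT_mono _ _ _ (Nat.zero_le (r + 1)) ?_
    exact H.W_TT _ _ (by omega) (H.P_W (m - (r + 1)) (r + 1) (by omega) D hD)
  · obtain rfl : c = r := by omega
    rw [show m - c = (m - (c + 1)) + 1 by omega, Wp, ← mul_assoc]
    exact TT_mono _ _ _ (Nat.zero_le (c + 1)) (H.P_W (m - (c + 1)) (c + 1) (by omega) _ (H.sq c hr))

theorem Chain.gen_TT {S : Type*} [Ring S] {P0 : Subring S} {a : ℕ → S} {m : ℕ} (H : Chain P0 a m)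
    {z : S} (hz : z ∈ gen P0 a m) : z ∈ TT P0 a m 0 := by
  have key : ∀ q ∈ gen P0 a m, ∀ z ∈ TT P0 a m 0, q * z ∈ TT P0 a m 0 := by
    intro q hq
    induction hq using Subring.closure_induction with
    | mem x hx =>
      intro z hz
      rcases hx with hx | ⟨t, ht, rfl⟩
      · exact H.P_TT hx hz
      · exact TT_left_of (fun c _ h2 => H.a_W t c ht h2) hz
    | zero => intro z _; rw [zero_mul]; exact AddSubgroup.zero_mem _
    | one => intro z hz; rwa [one_mul]
    | add x y _ _ hx hy => intro z hz; rw [add_mul]; exact AddSubgroup.add_mem _ (hx z hz) (hy z hz)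
    | neg x _ hx => intro z hz; rw [neg_mul]; exact AddSubgroup.neg_mem _ (hx z hz)
    | mul x y _ _ hx hy => intro z hz; rw [mul_assoc]; exact hx _ (hy z hz)
  have h1 : (1 : S) ∈ TT P0 a m 0 := by
    have := TT_base (P0 := P0) (a := a) (m := m) (c0 := 0) (c := m) (b := 1) (by omega) le_rfl
      (Subring.one_mem _)
    simpa [Wp] using this
  simpa using key z hz 1 h1

/-- From additive closure to an explicit sum; works for any additive subgroup `L`
of coefficients. -/
theorem closure_sum {S : Type*} [Ring S] (w : ℕ → S) (m : ℕ) (L : AddSubgroup S) {z : S}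
    (hz : z ∈ AddSubgroup.closure {z | ∃ c b, c ≤ m ∧ b ∈ L ∧ z = w c * b}) :
    ∃ b : ℕ → S, (∀ c, b c ∈ L) ∧ z = ∑ c ∈ Finset.range (m + 1), w c * b c := by
  induction hz using AddSubgroup.closure_induction with
  | mem z h =>
    obtain ⟨c, b, h1, h2, rfl⟩ := h
    refine ⟨fun c' => if c' = c then b else 0, ?_, ?_⟩
    · intro c'
      dsimp only
      split_ifs
      · exact h2
      · exact L.zero_mem
    · rw [Finset.sum_eq_single c]
      · simp
      · intro c' _ h; simp [h]
      · intro h; exact absurd (Finset.mem_range.2 (by omega)) h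
  | zero => exact ⟨fun _ => 0, fun _ => L.zero_mem, by simp⟩
  | add x y _ _ hx hy =>
    obtain ⟨b, hb, rfl⟩ := hx
    obtain ⟨b', hb', rfl⟩ := hy
    exact ⟨fun c => b c + b' c, fun c => L.add_mem (hb c) (hb' c), by
      simp [mul_add, Finset.sum_add_distrib]⟩
  | neg x _ hx =>
    obtain ⟨b, hb, rfl⟩ := hx
    exact ⟨fun c => - b c, fun c => L.neg_mem (hb c), by simp⟩

theorem Chain.span {S : Type*} [Ring S] {P0 : Subring S} {a : ℕ → S} {m : ℕ} (H : Chain P0 a m)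
    {z : S} (hz : z ∈ gen P0 a m) :
    ∃ b : ℕ → S, (∀ c, b c ∈ gen P0 a (m - 1)) ∧
      z = ∑ c ∈ Finset.range (m + 1), Wp a c (m - c) * b c := by
  have := H.gen_TT hz
  refine closure_sum (fun c => Wp a c (m - c)) m (gen P0 a (m - 1)).toAddSubgroup ?_
  refine AddSubgroup.closure_mono ?_ this
  rintro z ⟨c, b, _, h2, h3, h4⟩
  exact ⟨c, b, h2, h3, h4⟩

end NB
end Paper

namespace Paper
namespace NB

/-! ### Part 2: the polynomial ring, and its faithful representation -/

/-- The position `r`. -/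
def pos (n : ℕ) [NeZero n] (r : ℕ) : Fin n := Fin.ofNat n r

theorem pos_val {n : ℕ} [NeZero n] {r : ℕ} (h : r < n) : (pos n r).1 = r := Nat.mod_eq_of_lt h

theorem pos_inj {n : ℕ} [NeZero n] {r s : ℕ} (hr : r < n) (hs : s < n) :
    pos n r = pos n s ↔ r = s := by
  constructor
  · intro h
    have := congrArg Fin.val h
    rwa [pos_val hr, pos_val hs] at this
  · rintro rfl; rfl

theorem pos_fin {n : ℕ} [NeZero n] (t : Fin n) : pos n t.1 = t := Fin.ext (pos_val t.2)

/-- The transposition of the positions `r`, `r + 1`. -/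
def sw (n : ℕ) [NeZero n] (r : ℕ) : Equiv.Perm (Fin n) := Equiv.swap (pos n r) (pos n (r + 1))

theorem sw_left {n : ℕ} [NeZero n] (r : ℕ) : sw n r (pos n r) = pos n (r + 1) :=
  Equiv.swap_apply_left _ _

theorem sw_right {n : ℕ} [NeZero n] (r : ℕ) : sw n r (pos n (r + 1)) = pos n r :=
  Equiv.swap_apply_right _ _

theorem sw_ne {n : ℕ} [NeZero n] {r t : ℕ} (h : r + 1 < n) (ht : t < n) (h1 : t ≠ r)
    (h2 : t ≠ r + 1) : sw n r (pos n t) = pos n t := by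
  apply Equiv.swap_apply_of_ne_of_ne
  · rw [Ne, pos_inj ht (by omega)]; exact h1
  · rw [Ne, pos_inj ht h]; exact h2

theorem sw_sq {n : ℕ} [NeZero n] (r : ℕ) : sw n r * sw n r = 1 := Equiv.swap_mul_self _ _

/-- The transposition on natural numbers. -/
def swn (r t : ℕ) : ℕ := if t = r then r + 1 else if t = r + 1 then r else t

theorem swn_lt {n r t : ℕ} (h : r + 1 < n) (ht : t < n) : swn r t < n := by
  unfold swn; split_ifs <;> omega

theorem sw_apply {n : ℕ} [NeZero n] {r t : ℕ} (h : r + 1 < n) (ht : t < n) :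
    sw n r (pos n t) = pos n (swn r t) := by
  unfold swn
  split_ifs with h1 h2
  · rw [h1, sw_left]
  · rw [h2, sw_right]
  · exact sw_ne h ht h1 h2

theorem sw_far {n : ℕ} [NeZero n] {r s : ℕ} (h : r + 1 < s) (h' : s + 1 < n) :
    sw n r * sw n s = sw n s * sw n r := by
  have hr : r + 1 < n := by omega
  refine Equiv.ext fun t => ?_
  rw [← pos_fin t]
  have ht := t.2
  generalize t.1 = t at ht
  rw [Equiv.Perm.mul_apply, Equiv.Perm.mul_apply, sw_apply hr ht, sw_apply h' ht,
    sw_apply h' (swn_lt hr ht), sw_apply hr (swn_lt h' ht)]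
  congr 1
  unfold swn
  split_ifs <;> omega

theorem sw_braid {n : ℕ} [NeZero n] {r : ℕ} (h : r + 2 < n) :
    sw n r * sw n (r + 1) * sw n r = sw n (r + 1) * sw n r * sw n (r + 1) := by
  have hr : r + 1 < n := by omega
  have hr' : r + 1 + 1 < n := by omega
  refine Equiv.ext fun t => ?_
  rw [← pos_fin t]
  have ht := t.2
  generalize t.1 = t at ht
  simp only [Equiv.Perm.mul_apply]
  rw [sw_apply hr ht, sw_apply hr' ht, sw_apply hr' (swn_lt hr ht), sw_apply hr (swn_lt hr' ht),
    sw_apply hr (swn_lt hr' (swn_lt hr ht)), sw_apply hr' (swn_lt hr (swn_lt hr' ht))]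
  congr 1
  unfold swn
  split_ifs <;> omega

/-- Families of polynomials indexed by residue sequences. -/
abbrev PP (k : Type) [CommRing k] (e n : ℕ) : Type := (Fin n → ZMod e) → MvPolynomial (Fin n) k

section PPsec
variable {k : Type} [CommRing k] {e n : ℕ} [NeZero n]

/-- The action of a permutation. -/
noncomputable def act (σ : Equiv.Perm (Fin n)) : PP k e n →+* PP k e n where
  toFun f := fun i => MvPolynomial.rename σ (f (i ∘ σ))
  map_one' := by funext i; simp
  map_mul' f g := by funext i; simp
  map_zero' := by funext i; simp
  map_add' f g := by funext i; simp

theorem act_apply (σ : Equiv.Perm (Fin n)) (f : PP k e n) (i) :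
    act σ f i = MvPolynomial.rename σ (f (i ∘ σ)) := rfl

theorem act_mul (σ τ : Equiv.Perm (Fin n)) (f : PP k e n) : act (σ * τ) f = act σ (act τ f) := by
  funext i
  rw [act_apply, act_apply, act_apply, MvPolynomial.rename_rename]
  rfl

theorem act_one (f : PP k e n) : act 1 f = f := by
  funext i
  rw [act_apply]
  exact MvPolynomial.rename_id_apply _

theorem act_sw_sw (r : ℕ) (f : PP k e n) : act (sw n r) (act (sw n r) f) = f := by
  rw [← act_mul, sw_sq, act_one]

/-- The variable at position `t`. -/
noncomputable def Yv (k : Type) [CommRing k] (e n : ℕ) [NeZero n] (t : ℕ) : PP k e n :=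
  fun _ => MvPolynomial.X (pos n t)

/-- Scalars. -/
noncomputable def cs (e n : ℕ) [NeZero n] (s : k) : PP k e n := fun _ => MvPolynomial.C s

theorem act_Yv (σ : Equiv.Perm (Fin n)) (t : ℕ) :
    act σ (Yv k e n t) = fun _ => MvPolynomial.X (σ (pos n t)) := by
  funext i
  simp [act_apply, Yv]

theorem act_cs (σ : Equiv.Perm (Fin n)) (s : k) : act σ (cs e n s) = cs e n s := by
  funext i
  simp [act_apply, cs]

/-- Indicator function. -/
noncomputable def ind (k : Type) [CommRing k] {e n : ℕ} (q : (Fin n → ZMod e) → Prop) : PP k e n :=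
  fun i => if q i then 1 else 0

theorem act_ind (σ : Equiv.Perm (Fin n)) (q : (Fin n → ZMod e) → Prop) :
    act σ (ind k q) = ind k fun i => q (i ∘ σ) := by
  funext i
  simp only [act_apply, ind]
  split_ifs <;> simp

/-- The idempotent picking equal residues at `r`, `r+1`. -/
noncomputable def eta (k : Type) [CommRing k] (e n : ℕ) [NeZero n] (r : ℕ) : PP k e n :=
  ind k fun i => i (pos n r) = i (pos n (r + 1))

/-- The factors `θ`. -/
noncomputable def th {e : ℕ} {R : Type} [CommRing R] (w : ZMod e → R) (i j : ZMod e) (u v : R) : R :=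
  if j = i + 1 then u - v + w i else 1

/-- The square of `ψ`. -/
noncomputable def QQ {e : ℕ} {R : Type} [CommRing R] (w : ZMod e → R) (i j : ZMod e) (u v : R) : R :=
  if i = j then 0 else th w i j u v * th w j i v u

/-- The braid defect. -/
noncomputable def DD {e : ℕ} {R : Type} [CommRing R] (wt : ZMod e → R) (i j l : ZMod e)
    (u v w : R) : R :=
  if i = l ∧ i ≠ j then
    (if j = i + 1 then 1 else 0) * th wt j i v u + th wt i j w v * (if i = j + 1 then -1 else 0)
  else 0

/-- The element `Q_r`. -/
noncomputable def Qr (e n : ℕ) [NeZero n] (wt : ZMod e → k) (r : ℕ) : PP k e n := fun i =>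
  QQ (fun a => MvPolynomial.C (wt a)) (i (pos n r)) (i (pos n (r + 1)))
    (MvPolynomial.X (pos n r)) (MvPolynomial.X (pos n (r + 1)))

/-- The element `D_r`. -/
noncomputable def Dr (e n : ℕ) [NeZero n] (wt : ZMod e → k) (r : ℕ) : PP k e n := fun i =>
  DD (fun a => MvPolynomial.C (wt a)) (i (pos n r)) (i (pos n (r + 1))) (i (pos n (r + 2)))
    (MvPolynomial.X (pos n r)) (MvPolynomial.X (pos n (r + 1))) (MvPolynomial.X (pos n (r + 2)))

end PPsec

/-- A ring with a realization of the KLR generators. -/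
structure KRep (k : Type) [CommRing k] (e n : ℕ) [NeZero n] (wt : ZMod e → k) (S : Type)
    [Ring S] where
  c : PP k e n →+* S
  ψ : ℕ → S
  h1 : ∀ r, r + 1 < n → ∀ f g : PP k e n,
    (Yv k e n (r + 1) - Yv k e n r) * g = eta k e n r * (f - act (sw n r) f) →
    ψ r * c f = c (act (sw n r) f) * ψ r + c g
  h2 : ∀ r, r + 1 < n → ψ r * ψ r = c (Qr e n wt r)
  h3 : ∀ r s, r + 1 < s → s + 1 < n → ψ r * ψ s = ψ s * ψ r
  h4 : ∀ r, r + 2 < n → ψ (r + 1) * ψ r * ψ (r + 1) = ψ r * ψ (r + 1) * ψ r + c (Dr e n wt r)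

/-- Parameters for the faithful representation. -/
structure Ctx (k F : Type) [CommRing k] [Field F] (e n : ℕ) where
  wt : ZMod e → k
  φ : MvPolynomial (Fin n) k →+* F
  inj : Function.Injective φ

/-- Points. -/
abbrev Pt (e n : ℕ) : Type := (Fin n → ZMod e) × Equiv.Perm (Fin n)

/-- Moving a point. -/
def mv {e n : ℕ} (p : Pt e n) (σ : Equiv.Perm (Fin n)) : Pt e n := (p.1, p.2 * σ)

theorem mv_mv {e n : ℕ} (p : Pt e n) (σ τ : Equiv.Perm (Fin n)) :
    mv (mv p σ) τ = mv p (σ * τ) := by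
  simp [mv, mul_assoc]

theorem mv_one {e n : ℕ} (p : Pt e n) : mv p 1 = p := by simp [mv]

/-- Residue at a position. -/
def rs {e n : ℕ} [NeZero n] (p : Pt e n) (t : ℕ) : ZMod e := p.1 (p.2 (pos n t))

/-- The representation space endomorphisms. -/
abbrev EE (F : Type) [Field F] (e n : ℕ) : Type := Module.End F (Pt e n → F)

section Real
variable {k F : Type} [CommRing k] [Field F] {e n : ℕ} [NeZero n] (Γ : Ctx k F e n)

/-- The variable at a position. -/
noncomputable def Ctx.vr (p : Pt e n) (t : ℕ) : F := Γ.φ (MvPolynomial.X (p.2 (pos n t)))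

/-- Evaluation at a point. -/
noncomputable def Ctx.ev (p : Pt e n) : PP k e n →+* F :=
  Γ.φ.comp ((Pi.evalRingHom _ p.1).comp (act p.2))

theorem Ctx.ev_apply (p : Pt e n) (f : PP k e n) : Γ.ev p f = Γ.φ (act p.2 f p.1) := rfl

theorem Ctx.ev_act (p : Pt e n) (σ : Equiv.Perm (Fin n)) (f : PP k e n) :
    Γ.ev p (act σ f) = Γ.ev (mv p σ) f := by
  rw [Γ.ev_apply, Γ.ev_apply, mv, act_mul]

theorem Ctx.ev_Yv (p : Pt e n) (t : ℕ) : Γ.ev p (Yv k e n t) = Γ.vr p t := by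
  rw [Γ.ev_apply, act_Yv]; rfl

theorem Ctx.ev_cs (p : Pt e n) (s : k) : Γ.ev p (cs e n s) = Γ.φ (MvPolynomial.C s) := by
  rw [Γ.ev_apply, act_cs]; rfl

theorem Ctx.ev_ind (p : Pt e n) (q : (Fin n → ZMod e) → Prop) :
    Γ.ev p (ind k q) = if q (p.1 ∘ p.2) then 1 else 0 := by
  rw [Γ.ev_apply, act_ind]
  simp only [ind]
  split_ifs <;> simp

theorem Ctx.ev_eta (p : Pt e n) (r : ℕ) :
    Γ.ev p (eta k e n r) = if rs p r = rs p (r + 1) then 1 else 0 := by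
  rw [eta, Γ.ev_ind]
  simp only [rs, Function.comp]
  congr

theorem Ctx.ev_eq_zero (f : PP k e n) (h : ∀ p, Γ.ev p f = 0) : f = 0 := by
  funext i
  have := h (i, 1)
  rw [Γ.ev_apply, act_one] at this
  exact Γ.inj (by rw [this]; simp)

theorem Ctx.ev_eq_zero_iff (p : Pt e n) (f : PP k e n) :
    Γ.ev p f = 0 ↔ f (p.1 ∘ p.2) = 0 := by
  rw [Γ.ev_apply, map_eq_zero_iff _ Γ.inj, act_apply,
    map_eq_zero_iff _ (MvPolynomial.rename_injective _ p.2.injective)]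

theorem th_map {R R' : Type} [CommRing R] [CommRing R'] (g : R →+* R') (w : ZMod e → R)
    (i j : ZMod e) (u v : R) : g (th w i j u v) = th (fun a => g (w a)) i j (g u) (g v) := by
  unfold th; split_ifs <;> simp

theorem QQ_map {R R' : Type} [CommRing R] [CommRing R'] (g : R →+* R') (w : ZMod e → R)
    (i j : ZMod e) (u v : R) : g (QQ w i j u v) = QQ (fun a => g (w a)) i j (g u) (g v) := by
  unfold QQ; split_ifs <;> simp [th_map]

theorem DD_map {R R' : Type} [CommRing R] [CommRing R'] (g : R →+* R') (wt : ZMod e → R)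
    (i j l : ZMod e) (u v w : R) :
    g (DD wt i j l u v w) = DD (fun a => g (wt a)) i j l (g u) (g v) (g w) := by
  unfold DD; split_ifs <;> simp [th_map]

/-- The deformation parameters in `F`. -/
noncomputable def Ctx.wF (a : ZMod e) : F := Γ.φ (MvPolynomial.C (Γ.wt a))

theorem Ctx.ev_Qr (p : Pt e n) (r : ℕ) : Γ.ev p (Qr e n Γ.wt r) =
    QQ Γ.wF (rs p r) (rs p (r + 1)) (Γ.vr p r) (Γ.vr p (r + 1)) := by
  rw [Γ.ev_apply, act_apply, Qr]
  have := QQ_map (e := e) (Γ.φ.comp (MvPolynomial.rename p.2 :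
    MvPolynomial (Fin n) k →ₐ[k] MvPolynomial (Fin n) k).toRingHom)
    (fun a => MvPolynomial.C (Γ.wt a)) (rs p r) (rs p (r + 1)) (MvPolynomial.X (pos n r))
    (MvPolynomial.X (pos n (r + 1)))
  simp only [RingHom.coe_comp, Function.comp, AlgHom.toRingHom_eq_coe, RingHom.coe_coe,
    MvPolynomial.rename_C, MvPolynomial.rename_X] at this
  exact this

theorem Ctx.ev_Dr (p : Pt e n) (r : ℕ) : Γ.ev p (Dr e n Γ.wt r) =
    DD Γ.wF (rs p r) (rs p (r + 1)) (rs p (r + 2)) (Γ.vr p r) (Γ.vr p (r + 1))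
      (Γ.vr p (r + 2)) := by
  rw [Γ.ev_apply, act_apply, Dr]
  have := DD_map (e := e) (Γ.φ.comp (MvPolynomial.rename p.2 :
    MvPolynomial (Fin n) k →ₐ[k] MvPolynomial (Fin n) k).toRingHom)
    (fun a => MvPolynomial.C (Γ.wt a)) (rs p r) (rs p (r + 1)) (rs p (r + 2))
    (MvPolynomial.X (pos n r)) (MvPolynomial.X (pos n (r + 1))) (MvPolynomial.X (pos n (r + 2)))
  simp only [RingHom.coe_comp, Function.comp, AlgHom.toRingHom_eq_coe, RingHom.coe_coe,
    MvPolynomial.rename_C, MvPolynomial.rename_X] at this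
  exact this

/-- Multiplication operators. -/
noncomputable def Ctx.cE : PP k e n →+* EE F e n where
  toFun f := 
    { toFun := fun μ p => Γ.ev p f * μ p
      map_add' := by intro a b; funext p; simp [mul_add]
      map_smul' := by intro a b; funext p; simp [mul_left_comm] }
  map_one' := by
    refine LinearMap.ext fun μ => funext fun p => ?_
    simp
  map_mul' f g := by
    refine LinearMap.ext fun μ => funext fun p => ?_
    simp [Module.End.mul_apply, mul_assoc]
  map_zero' := by 
    refine LinearMap.ext fun μ => funext fun p => ?_
    simp
  map_add' f g := by
    refine LinearMap.ext fun μ => funext fun p => ?_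
    simp [add_mul]

theorem Ctx.cE_apply (f : PP k e n) (μ : Pt e n → F) (p : Pt e n) :
    Γ.cE f μ p = Γ.ev p f * μ p := rfl

/-- Coefficient `α`. -/
noncomputable def al (i j : ZMod e) (u v : F) : F := if i = j then (v - u)⁻¹ else 0

/-- Coefficient `β`. -/
noncomputable def be (w : ZMod e → F) (i j : ZMod e) (u v : F) : F :=
  if i = j then -(v - u)⁻¹ else th w i j u v

/-- `α` at a point. -/
noncomputable def Ctx.alp (r : ℕ) (p : Pt e n) : F :=
  al (rs p r) (rs p (r + 1)) (Γ.vr p r) (Γ.vr p (r + 1))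

/-- `β` at a point. -/
noncomputable def Ctx.bet (r : ℕ) (p : Pt e n) : F :=
  be Γ.wF (rs p r) (rs p (r + 1)) (Γ.vr p r) (Γ.vr p (r + 1))

/-- The operators `ψ`. -/
noncomputable def Ctx.psi (r : ℕ) : EE F e n where
  toFun := fun μ p => Γ.alp r p * μ p + Γ.bet r p * μ (mv p (sw n r))
  map_add' := by intro a b; funext p; simp; ring
  map_smul' := by intro a b; funext p; simp; ring

theorem Ctx.psi_apply (r : ℕ) (μ : Pt e n → F) (p : Pt e n) :
    Γ.psi r μ p = Γ.alp r p * μ p + Γ.bet r p * μ (mv p (sw n r)) := rfl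

theorem rs_mv (p : Pt e n) (σ : Equiv.Perm (Fin n)) (t t' : ℕ) (h : σ (pos n t) = pos n t') :
    rs (mv p σ) t = rs p t' := by
  simp [rs, mv, h]

theorem Ctx.vr_mv (p : Pt e n) (σ : Equiv.Perm (Fin n)) (t t' : ℕ) (h : σ (pos n t) = pos n t') :
    Γ.vr (mv p σ) t = Γ.vr p t' := by
  simp [Ctx.vr, mv, h]

theorem Ctx.vr_inj [Nontrivial k] (p : Pt e n) {t t' : ℕ} (h : t < n) (h' : t' < n) (hne : t ≠ t') :
    Γ.vr p t - Γ.vr p t' ≠ 0 := by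
  rw [sub_ne_zero]
  intro h2
  have h3 := Γ.inj h2
  have h4 := MvPolynomial.X_injective h3
  exact hne ((pos_inj h h').1 (p.2.injective h4))

theorem Ctx.bet_ne [Nontrivial k] (p : Pt e n) {r : ℕ} (h : r + 1 < n) : Γ.bet r p ≠ 0 := by
  have h0 := Γ.vr_inj p (t := r + 1) (t' := r) h (by omega) (by omega)
  unfold Ctx.bet be th
  split_ifs
  · exact neg_ne_zero.2 (inv_ne_zero h0)
  · intro h2
    have hu : p.2 (pos n r) ≠ p.2 (pos n (r + 1)) := by
      intro h5
      have := (pos_inj (by omega) h).1 (p.2.injective h5)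
      omega
    have h3 : Γ.φ (MvPolynomial.X (p.2 (pos n r)) - MvPolynomial.X (p.2 (pos n (r + 1))) +
      MvPolynomial.C (Γ.wt (rs p r))) = 0 := by
      rw [map_add, map_sub]; exact h2
    have h4 := Γ.inj (h3.trans (map_zero Γ.φ).symm)
    have h5 := congrArg (MvPolynomial.coeff (Finsupp.single (p.2 (pos n r)) 1)) h4
    simp [MvPolynomial.coeff_X, MvPolynomial.coeff_C, Finsupp.single_left_inj, hu.symm] at h5
    rw [if_neg (by intro h6; have := DFunLike.congr_fun h6 (p.2 (pos n r)); simp at this)] at h5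
    simp at h5
  · exact one_ne_zero

theorem rs_sw_l (p : Pt e n) (r : ℕ) : rs (mv p (sw n r)) r = rs p (r + 1) :=
  rs_mv _ _ _ _ (sw_left r)
theorem rs_sw_r (p : Pt e n) (r : ℕ) : rs (mv p (sw n r)) (r + 1) = rs p r :=
  rs_mv _ _ _ _ (sw_right r)
theorem rs_sw_ne (p : Pt e n) {r t : ℕ} (h : r + 1 < n) (ht : t < n) (h1 : t ≠ r)
    (h2 : t ≠ r + 1) : rs (mv p (sw n r)) t = rs p t :=
  rs_mv _ _ _ _ (sw_ne h ht h1 h2)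
theorem Ctx.vr_sw_l (p : Pt e n) (r : ℕ) : Γ.vr (mv p (sw n r)) r = Γ.vr p (r + 1) :=
  Γ.vr_mv _ _ _ _ (sw_left r)
theorem Ctx.vr_sw_r (p : Pt e n) (r : ℕ) : Γ.vr (mv p (sw n r)) (r + 1) = Γ.vr p r :=
  Γ.vr_mv _ _ _ _ (sw_right r)
theorem Ctx.vr_sw_ne (p : Pt e n) {r t : ℕ} (h : r + 1 < n) (ht : t < n) (h1 : t ≠ r)
    (h2 : t ≠ r + 1) : Γ.vr (mv p (sw n r)) t = Γ.vr p t :=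
  Γ.vr_mv _ _ _ _ (sw_ne h ht h1 h2)

theorem mv_sw_sw (p : Pt e n) (r : ℕ) : mv (mv p (sw n r)) (sw n r) = p := by
  rw [mv_mv, sw_sq, mv_one]

theorem al_swap (i j : ZMod e) (u v : F) : al j i v u = - al i j u v := by
  unfold al
  by_cases h : i = j
  · rw [if_pos h, if_pos h.symm, ← inv_neg]; congr 1; ring
  · rw [if_neg h, if_neg (Ne.symm h), neg_zero]

theorem albe (w : ZMod e → F) (i j : ZMod e) (u v : F) :
    al i j u v * al i j u v + be w i j u v * be w j i v u = QQ w i j u v := by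
  unfold al be QQ
  by_cases h : i = j
  · rw [if_pos h, if_pos h, if_pos h.symm, if_pos h]
    rw [show u - v = -(v - u) by ring, inv_neg]; ring
  · rw [if_neg h, if_neg h, if_neg (Ne.symm h), if_neg h]; ring

theorem braid_id1 (w : ZMod e → F) (i j l : ZMod e) (u v z : F) (h1 : v - u ≠ 0)
    (h2 : z - u ≠ 0) (h3 : z - v ≠ 0) :
    al j l v z * al i j u v * al j l v z + be w j l v z * al i l u z * be w l j z v =
    al i j u v * al j l v z * al i j u v + be w i j u v * al i l u z * be w j i v u
      + DD w i j l u v z := by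
  have e1 : v - z ≠ 0 := by intro h; apply h3; linear_combination -h
  have e2 : u - v ≠ 0 := by intro h; apply h1; linear_combination -h
  unfold al be DD
  by_cases hij : i = j
  · subst hij
    by_cases hil : i = l
    · subst hil
      simp
      field_simp
      ring
    · simp [hil, Ne.symm hil]
  · by_cases hil : i = l
    · subst hil
      simp only [hij, Ne.symm hij, if_true, if_false, ne_eq, not_false_eq_true, and_self]
      unfold th
      field_simp
      by_cases q1 : j = i + 1
      · by_cases q2 : i = j + 1
        · simp only [if_pos q1, if_pos q2]; ring
        · simp only [if_pos q1, if_neg q2]; ring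
      · by_cases q2 : i = j + 1
        · simp only [if_neg q1, if_pos q2]; ring
        · simp only [if_neg q1, if_neg q2]; ring
    · simp [hij, hil]

theorem braid_id2 (w : ZMod e → F) (i j l : ZMod e) (u v z : F) (h1 : v - u ≠ 0)
    (h2 : z - u ≠ 0) (h3 : z - v ≠ 0) :
    al j l v z * be w i j u v * al i l u z =
      al i j u v * al j l v z * be w i j u v + be w i j u v * al i l u z * al j i v u := by
  have e2 : u - v ≠ 0 := by intro h; apply h1; linear_combination -h
  unfold al be
  by_cases hij : i = j
  · subst hij
    by_cases hil : i = l
    · subst hil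
      simp
      field_simp
      ring
    · simp [hil]
  · by_cases hil : i = l
    · subst hil
      simp [hij, Ne.symm hij]
    · simp [hij, hil, Ne.symm hij]

theorem braid_id3 (w : ZMod e → F) (i j l : ZMod e) (u v z : F) (h1 : v - u ≠ 0)
    (h2 : z - u ≠ 0) (h3 : z - v ≠ 0) :
    al j l v z * al i j u v * be w j l v z + be w j l v z * al i l u z * al l j z v =
      al i j u v * be w j l v z * al i l u z := by
  have e1 : v - z ≠ 0 := by intro h; apply h3; linear_combination -h
  unfold al be
  by_cases hij : i = j
  · subst hij
    by_cases hil : i = l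
    · subst hil
      simp
      field_simp
      ring
    · simp [hil, Ne.symm hil]
  · by_cases hil : i = l
    · subst hil
      simp [hij, Ne.symm hij]
    · simp [hij, hil]

/-- The faithful representation. -/
noncomputable def Ctx.rep [IsDomain k] : KRep k e n Γ.wt (EE F e n) where
  c := Γ.cE
  ψ := Γ.psi
  h1 r hr f g hfg := by
    refine LinearMap.ext fun μ => funext fun p => ?_
    simp only [Module.End.mul_apply, LinearMap.add_apply, Pi.add_apply, Γ.psi_apply, Γ.cE_apply,
      Γ.ev_act]
    have h := congrArg (Γ.ev p) hfg
    rw [map_mul, map_mul, map_sub, map_sub, Γ.ev_act, Γ.ev_Yv, Γ.ev_Yv, Γ.ev_eta] at h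
    have h0 := Γ.vr_inj p (t := r + 1) (t' := r) hr (by omega) (by omega)
    have h5 : Γ.ev p g = Γ.alp r p * (Γ.ev p f - Γ.ev (mv p (sw n r)) f) := by
      unfold Ctx.alp al
      split_ifs at h ⊢ with h6
      · field_simp
        linear_combination h
      · rw [zero_mul] at h ⊢
        exact (mul_eq_zero.1 h).resolve_left h0
    rw [h5]; ring
  h2 r hr := by
    refine LinearMap.ext fun μ => funext fun p => ?_
    simp only [Module.End.mul_apply, Γ.psi_apply, Γ.cE_apply, mv_sw_sw, Γ.ev_Qr]
    rw [← albe]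
    simp only [Ctx.alp, Ctx.bet, rs_sw_l, rs_sw_r, Γ.vr_sw_l, Γ.vr_sw_r]
    rw [al_swap (rs p r) (rs p (r + 1))]
    ring
  h3 r s hrs hs := by
    refine LinearMap.ext fun μ => funext fun p => ?_
    simp only [Module.End.mul_apply, Γ.psi_apply, mv_mv, sw_far hrs hs]
    have e1 : Γ.alp r (mv p (sw n s)) = Γ.alp r p := by
      simp only [Ctx.alp]
      rw [rs_sw_ne _ hs (by omega) (by omega) (by omega), rs_sw_ne _ hs (by omega) (by omega)
        (by omega), Γ.vr_sw_ne _ hs (by omega) (by omega) (by omega), Γ.vr_sw_ne _ hs (by omega)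
        (by omega) (by omega)]
    have e2 : Γ.bet r (mv p (sw n s)) = Γ.bet r p := by
      simp only [Ctx.bet]
      rw [rs_sw_ne _ hs (by omega) (by omega) (by omega), rs_sw_ne _ hs (by omega) (by omega)
        (by omega), Γ.vr_sw_ne _ hs (by omega) (by omega) (by omega), Γ.vr_sw_ne _ hs (by omega)
        (by omega) (by omega)]
    have hr : r + 1 < n := by omega
    have e3 : Γ.alp s (mv p (sw n r)) = Γ.alp s p := by
      simp only [Ctx.alp]
      rw [rs_sw_ne _ hr (by omega) (by omega) (by omega), rs_sw_ne _ hr (by omega) (by omega)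
        (by omega), Γ.vr_sw_ne _ hr (by omega) (by omega) (by omega), Γ.vr_sw_ne _ hr (by omega)
        (by omega) (by omega)]
    have e4 : Γ.bet s (mv p (sw n r)) = Γ.bet s p := by
      simp only [Ctx.bet]
      rw [rs_sw_ne _ hr (by omega) (by omega) (by omega), rs_sw_ne _ hr (by omega) (by omega)
        (by omega), Γ.vr_sw_ne _ hr (by omega) (by omega) (by omega), Γ.vr_sw_ne _ hr (by omega)
        (by omega) (by omega)]
    rw [e1, e2, e3, e4]
    ring
  h4 r hr := by
    refine LinearMap.ext fun μ => funext fun p => ?_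
    have hr1 : r + 1 < n := by omega
    have hr2 : r + 1 + 1 < n := by omega
    have a1 : ∀ p : Pt e n, rs (mv p (sw n r)) (r + 1 + 1) = rs p (r + 1 + 1) := fun p =>
      rs_sw_ne _ hr1 (by omega) (by omega) (by omega)
    have a2 : ∀ p : Pt e n, rs (mv p (sw n (r + 1))) r = rs p r := fun p =>
      rs_sw_ne _ hr2 (by omega) (by omega) (by omega)
    have a3 : ∀ p : Pt e n, Γ.vr (mv p (sw n r)) (r + 1 + 1) = Γ.vr p (r + 1 + 1) := fun p =>
      Γ.vr_sw_ne _ hr1 (by omega) (by omega) (by omega)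
    have a4 : ∀ p : Pt e n, Γ.vr (mv p (sw n (r + 1))) r = Γ.vr p r := fun p =>
      Γ.vr_sw_ne _ hr2 (by omega) (by omega) (by omega)
    have d1 := Γ.vr_inj p (t := r + 1) (t' := r) hr1 (by omega) (by omega)
    have d2 := Γ.vr_inj p (t := r + 1 + 1) (t' := r) hr2 (by omega) (by omega)
    have d3 := Γ.vr_inj p (t := r + 1 + 1) (t' := r + 1) hr2 (by omega) (by omega)
    have b1 := braid_id1 Γ.wF (rs p r) (rs p (r + 1)) (rs p (r + 1 + 1)) _ _ _ d1 d2 d3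
    have b2 := braid_id2 Γ.wF (rs p r) (rs p (r + 1)) (rs p (r + 1 + 1)) _ _ _ d1 d2 d3
    have b3 := braid_id3 Γ.wF (rs p r) (rs p (r + 1)) (rs p (r + 1 + 1)) _ _ _ d1 d2 d3
    simp only [Module.End.mul_apply, LinearMap.add_apply, Pi.add_apply, Γ.psi_apply, Γ.cE_apply,
      mv_sw_sw, Γ.ev_Dr, Ctx.alp, Ctx.bet, rs_sw_l, rs_sw_r, Γ.vr_sw_l, Γ.vr_sw_r, a1, a2, a3, a4]
    have m1 : mv (mv (mv p (sw n (r + 1))) (sw n r)) (sw n (r + 1)) =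
        mv (mv (mv p (sw n r)) (sw n (r + 1))) (sw n r) := by
      rw [mv_mv, mv_mv, mv_mv, mv_mv, ← mul_assoc, ← mul_assoc, sw_braid hr]
    rw [m1]
    linear_combination μ p * b1 + μ (mv p (sw n r)) * b2 + μ (mv p (sw n (r + 1))) * b3

end Real

end NB
end Paper

namespace Paper
namespace NB

/-! ### Part 3: freeness -/

section DDsec
variable {k : Type} [CommRing k] {e n : ℕ} [NeZero n]

theorem dd_poly (r : ℕ) (f : MvPolynomial (Fin n) k) :
    ∃ g, (MvPolynomial.X (pos n (r + 1)) - MvPolynomial.X (pos n r)) * g =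
      f - MvPolynomial.rename (sw n r) f := by
  induction f using MvPolynomial.induction_on with
  | C a => exact ⟨0, by simp⟩
  | add p q hp hq =>
    obtain ⟨g, hg⟩ := hp
    obtain ⟨g', hg'⟩ := hq
    exact ⟨g + g', by rw [mul_add, hg, hg', map_add]; ring⟩
  | mul_X p t hp =>
    obtain ⟨g, hg⟩ := hp
    by_cases h1 : t = pos n r
    · subst h1
      refine ⟨g * MvPolynomial.X (pos n r) - MvPolynomial.rename (sw n r) p, ?_⟩
      rw [map_mul, MvPolynomial.rename_X, sw_left]
      linear_combination MvPolynomial.X (pos n r) * hg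
    · by_cases h2 : t = pos n (r + 1)
      · subst h2
        refine ⟨g * MvPolynomial.X (pos n (r + 1)) + MvPolynomial.rename (sw n r) p, ?_⟩
        rw [map_mul, MvPolynomial.rename_X, sw_right]
        linear_combination MvPolynomial.X (pos n (r + 1)) * hg
      · refine ⟨g * MvPolynomial.X t, ?_⟩
        have h3 : sw n r t = t := Equiv.swap_apply_of_ne_of_ne h1 h2
        rw [map_mul, MvPolynomial.rename_X, h3]
        linear_combination MvPolynomial.X t * hg

theorem comp_sw_eq {r : ℕ} {i : Fin n → ZMod e} (h : i (pos n r) = i (pos n (r + 1))) :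
    i ∘ sw n r = i := by
  funext t
  simp only [Function.comp, sw, Equiv.swap_apply_def]
  split_ifs with h1 h2
  · rw [h1, h]
  · rw [h2, h]
  · rfl

theorem dd_exists (r : ℕ) (f : PP k e n) : ∃ g : PP k e n,
    (Yv k e n (r + 1) - Yv k e n r) * g = eta k e n r * (f - act (sw n r) f) := by
  choose g hg using fun i => dd_poly (n := n) r (f i)
  refine ⟨fun i => if i (pos n r) = i (pos n (r + 1)) then g i else 0, ?_⟩
  funext i
  simp only [Pi.mul_apply, Pi.sub_apply, Yv, eta, ind, act_apply]
  split_ifs with h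
  · rw [hg, one_mul, comp_sw_eq h]
  · simp

theorem Yv_sub_cancel [IsDomain k] {r s : ℕ} (hr : r < n) (hs : s < n) (hne : r ≠ s)
    {f g : PP k e n} (h : (Yv k e n r - Yv k e n s) * f = (Yv k e n r - Yv k e n s) * g) :
    f = g := by
  funext i
  have := congrFun h i
  simp only [Pi.mul_apply, Pi.sub_apply, Yv] at this
  refine mul_left_cancel₀ ?_ this
  rw [sub_ne_zero]
  intro h2
  exact hne ((pos_inj hr hs).1 (MvPolynomial.X_injective h2))

end DDsec

section KR
variable {k : Type} [CommRing k] {e n : ℕ} [NeZero n] {wt : ZMod e → k} {S : Type} [Ring S]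

theorem KRep.cpsi (H : KRep k e n wt S) {r : ℕ} (hr : r + 1 < n) (f : PP k e n) :
    ∃ g : PP k e n, (Yv k e n (r + 1) - Yv k e n r) * g = eta k e n r * (f - act (sw n r) f) ∧
      H.c f * H.ψ r = H.ψ r * H.c (act (sw n r) f) + H.c g := by
  obtain ⟨g, hg⟩ := dd_exists r (act (sw n r) f)
  refine ⟨-g, ?_, ?_⟩
  · rw [mul_neg, hg, act_sw_sw]; ring
  · rw [H.h1 r hr _ g hg, act_sw_sw, map_neg]; abel

theorem KRep.cpsi_fix (H : KRep k e n wt S) {r : ℕ} (hr : r + 1 < n) (f : PP k e n)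
    (hf : act (sw n r) f = f) : H.c f * H.ψ r = H.ψ r * H.c f := by
  have := H.h1 r hr f 0 (by rw [hf]; simp)
  rw [this, hf, map_zero, add_zero]

/-- Stable subrings of polynomials. -/
structure Stab (wt : ZMod e → k) (R0 : Subring (PP k e n)) (r : ℕ) : Prop where
  lt : r + 1 < n
  act : ∀ f ∈ R0, act (sw n r) f ∈ R0
  dd : ∀ f ∈ R0, ∀ g, (Yv k e n (r + 1) - Yv k e n r) * g = eta k e n r * (f - NB.act (sw n r) f) →
    g ∈ R0
  Q : Qr e n wt r ∈ R0

/-- Forward chains. -/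
theorem KRep.chainF (H : KRep k e n wt S) (R0 : Subring (PP k e n)) (o m : ℕ)
    (hst : ∀ t, t < m → Stab wt R0 (o + t)) (hD : ∀ t, t + 1 < m → Dr e n wt (o + t) ∈ R0) :
    Chain (R0.map H.c) (fun t => H.ψ (o + t)) m where
  left t ht f hf := by
    obtain ⟨f, hf, rfl⟩ := hf
    obtain ⟨g, hg, h⟩ := H.cpsi (hst t ht).lt f
    exact ⟨_, ⟨_, (hst t ht).act f hf, rfl⟩, _, ⟨g, (hst t ht).dd f hf g hg, rfl⟩, h⟩
  sq t ht := ⟨_, (hst t ht).Q, (H.h2 _ (hst t ht).lt).symm⟩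
  far t u h1 h2 := H.h3 _ _ (by omega) (hst u h2).lt
  braid t ht := ⟨_, ⟨_, hD t ht, rfl⟩, H.h4 _ (by have := (hst (t+1) ht).lt; omega)⟩

/-- Backward chains. -/
theorem KRep.chainB (H : KRep k e n wt S) (R0 : Subring (PP k e n)) (m : ℕ)
    (hst : ∀ t, t < m → Stab wt R0 t) (hD : ∀ t, t + 1 < m → Dr e n wt t ∈ R0) :
    Chain (R0.map H.c) (fun t => H.ψ (m - 1 - t)) m where
  left t ht f hf := by
    have h0 := hst (m - 1 - t) (by omega)
    obtain ⟨f, hf, rfl⟩ := hf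
    obtain ⟨g, hg, h⟩ := H.cpsi h0.lt f
    exact ⟨_, ⟨_, h0.act f hf, rfl⟩, _, ⟨g, h0.dd f hf g hg, rfl⟩, h⟩
  sq t ht := by
    have h0 := hst (m - 1 - t) (by omega)
    exact ⟨_, h0.Q, (H.h2 _ h0.lt).symm⟩
  far t u h1 h2 := (H.h3 _ _ (by omega) (hst _ (by omega)).lt).symm
  braid t ht := by
    refine ⟨_, ⟨-Dr e n wt (m - 1 - (t + 1)), neg_mem (hD _ (by omega)), rfl⟩, ?_⟩
    have h1 := (hst (m - 1 - t) (by omega)).lt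
    have := H.h4 (m - 1 - (t + 1)) (by omega)
    rw [show m - 1 - (t + 1) + 1 = m - 1 - t by omega] at this
    rw [this, map_neg]; abel

theorem stab_top (r : ℕ) (h : r + 1 < n) : Stab wt (⊤ : Subring (PP k e n)) r where
  lt := h
  act _ _ := Subring.mem_top _
  dd _ _ _ _ := Subring.mem_top _
  Q := Subring.mem_top _

/-- The subring of polynomials. -/
noncomputable def KRep.P (H : KRep k e n wt S) : Subring S := (⊤ : Subring (PP k e n)).map H.c

theorem KRep.c_mem (H : KRep k e n wt S) (f : PP k e n) : H.c f ∈ H.P := ⟨f, Subring.mem_top _, rfl⟩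

theorem KRep.chF (H : KRep k e n wt S) (o m : ℕ) (h : o + m + 1 ≤ n) :
    Chain H.P (fun t => H.ψ (o + t)) m :=
  H.chainF ⊤ o m (fun t ht => stab_top _ (by omega)) (fun _ _ => Subring.mem_top _)

theorem KRep.chB (H : KRep k e n wt S) (m : ℕ) (h : m + 1 ≤ n) :
    Chain H.P (fun t => H.ψ (m - 1 - t)) m :=
  H.chainB ⊤ m (fun t ht => stab_top _ (by omega)) (fun _ _ => Subring.mem_top _)

end KR

theorem gen_zero {S : Type} [Ring S] (P0 : Subring S) (a : ℕ → S) : gen P0 a 0 = P0 := by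
  unfold gen
  have : a '' {t | t < 0} = ∅ := by simp
  rw [this, Set.union_empty, Subring.closure_eq]

section Free
variable {k F : Type} [CommRing k] [IsDomain k] [Field F] {e n : ℕ} [NeZero n] (Γ : Ctx k F e n)

/-- Vanishing when the particle `x` is at position `q`. -/
def van (q : ℕ) (x : Fin n) (μ : Pt e n → F) : Prop := ∀ p : Pt e n, p.2 (pos n q) = x → μ p = 0

/-- Operators preserving the particle at position `q`. -/
def Loc (F : Type) [Field F] (e n : ℕ) [NeZero n] (q : ℕ) : Subring (EE F e n) where
  carrier := {b | ∀ x μ, van q x μ → van q x (b μ)}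
  mul_mem' {a b} ha hb := fun x μ h => ha x _ (hb x μ h)
  one_mem' := fun x μ h => h
  add_mem' {a b} ha hb := fun x μ h p hp => by
    rw [LinearMap.add_apply, Pi.add_apply, ha x μ h p hp, hb x μ h p hp, add_zero]
  zero_mem' := fun x μ h p hp => by simp
  neg_mem' {a} ha := fun x μ h p hp => by
    rw [LinearMap.neg_apply, Pi.neg_apply, ha x μ h p hp, neg_zero]

theorem Ctx.cE_Loc (q : ℕ) (f : PP k e n) : Γ.cE f ∈ Loc F e n q := fun x μ h p hp => by
  rw [Γ.cE_apply, h p hp, mul_zero]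

theorem Ctx.psi_Loc {q r : ℕ} (hr : r + 1 < n) (hq : q < n) (h1 : q ≠ r) (h2 : q ≠ r + 1) :
    Γ.psi r ∈ Loc F e n q := fun x μ h p hp => by
  rw [Γ.psi_apply, h p hp, h (mv p (sw n r)), mul_zero, mul_zero, add_zero]
  rw [mv, Equiv.Perm.mul_apply, sw_ne hr hq h1 h2, hp]

theorem Ctx.van_psi {r q q' : ℕ} (hr : r + 1 < n)
    (hqq : (q = r ∧ q' = r + 1) ∨ (q = r + 1 ∧ q' = r)) (x : Fin n) (μ : Pt e n → F)
    (h1 : van q x μ) (h2 : van q x (Γ.psi r μ)) : van q' x μ := fun p hp => by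
  have h3 : sw n r (pos n q) = pos n q' := by
    rcases hqq with ⟨rfl, rfl⟩ | ⟨rfl, rfl⟩
    · exact sw_left _
    · exact sw_right _
  have h4 : (mv p (sw n r)).2 (pos n q) = x := by
    rw [mv, Equiv.Perm.mul_apply, h3, hp]
  have h5 := h2 _ h4
  rw [Γ.psi_apply, h1 _ h4, mul_zero, zero_add, mv_sw_sw] at h5
  exact (mul_eq_zero.1 h5).resolve_left (Γ.bet_ne _ hr)

theorem Ctx.van_W (idx kk : ℕ → ℕ) (m : ℕ) (hidx : ∀ t, t < m → idx t + 1 < n)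
    (hk : ∀ t, t < m → (kk t = idx t ∧ kk (t + 1) = idx t + 1) ∨
      (kk t = idx t + 1 ∧ kk (t + 1) = idx t))
    (hlt : ∀ t, t ≤ m → kk t < n) (hinj : ∀ t t', t < t' → t' ≤ m → kk t ≠ kk t')
    (x : Fin n) (μ : Pt e n → F) (hμ : ∀ p : Pt e n, p.2 (pos n (kk m)) ≠ x → μ p = 0) (d : ℕ) :
    ∀ c, c + d = m → van (kk c) x (Wp (fun t => Γ.psi (idx t)) c d μ) → van (kk m) x μ := by
  induction d with
  | zero => rintro c rfl h; exact h
  | succ d ih =>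
    intro c hc h
    refine ih (c + 1) (by omega) ?_
    have h0 : van (kk c) x (Wp (fun t => Γ.psi (idx t)) (c + 1) d μ) := by
      have hL : Wp (fun t => Γ.psi (idx t)) (c + 1) d ∈ Loc F e n (kk c) := by
        refine Wp_mem _ _ _ _ fun t h1 h2 => Γ.psi_Loc (hidx t (by omega)) (hlt c (by omega)) ?_ ?_
        · have e1 := hinj c t (by omega) (by omega)
          have e2 := hinj c (t + 1) (by omega) (by omega)
          have e3 := hk t (by omega)
          omega
        · have e1 := hinj c t (by omega) (by omega)
          have e2 := hinj c (t + 1) (by omega) (by omega)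
          have e3 := hk t (by omega)
          omega
      refine hL x μ fun p hp => hμ p ?_
      rw [← hp]
      intro h2
      have h3 := p.2.injective h2
      rw [pos_inj (hlt m le_rfl) (hlt c (by omega))] at h3
      exact hinj c m (by omega) le_rfl h3.symm
    exact Γ.van_psi (hidx c (by omega)) (hk c (by omega)) x _ h0 h

theorem Ctx.free (idx kk : ℕ → ℕ) (m : ℕ) (hidx : ∀ t, t < m → idx t + 1 < n)
    (hk : ∀ t, t < m → (kk t = idx t ∧ kk (t + 1) = idx t + 1) ∨
      (kk t = idx t + 1 ∧ kk (t + 1) = idx t))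
    (hlt : ∀ t, t ≤ m → kk t < n) (hinj : ∀ t t', t < t' → t' ≤ m → kk t ≠ kk t')
    (b : ℕ → EE F e n) (hb : ∀ c, b c ∈ Loc F e n (kk m))
    (h : ∑ c ∈ Finset.range (m + 1), Wp (fun t => Γ.psi (idx t)) c (m - c) * b c = 0) :
    ∀ c, c ≤ m → b c = 0 := by
  intro c
  induction c using Nat.strong_induction_on with
  | _ c ih =>
    intro hc
    have key : ∀ (μ : Pt e n → F) (x : Fin n), (∀ p : Pt e n, p.2 (pos n (kk m)) ≠ x → μ p = 0) →
        van (kk m) x (b c μ) := by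
      intro μ x hμ
      have hs : ∀ c', ∀ p : Pt e n, p.2 (pos n (kk m)) ≠ x → b c' μ p = 0 := by
        intro c' p hp
        exact hb c' (p.2 (pos n (kk m))) μ (fun p' hp' => hμ p' (by rw [hp']; exact hp)) p rfl
      refine Γ.van_W idx kk m hidx hk hlt hinj x (b c μ) (hs c) (m - c) c (by omega) ?_
      intro p hp
      have h1 := congrFun (LinearMap.congr_fun h μ) p
      rw [LinearMap.sum_apply, Finset.sum_apply, Finset.sum_eq_single c] at h1
      · exact h1
      · intro c' hc' hne
        rw [Finset.mem_range] at hc'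
        rcases Nat.lt_or_ge c' c with h2 | h2
        · rw [ih c' h2 (by omega), mul_zero]; rfl
        · have hL : Wp (fun t => Γ.psi (idx t)) c' (m - c') ∈ Loc F e n (kk c) := by
            refine Wp_mem _ _ _ _ fun t h1 h2 =>
              Γ.psi_Loc (hidx t (by omega)) (hlt c (by omega)) ?_ ?_
            · have e1 := hinj c t (by omega) (by omega)
              have e2 := hinj c (t + 1) (by omega) (by omega)
              have e3 := hk t (by omega)
              omega
            · have e1 := hinj c t (by omega) (by omega)
              have e2 := hinj c (t + 1) (by omega) (by omega)
              have e3 := hk t (by omega)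
              omega
          refine hL x (b c' μ) (fun p' hp' => hs c' p' ?_) p hp
          rw [← hp']
          intro h2
          have h3 := p'.2.injective h2
          rw [pos_inj (hlt m le_rfl) (hlt c (by omega))] at h3
          exact hinj c m (by omega) le_rfl h3.symm
      · intro h3; exact absurd (Finset.mem_range.2 (by omega)) h3
    refine LinearMap.ext fun μ => funext fun p => ?_
    have e1 : μ = (fun p' => if p'.2 (pos n (kk m)) = p.2 (pos n (kk m)) then μ p' else 0) +
        (fun p' => if p'.2 (pos n (kk m)) = p.2 (pos n (kk m)) then 0 else μ p') := by
      funext p'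
      simp only [Pi.add_apply]
      split_ifs <;> simp
    rw [e1, map_add, Pi.add_apply, key _ (p.2 (pos n (kk m))) _ p rfl,
      hb c (p.2 (pos n (kk m))) _ _ p rfl]
    · simp
    · intro p' hp'
      exact if_pos hp'
    · intro p' hp'
      exact if_neg hp'

/-- Freeness for forward chains. -/
theorem Ctx.freeF (o m : ℕ) (hn : o + m + 1 ≤ n) (b : ℕ → EE F e n)
    (hb : ∀ c, b c ∈ Loc F e n (o + m))
    (h : ∑ c ∈ Finset.range (m + 1), Wp (fun t => Γ.psi (o + t)) c (m - c) * b c = 0) :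
    ∀ c, c ≤ m → b c = 0 :=
  Γ.free (fun t => o + t) (fun t => o + t) m (fun t ht => by omega)
    (fun t ht => Or.inl ⟨rfl, by omega⟩) (fun t ht => by omega) (fun t t' h1 h2 => by omega) b hb h

/-- Freeness for backward chains. -/
theorem Ctx.freeB (m : ℕ) (hn : m + 1 ≤ n) (b : ℕ → EE F e n)
    (hb : ∀ c, b c ∈ Loc F e n 0)
    (h : ∑ c ∈ Finset.range (m + 1), Wp (fun t => Γ.psi (m - 1 - t)) c (m - c) * b c = 0) :
    ∀ c, c ≤ m → b c = 0 := by
  refine Γ.free (fun t => m - 1 - t) (fun t => m - t) m (fun t ht => by omega)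
    (fun t ht => Or.inr ⟨by omega, by omega⟩) (fun t ht => by omega) (fun t t' h1 h2 => by omega)
    b ?_ h
  simpa using hb

theorem Ctx.genF_Loc (o m : ℕ) (hn : o + m + 1 < n) :
    gen Γ.rep.P (fun t => Γ.rep.ψ (o + t)) m ≤ Loc F e n (o + m + 1) := by
  apply (Subring.closure_le).2
  rintro z (⟨f, -, rfl⟩ | ⟨t, ht, rfl⟩)
  · exact Γ.cE_Loc _ f
  · have ht : t < m := ht
    exact Γ.psi_Loc (by omega) (by omega) (by omega) (by omega)

theorem Ctx.cE_inj (f : PP k e n) (h : Γ.cE f = 0) : f = 0 := by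
  apply Γ.ev_eq_zero
  intro p
  have := congrFun (LinearMap.congr_fun h (fun _ => 1)) p
  rw [Γ.cE_apply] at this
  simpa using this

/-- Elements of the affine algebra are determined by their action. -/
theorem iota_inj {S : Type} [Ring S] (H : KRep k e n Γ.wt S) (ι : S →+* EE F e n)
    (hc : ∀ f, ι (H.c f) = Γ.cE f) (hψ : ∀ r, ι (H.ψ r) = Γ.psi r) (j : ℕ) :
    j + 1 ≤ n → ∀ z ∈ gen H.P H.ψ j, ι z = 0 → z = 0 := by
  induction j with
  | zero =>
    intro _ z hz h0
    rw [gen_zero] at hz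
    obtain ⟨f, -, rfl⟩ := hz
    rw [hc] at h0
    rw [Γ.cE_inj f h0, map_zero]
  | succ j ih =>
    intro hj z hz h0
    have hch := H.chF 0 (j + 1) (by omega)
    simp only [Nat.zero_add] at hch
    obtain ⟨b, hb, rfl⟩ := hch.span hz
    have hL : ∀ z ∈ gen H.P H.ψ j, ι z ∈ Loc F e n (j + 1) := by
      intro z hz
      have : gen H.P H.ψ j ≤ (Loc F e n (j + 1)).comap ι := by
        apply (Subring.closure_le).2
        rintro z (⟨f, -, rfl⟩ | ⟨t, ht, rfl⟩)
        · rw [SetLike.mem_coe, Subring.mem_comap, hc]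
          exact Γ.cE_Loc _ f
        · have ht : t < j := ht
          rw [SetLike.mem_coe, Subring.mem_comap, hψ]
          exact Γ.psi_Loc (by omega) (by omega) (by omega) (by omega)
      exact this hz
    have hW : ∀ d c, ι (Wp H.ψ c d) = Wp (fun t => Γ.psi (0 + t)) c d := by
      intro d
      induction d with
      | zero => intro c; exact map_one ι
      | succ d ihd => intro c; rw [Wp, Wp, map_mul, ihd, hψ, Nat.zero_add]
    have := Γ.freeF 0 (j + 1) (by omega) (fun c => ι (b c))
      (fun c => by rw [Nat.zero_add]; exact hL _ (hb c)) (by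
        rw [map_sum] at h0
        rw [← h0]
        refine Finset.sum_congr rfl fun c hc => ?_
        rw [map_mul, hW])
    apply Finset.sum_eq_zero
    intro c hc
    rw [ih (by omega) (b c) (hb c) (this c (by rw [Finset.mem_range] at hc; omega)), mul_zero]

end Free

end NB
end Paper

namespace Paper
namespace NB

/-! ### Part 4: regularity -/

section LRsec
variable {S : Type*} [Ring S]

/-- The additive span of `x * a * y`. -/
def LR (B : Subring S) (A : Set S) (B0 : Subring S) : AddSubgroup S :=
  AddSubgroup.closure {z | ∃ x ∈ B, ∃ a ∈ A, ∃ y ∈ B0, z = x * a * y}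

theorem LR_base {B : Subring S} {A : Set S} {B0 : Subring S} {x a y : S} (hx : x ∈ B) (ha : a ∈ A)
    (hy : y ∈ B0) : x * a * y ∈ LR B A B0 :=
  AddSubgroup.subset_closure ⟨x, hx, a, ha, y, hy, rfl⟩

theorem LR_le {B : Subring S} {A : Set S} {B0 : Subring S} {M : AddSubgroup S}
    (h : ∀ x ∈ B, ∀ a ∈ A, ∀ y ∈ B0, x * a * y ∈ M) : LR B A B0 ≤ M := by
  apply (AddSubgroup.closure_le _).2
  rintro z ⟨x, hx, a, ha, y, hy, rfl⟩
  exact h x hx a ha y hy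

theorem LR_mono {B B' : Subring S} {A A' : Set S} {B0 B0' : Subring S} (h1 : B ≤ B') (h2 : A ⊆ A')
    (h3 : B0 ≤ B0') : LR B A B0 ≤ LR B' A' B0' :=
  LR_le fun _ hx _ ha _ hy => LR_base (h1 hx) (h2 ha) (h3 hy)

theorem LR_left {B : Subring S} {A : Set S} {B0 : Subring S} {x z : S} (hx : x ∈ B)
    (hz : z ∈ LR B A B0) : x * z ∈ LR B A B0 := by
  have : LR B A B0 ≤ (LR B A B0).comap (AddMonoidHom.mulLeft x) := by
    refine LR_le fun x' hx' a ha y hy => ?_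
    change x * (x' * a * y) ∈ LR B A B0
    rw [show x * (x' * a * y) = (x * x') * a * y by simp only [mul_assoc]]
    exact LR_base (B.mul_mem hx hx') ha hy
  exact this hz

theorem LR_right {B : Subring S} {A : Set S} {B0 : Subring S} {y z : S} (hy : y ∈ B0)
    (hz : z ∈ LR B A B0) : z * y ∈ LR B A B0 := by
  have : LR B A B0 ≤ (LR B A B0).comap (AddMonoidHom.mulRight y) := by
    refine LR_le fun x' hx' a ha y' hy' => ?_
    change (x' * a * y') * y ∈ LR B A B0
    rw [mul_assoc]
    exact LR_base hx' ha (B0.mul_mem hy' hy)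
  exact this hz

theorem LR_sub {B : Subring S} {A : Set S} {B0 : Subring S} (hA : A ⊆ B) (h0 : B0 ≤ B) {z : S}
    (hz : z ∈ LR B A B0) : z ∈ B := by
  have : LR B A B0 ≤ B.toAddSubgroup :=
    LR_le fun x hx a ha y hy => B.mul_mem (B.mul_mem hx (hA ha)) (h0 hy)
  exact this hz

end LRsec

section Tau
variable {k : Type} [CommRing k] {e n : ℕ} [NeZero n]

/-- Setting the first variable to zero. -/
noncomputable def tau0 (k : Type) [CommRing k] (n : ℕ) [NeZero n] :
    MvPolynomial (Fin n) k →ₐ[k] MvPolynomial (Fin n) k :=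
  MvPolynomial.aeval fun t => if t = pos n 0 then 0 else MvPolynomial.X t

theorem tau0_X {t : Fin n} (h : t ≠ pos n 0) : tau0 k n (MvPolynomial.X t) = MvPolynomial.X t := by
  simp [tau0, h]

theorem tau0_rename {r : ℕ} (hr : r + 2 < n) (f : MvPolynomial (Fin n) k) :
    tau0 k n (MvPolynomial.rename (sw n (r + 1)) f) =
      MvPolynomial.rename (sw n (r + 1)) (tau0 k n f) := by
  have hf : sw n (r + 1) (pos n 0) = pos n 0 := sw_ne (by omega) (by omega) (by omega) (by omega)
  have : (tau0 k n).comp (MvPolynomial.rename (sw n (r + 1))) =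
      (MvPolynomial.rename (sw n (r + 1))).comp (tau0 k n) := by
    apply MvPolynomial.algHom_ext
    intro t
    by_cases h : t = pos n 0
    · subst h
      simp [tau0, hf]
    · have h2 : sw n (r + 1) t ≠ pos n 0 := by
        intro h2
        rw [← hf] at h2
        exact h ((sw n (r + 1)).injective h2)
      rw [AlgHom.comp_apply, AlgHom.comp_apply, MvPolynomial.rename_X, tau0_X h2, tau0_X h,
        MvPolynomial.rename_X]
  exact AlgHom.congr_fun this f

/-- Polynomials not involving the first variable. -/
def P0s (k : Type) [CommRing k] (e n : ℕ) [NeZero n] : Subring (PP k e n) where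
  carrier := {f | ∀ i, tau0 k n (f i) = f i}
  mul_mem' {a b} ha hb := fun i => by rw [Pi.mul_apply, map_mul, ha i, hb i]
  one_mem' := fun i => by simp
  add_mem' {a b} ha hb := fun i => by rw [Pi.add_apply, map_add, ha i, hb i]
  zero_mem' := fun i => by simp
  neg_mem' {a} ha := fun i => by rw [Pi.neg_apply, map_neg, ha i]

theorem P0s_ind (q : (Fin n → ZMod e) → Prop) : ind k q ∈ P0s k e n := by
  intro i
  simp only [ind]
  split_ifs <;> simp

theorem P0s_cs (s : k) : cs e n s ∈ P0s k e n := by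
  intro i
  simp only [cs, ← MvPolynomial.algebraMap_eq]
  exact AlgHom.commutes _ _

theorem pos_ne_zero {t : ℕ} (h : t + 1 < n) : pos n (t + 1) ≠ pos n 0 := by
  rw [Ne, pos_inj h (by omega)]; omega

theorem P0s_Yv {t : ℕ} (h : t + 1 < n) : Yv k e n (t + 1) ∈ P0s k e n := fun _ =>
  tau0_X (pos_ne_zero h)

theorem P0s_act {r : ℕ} (hr : r + 2 < n) {f : PP k e n} (hf : f ∈ P0s k e n) :
    act (sw n (r + 1)) f ∈ P0s k e n := fun i => by
  rw [act_apply, tau0_rename hr, hf]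

theorem tau0_C (s : k) : tau0 k n (MvPolynomial.C s) = MvPolynomial.C s := by
  simp only [← MvPolynomial.algebraMap_eq]
  exact AlgHom.commutes _ _

theorem P0s_stab [IsDomain k] (wt : ZMod e → k) {r : ℕ} (hr : r + 2 < n) :
    Stab wt (P0s k e n) (r + 1) where
  lt := by omega
  act f hf := P0s_act hr hf
  dd f hf g hg := by
    have key : (fun i => tau0 k n (g i) : PP k e n) = g := by
      apply Yv_sub_cancel (k := k) (e := e) (n := n) (r := r + 1 + 1) (s := r + 1) (by omega)
        (by omega) (by omega)
      rw [hg]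
      have h1 : eta k e n (r + 1) * (f - NB.act (sw n (r + 1)) f) ∈ P0s k e n :=
        Subring.mul_mem _ (P0s_ind _) (Subring.sub_mem _ hf (P0s_act hr hf))
      funext i
      rw [← h1 i, ← hg, Pi.mul_apply, Pi.mul_apply, map_mul]
      congr 1
      exact ((Subring.sub_mem _ (P0s_Yv (k := k) (e := e) (n := n) (t := r + 1) (by omega))
        (P0s_Yv (k := k) (e := e) (n := n) (t := r) (by omega))) i).symm
    intro i
    exact congrFun key i
  Q := fun i => by
    have := QQ_map (e := e) (tau0 k n).toRingHom (fun a => MvPolynomial.C (wt a))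
      (i (pos n (r + 1))) (i (pos n (r + 1 + 1))) (MvPolynomial.X (pos n (r + 1)))
      (MvPolynomial.X (pos n (r + 1 + 1)))
    simp only [AlgHom.toRingHom_eq_coe, RingHom.coe_coe, tau0_C] at this
    rw [Qr, this, tau0_X (pos_ne_zero (by omega)), tau0_X (pos_ne_zero (by omega))]

theorem P0s_D (wt : ZMod e → k) {r : ℕ} (hr : r + 3 < n) : Dr e n wt (r + 1) ∈ P0s k e n :=
  fun i => by
    have := DD_map (e := e) (tau0 k n).toRingHom (fun a => MvPolynomial.C (wt a))
      (i (pos n (r + 1))) (i (pos n (r + 1 + 1))) (i (pos n (r + 1 + 2)))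
      (MvPolynomial.X (pos n (r + 1)))
      (MvPolynomial.X (pos n (r + 1 + 1))) (MvPolynomial.X (pos n (r + 1 + 2)))
    simp only [AlgHom.toRingHom_eq_coe, RingHom.coe_coe, tau0_C] at this
    rw [Dr, this, tau0_X (pos_ne_zero (by omega)), tau0_X (pos_ne_zero (by omega)),
      tau0_X (pos_ne_zero (t := r + 2) (by omega))]

/-- Separating the first variable. -/
noncomputable def sig0 (k : Type) [CommRing k] (n : ℕ) [NeZero n] :
    MvPolynomial (Fin n) k →ₐ[k] Polynomial (MvPolynomial (Fin n) k) :=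
  MvPolynomial.aeval fun t => if t = pos n 0 then Polynomial.X else Polynomial.C (MvPolynomial.X t)

theorem sig0_X0 : sig0 k n (MvPolynomial.X (pos n 0)) = Polynomial.X := by simp [sig0]

theorem sig0_tau0 (f : MvPolynomial (Fin n) k) :
    sig0 k n (tau0 k n f) = Polynomial.C (tau0 k n f) := by
  have : (sig0 k n).comp (tau0 k n) = (Polynomial.CAlgHom (R := k)).comp (tau0 k n) := by
    apply MvPolynomial.algHom_ext
    intro t
    by_cases h : t = pos n 0
    · subst h
      simp [tau0]
    · rw [AlgHom.comp_apply, AlgHom.comp_apply, tau0_X h]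
      simp [sig0, h]
  exact AlgHom.congr_fun this f

theorem tau_unique (N : ℕ) (f : ℕ → MvPolynomial (Fin n) k) (hf : ∀ t, tau0 k n (f t) = f t)
    (h : ∑ t ∈ Finset.range N, f t * MvPolynomial.X (pos n 0) ^ t = 0) :
    ∀ t, t < N → f t = 0 := by
  intro t ht
  have h1 := congrArg (sig0 k n) h
  rw [map_sum, map_zero] at h1
  have h2 : ∀ t, sig0 k n (f t * MvPolynomial.X (pos n 0) ^ t) = Polynomial.C (f t) * Polynomial.X ^ t := by
    intro t
    rw [map_mul, map_pow, sig0_X0, ← hf t, sig0_tau0]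
  simp only [h2] at h1
  have h3 := congrArg (fun p => Polynomial.coeff p t) h1
  simp only [Polynomial.finsetSum_coeff, Polynomial.coeff_C_mul_X_pow, Polynomial.coeff_zero] at h3
  rw [Finset.sum_eq_single t] at h3
  · simpa using h3
  · intro b _ hb
    rw [if_neg (Ne.symm hb)]
  · intro h4
    exact absurd (Finset.mem_range.2 ht) h4

theorem PP_gen [NeZero e] (R : Subring (PP k e n)) (h1 : ∀ q, ind k q ∈ R) (h2 : ∀ s, cs e n s ∈ R)
    (h3 : ∀ t, t < n → Yv k e n t ∈ R) (f : PP k e n) : f ∈ R := by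
  have hc : ∀ p : MvPolynomial (Fin n) k, (fun _ => p : PP k e n) ∈ R := by
    intro p
    induction p using MvPolynomial.induction_on with
    | C a => exact h2 a
    | add p q hp hq => exact R.add_mem hp hq
    | mul_X p t hp =>
      have h4 : Yv k e n t.1 = fun _ => MvPolynomial.X t := by
        funext i
        simp only [Yv, pos_fin]
      have := R.mul_mem hp (h3 t.1 t.2)
      rw [h4] at this
      exact this
  have : f = ∑ i, ind k (fun i' => i' = i) * (fun _ => f i : PP k e n) := by
    funext i'
    rw [Finset.sum_apply, Finset.sum_eq_single i']
    · simp [ind]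
    · intro i _ hi
      simp [ind, Ne.symm hi]
    · intro h; exact absurd (Finset.mem_univ _) h
  rw [this]
  exact R.sum_mem fun i _ => R.mul_mem (h1 _) (hc _)

end Tau

section Reg
variable {k F : Type} [CommRing k] [IsDomain k] [Field F] {e n : ℕ} [NeZero n] [NeZero e]
  (Γ : Ctx k F e n)

/-- The coefficient ring. -/
noncomputable def Ctx.B0 (j : ℕ) : Subring (EE F e n) := gen ((P0s k e n).map Γ.cE) (fun t => Γ.psi (1 + t)) j

/-- The shifted algebra. -/
noncomputable def Ctx.Bs (j : ℕ) : Subring (EE F e n) := gen Γ.rep.P (fun t => Γ.psi (1 + t)) j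

/-- The algebra. -/
noncomputable def Ctx.B (j : ℕ) : Subring (EE F e n) := gen Γ.rep.P Γ.psi j

theorem Ctx.cB (j : ℕ) (f : PP k e n) : Γ.cE f ∈ Γ.B j := gen_P (Γ.rep.c_mem f)
theorem Ctx.cBs (j : ℕ) (f : PP k e n) : Γ.cE f ∈ Γ.Bs j := gen_P (Γ.rep.c_mem f)

theorem Ctx.B0_Bs (j : ℕ) : Γ.B0 j ≤ Γ.Bs j :=
  gen_mono (by rintro _ ⟨f, -, rfl⟩; exact Γ.rep.c_mem f) le_rfl

/-- The central element. -/
noncomputable def Ctx.y0 : EE F e n := Γ.cE (Yv k e n 0)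

theorem Ctx.c_psi_comm {r : ℕ} (hr : r + 1 < n) (f : PP k e n) (hf : act (sw n r) f = f) :
    Γ.cE f * Γ.psi r = Γ.psi r * Γ.cE f := Γ.rep.cpsi_fix hr f hf

theorem act_Yv_ne {r t : ℕ} (hr : r + 1 < n) (ht : t < n) (h1 : t ≠ r) (h2 : t ≠ r + 1) :
    act (sw n r) (Yv k e n t) = Yv k e n t := by
  rw [act_Yv, sw_ne hr ht h1 h2]; rfl

theorem Ctx.y0_comm (j : ℕ) (hj : j + 2 ≤ n ∨ j = 0) {b : EE F e n} (hb : b ∈ Γ.Bs j) :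
    Commute b Γ.y0 := by
  have : Γ.Bs j ≤ Subring.centralizer {Γ.y0} := by
    apply (Subring.closure_le).2
    rintro z (⟨f, -, rfl⟩ | ⟨t, ht, rfl⟩)
    · rw [SetLike.mem_coe, Subring.mem_centralizer_iff]
      rintro _ rfl
      change Γ.cE _ * Γ.cE _ = Γ.cE _ * Γ.cE _
      rw [← map_mul, ← map_mul, mul_comm]
    · have ht : t < j := ht
      rw [SetLike.mem_coe, Subring.mem_centralizer_iff]
      rintro _ rfl
      exact Γ.c_psi_comm (by omega) _ (act_Yv_ne (by omega) (by omega) (by omega) (by omega))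
  exact ((Subring.mem_centralizer_iff.1 (this hb)) _ rfl).symm

theorem Ctx.uniq (j : ℕ) : j + 2 ≤ n ∨ j = 0 → ∀ (N : ℕ) (b : ℕ → EE F e n), (∀ t, b t ∈ Γ.B0 j) →
    ∑ t ∈ Finset.range N, b t * Γ.y0 ^ t = 0 → ∀ t, t < N → b t = 0 := by
  induction j with
  | zero =>
    intro _ N b hb h t ht
    simp only [Ctx.B0, gen_zero] at hb
    choose f hf1 hf2 using hb
    have h1 : Γ.cE (∑ t ∈ Finset.range N, f t * Yv k e n 0 ^ t) = 0 := by
      rw [← h, map_sum]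
      refine Finset.sum_congr rfl fun t _ => ?_
      rw [map_mul, map_pow, ← hf2 t]; rfl
    have h2 := Γ.cE_inj _ h1
    have h3 : f t = 0 := by
      funext i
      have h4 := congrFun h2 i
      rw [Finset.sum_apply] at h4
      exact tau_unique N (fun t => f t i) (fun t => hf1 t i) h4 t ht
    rw [← hf2 t, h3, map_zero]
  | succ j ih =>
    intro hj N b hb h
    have hj' : j + 3 ≤ n := by omega
    have hch : Chain ((P0s k e n).map Γ.cE) (fun t => Γ.psi (1 + t)) (j + 1) :=
      Γ.rep.chainF (P0s k e n) 1 (j + 1)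
        (fun t ht => by rw [add_comm]; exact P0s_stab _ (by omega))
        (fun t ht => by rw [add_comm]; exact P0s_D _ (by omega))
    have hsp : ∀ t, ∃ b' : ℕ → EE F e n, (∀ c, b' c ∈ Γ.B0 j) ∧
      b t = ∑ c ∈ Finset.range (j + 1 + 1), Wp (fun t => Γ.psi (1 + t)) c (j + 1 - c) * b' c :=
      fun t => hch.span (hb t)
    choose b' hb1 hb2 using hsp
    have hL : Γ.Bs j ≤ Loc F e n (1 + (j + 1)) := by
      have := Γ.genF_Loc 1 j (by omega)
      exact this
    have h0 := Γ.freeF 1 (j + 1) (by omega)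
      (fun c => ∑ t ∈ Finset.range N, b' t c * Γ.y0 ^ t)
      (fun c => Subring.sum_mem _ fun t _ => hL (Subring.mul_mem _ (Γ.B0_Bs j (hb1 t c))
        (Subring.pow_mem _ (Γ.cBs j _) _))) (by
        rw [← h]
        simp only [Finset.mul_sum]
        rw [Finset.sum_comm]
        refine Finset.sum_congr rfl fun t _ => ?_
        rw [hb2 t, Finset.sum_mul]
        simp only [mul_assoc])
    intro t ht
    rw [hb2 t]
    apply Finset.sum_eq_zero
    intro c hc
    rw [ih (by omega) N (fun t => b' t c) (fun t => hb1 t c)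
      (h0 c (by rw [Finset.mem_range] at hc; omega)) t ht, mul_zero]

/-- Polynomials over the coefficient ring. -/
noncomputable def Ctx.Phi (j : ℕ) (hj : j + 2 ≤ n ∨ j = 0) : Polynomial (Γ.B0 j) →+* EE F e n :=
  Polynomial.eval₂RingHom' (Γ.B0 j).subtype Γ.y0 fun a => Γ.y0_comm j hj (Γ.B0_Bs j a.2)

theorem Ctx.Phi_sum (j : ℕ) (hj : j + 2 ≤ n ∨ j = 0) (p : Polynomial (Γ.B0 j)) :
    Γ.Phi j hj p = ∑ t ∈ Finset.range (p.natDegree + 1), (p.coeff t : EE F e n) * Γ.y0 ^ t := by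
  change Polynomial.eval₂ _ _ p = _
  rw [Polynomial.eval₂_eq_sum_range]
  rfl

theorem Ctx.Phi_C (j : ℕ) (hj : j + 2 ≤ n ∨ j = 0) (b : Γ.B0 j) :
    Γ.Phi j hj (Polynomial.C b) = b := Polynomial.eval₂_C _ _

theorem Ctx.Phi_X (j : ℕ) (hj : j + 2 ≤ n ∨ j = 0) :
    Γ.Phi j hj Polynomial.X = Γ.y0 := Polynomial.eval₂_X _ _

theorem Ctx.Phi_inj (j : ℕ) (hj : j + 2 ≤ n ∨ j = 0) : Function.Injective (Γ.Phi j hj) := by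
  rw [injective_iff_map_eq_zero]
  intro p hp
  rw [Γ.Phi_sum] at hp
  have := Γ.uniq j hj _ (fun t => (p.coeff t : EE F e n)) (fun t => (p.coeff t).2) hp
  ext t
  rcases Nat.lt_or_ge t (p.natDegree + 1) with h | h
  · rw [this t h]; simp
  · rw [Polynomial.coeff_eq_zero_of_natDegree_lt (by omega)]; simp

theorem Ctx.Phi_surj (j : ℕ) (hj : j + 2 ≤ n ∨ j = 0) {b : EE F e n} (hb : b ∈ Γ.Bs j) :
    ∃ p, Γ.Phi j hj p = b := by
  have h0 : ∀ f ∈ P0s k e n, Γ.cE f ∈ (Γ.Phi j hj).range := fun f hf =>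
    ⟨Polynomial.C ⟨Γ.cE f, gen_P ⟨f, hf, rfl⟩⟩, Γ.Phi_C j hj _⟩
  have : Γ.Bs j ≤ (Γ.Phi j hj).range := by
    apply (Subring.closure_le).2
    rintro z (⟨f, -, rfl⟩ | ⟨t, ht, rfl⟩)
    · have := PP_gen ((Γ.Phi j hj).range.comap Γ.cE) (fun q => h0 _ (P0s_ind q))
        (fun s => h0 _ (P0s_cs s)) (fun t ht => by
          rcases t with _ | t
          · exact ⟨Polynomial.X, Γ.Phi_X j hj⟩
          · exact h0 _ (P0s_Yv ht)) f
      exact this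
    · have ht : t < j := ht
      exact ⟨Polynomial.C ⟨_, gen_a (a := fun t => Γ.psi (1 + t)) ht⟩, Γ.Phi_C j hj _⟩
  exact this hb

theorem Ctx.LR_coeff (j : ℕ) (hj : j + 2 ≤ n ∨ j = 0) (A : Set (EE F e n))
    (hA : ∀ a ∈ A, ∃ f ∈ P0s k e n, a = Γ.cE f) {z : EE F e n} (hz : z ∈ LR (Γ.Bs j) A (Γ.Bs j)) :
    ∃ p, Γ.Phi j hj p = z ∧ ∀ t, (p.coeff t : EE F e n) ∈ LR (Γ.B0 j) A (Γ.B0 j) := by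
  induction hz using AddSubgroup.closure_induction with
  | mem z h =>
    obtain ⟨x, hx, a, ha, y, hy, rfl⟩ := h
    obtain ⟨p, rfl⟩ := Γ.Phi_surj j hj hx
    obtain ⟨q, rfl⟩ := Γ.Phi_surj j hj hy
    have ha0 : a ∈ Γ.B0 j := by
      obtain ⟨f, hf, rfl⟩ := hA a ha
      exact gen_P ⟨f, hf, rfl⟩
    refine ⟨p * Polynomial.C ⟨a, ha0⟩ * q, ?_, ?_⟩
    · rw [map_mul, map_mul, Γ.Phi_C]
    · intro t
      rw [Polynomial.coeff_mul, AddSubmonoidClass.coe_finsetSum]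
      refine AddSubgroup.sum_mem _ fun x _ => ?_
      rw [Polynomial.coeff_mul_C]
      exact LR_base (p.coeff x.1).2 ha (q.coeff x.2).2
  | zero => exact ⟨0, map_zero _, fun t => by simp⟩
  | add x y _ _ hx hy =>
    obtain ⟨p, rfl, h1⟩ := hx
    obtain ⟨q, rfl, h2⟩ := hy
    exact ⟨p + q, map_add _ _ _, fun t => by
      rw [Polynomial.coeff_add]; exact AddSubgroup.add_mem _ (h1 t) (h2 t)⟩
  | neg x _ hx =>
    obtain ⟨p, rfl, h1⟩ := hx
    exact ⟨-p, map_neg _ _, fun t => by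
      rw [Polynomial.coeff_neg]; exact AddSubgroup.neg_mem _ (h1 t)⟩

theorem Ctx.reg_core (j : ℕ) (hj : j + 2 ≤ n ∨ j = 0) (A : Set (EE F e n))
    (hA : ∀ a ∈ A, ∃ f ∈ P0s k e n, a = Γ.cE f) (f0 : PP k e n) (hf0 : f0 ∈ P0s k e n)
    {v : EE F e n} (hv : v ∈ Γ.Bs j)
    (h : v * Γ.cE (Yv k e n 0 - f0) ∈ LR (Γ.Bs j) A (Γ.Bs j)) : v ∈ LR (Γ.Bs j) A (Γ.Bs j) := by
  obtain ⟨p, rfl⟩ := Γ.Phi_surj j hj hv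
  obtain ⟨q, hq1, hq2⟩ := Γ.LR_coeff j hj A hA h
  have hfm : Γ.cE f0 ∈ Γ.B0 j := gen_P ⟨f0, hf0, rfl⟩
  have e1 : q = p * (Polynomial.X - Polynomial.C ⟨Γ.cE f0, hfm⟩) := by
    apply Γ.Phi_inj j hj
    rw [hq1, map_mul, map_sub, map_sub, Γ.Phi_X, Γ.Phi_C]; rfl
  have key : ∀ d t, p.natDegree + 1 ≤ t + d → (p.coeff t : EE F e n) ∈ LR (Γ.B0 j) A (Γ.B0 j) := by
    intro d
    induction d with
    | zero =>
      intro t ht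
      rw [Polynomial.coeff_eq_zero_of_natDegree_lt (by omega)]
      exact AddSubgroup.zero_mem _
    | succ d ih =>
      intro t ht
      have h1 := hq2 (t + 1)
      rw [e1, Polynomial.coeff_mul_X_sub_C] at h1
      have h2 := LR_right hfm (ih (t + 1) (by omega))
      have := AddSubgroup.add_mem _ h1 h2
      simpa using this
  rw [Γ.Phi_sum]
  refine AddSubgroup.sum_mem _ fun t _ => LR_right (Subring.pow_mem _ (Γ.cBs j _) _) ?_
  exact LR_mono (Γ.B0_Bs j) le_rfl (Γ.B0_Bs j) (key (p.natDegree + 1) t (by omega))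

/-- Regular elements. -/
def Ctx.RegF (j : ℕ) (A : Set (EE F e n)) (f : PP k e n) : Prop :=
  ∀ v ∈ Γ.Bs j, v * Γ.cE f ∈ LR (Γ.Bs j) A (Γ.Bs j) → v ∈ LR (Γ.Bs j) A (Γ.Bs j)

theorem Ctx.RegF_one (j : ℕ) (A : Set (EE F e n)) : Γ.RegF j A 1 := by
  intro v _ h
  rwa [map_one, mul_one] at h

theorem Ctx.RegF_mul {j : ℕ} {A : Set (EE F e n)} {f g : PP k e n} (hf : Γ.RegF j A f)
    (hg : Γ.RegF j A g) : Γ.RegF j A (f * g) := by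
  intro v hv h
  rw [map_mul, ← mul_assoc] at h
  exact hf v hv (hg _ (Subring.mul_mem _ hv (Γ.cBs j f)) h)

theorem Ctx.RegF_prod {j : ℕ} {A : Set (EE F e n)} {α : Type} (s : Finset α) (f : α → PP k e n)
    (hf : ∀ a ∈ s, Γ.RegF j A (f a)) : Γ.RegF j A (∏ a ∈ s, f a) := by
  induction s using Finset.induction_on with
  | empty => rw [Finset.prod_empty]; exact Γ.RegF_one j A
  | insert a s ha ih =>
    rw [Finset.prod_insert ha]
    exact Γ.RegF_mul (hf a (Finset.mem_insert_self _ _))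
      (ih fun b hb => hf b (Finset.mem_insert_of_mem hb))

theorem Ctx.RegF_lin (j : ℕ) (hj : j + 2 ≤ n ∨ j = 0) (A : Set (EE F e n))
    (hA : ∀ a ∈ A, ∃ f ∈ P0s k e n, a = Γ.cE f) (f0 : PP k e n) (hf0 : f0 ∈ P0s k e n)
    (q : (Fin n → ZMod e) → Prop) (u : PP k e n) (hu : u * u = 1) :
    Γ.RegF j A (ind k q * (u * (Yv k e n 0 - f0)) + (1 - ind k q)) := by
  have hi : ind k q * ind k q = (ind k q : PP k e n) := by
    funext i; simp only [ind, Pi.mul_apply]; split_ifs <;> simp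
  intro v hv h
  have h1 := LR_right (Γ.cBs j (1 - ind k q)) h
  rw [mul_assoc, ← map_mul, show (ind k q * (u * (Yv k e n 0 - f0)) + (1 - ind k q)) * (1 - ind k q) =
    1 - ind k q by linear_combination (1 - u * (Yv k e n 0 - f0)) * hi] at h1
  have h2 := LR_right (Γ.cBs j (ind k q * u)) h
  rw [mul_assoc, ← map_mul, show (ind k q * (u * (Yv k e n 0 - f0)) + (1 - ind k q)) * (ind k q * u) =
    ind k q * (Yv k e n 0 - f0) by
      linear_combination (u * u * (Yv k e n 0 - f0) - u) * hi + (Yv k e n 0 - f0) * ind k q * hu,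
    map_mul, ← mul_assoc] at h2
  have h3 := Γ.reg_core j hj A hA f0 hf0 (Subring.mul_mem _ hv (Γ.cBs j _)) h2
  have := AddSubgroup.add_mem _ h1 h3
  rwa [← mul_add, ← map_add, sub_add_cancel, map_one, mul_one] at this

/-- Passing from the shifted algebra to the full algebra. -/
theorem Ctx.reg_B (j : ℕ) (hj : j + 2 ≤ n) (A : Set (EE F e n)) (f : PP k e n)
    (hA : A ⊆ Γ.Bs j) (hf : Γ.RegF j A f) {v : EE F e n} (hv : v ∈ Γ.B (j + 1))
    (h : v * Γ.cE f ∈ LR (Γ.B (j + 1)) A (Γ.Bs j)) : v ∈ LR (Γ.B (j + 1)) A (Γ.Bs j) := by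
  have hch := Γ.rep.chB (j + 1) (by omega)
  have e1 : gen Γ.rep.P (fun t => Γ.rep.ψ (j + 1 - 1 - t)) (j + 1) = Γ.B (j + 1) := by
    unfold Ctx.B gen
    congr 2
    ext z
    constructor
    · rintro ⟨t, ht, rfl⟩
      have ht : t < j + 1 := ht
      exact ⟨j + 1 - 1 - t, show _ < j + 1 by omega, rfl⟩
    · rintro ⟨t, ht, rfl⟩
      have ht : t < j + 1 := ht
      exact ⟨j - t, show _ < j + 1 by omega, by
        simp only; rw [show j + 1 - 1 - (j - t) = t by omega]; rfl⟩
  have e2 : gen Γ.rep.P (fun t => Γ.rep.ψ (j + 1 - 1 - t)) (j + 1 - 1) = Γ.Bs j := by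
    unfold Ctx.Bs gen
    congr 2
    ext z
    constructor
    · rintro ⟨t, ht, rfl⟩
      have ht : t < j + 1 - 1 := ht
      exact ⟨j - 1 - t, show _ < j by omega, by
        simp only; rw [show 1 + (j - 1 - t) = j + 1 - 1 - t by omega]; rfl⟩
    · rintro ⟨t, ht, rfl⟩
      have ht : t < j := ht
      exact ⟨j - 1 - t, show _ < j + 1 - 1 by omega, by
        simp only; rw [show j + 1 - 1 - (j - 1 - t) = 1 + t by omega]; rfl⟩
  have hWB : ∀ c, c ≤ j + 1 → Wp (fun t => Γ.psi (j + 1 - 1 - t)) c (j + 1 - c) ∈ Γ.B (j + 1) :=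
    fun c hc => Wp_mem _ _ _ _ fun t _ _ => gen_a (by omega)
  have hsp : ∀ z ∈ Γ.B (j + 1), ∃ b : ℕ → EE F e n, (∀ c, b c ∈ Γ.Bs j) ∧
      z = ∑ c ∈ Finset.range (j + 1 + 1), Wp (fun t => Γ.psi (j + 1 - 1 - t)) c (j + 1 - c) * b c := by
    intro z hz
    rw [← e1] at hz
    obtain ⟨b, hb, h⟩ := hch.span hz
    exact ⟨b, fun c => e2 ▸ hb c, h⟩
  have hLR : LR (Γ.B (j + 1)) A (Γ.Bs j) ≤ AddSubgroup.closure {z | ∃ c b, c ≤ j + 1 ∧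
      b ∈ LR (Γ.Bs j) A (Γ.Bs j) ∧ z = Wp (fun t => Γ.psi (j + 1 - 1 - t)) c (j + 1 - c) * b} := by
    refine LR_le fun x hx a ha y hy => ?_
    obtain ⟨b, hb, rfl⟩ := hsp x hx
    rw [Finset.sum_mul, Finset.sum_mul]
    refine AddSubgroup.sum_mem _ fun c hc => AddSubgroup.subset_closure ⟨c, b c * a * y, ?_,
      LR_base (hb c) ha hy, by simp only [mul_assoc]⟩
    rw [Finset.mem_range] at hc; omega
  obtain ⟨z, hz, hze⟩ := closure_sum (fun c => Wp (fun t => Γ.psi (j + 1 - 1 - t)) c (j + 1 - c))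
    (j + 1) _ (hLR h)
  obtain ⟨b, hb, rfl⟩ := hsp v hv
  have hLoc : Γ.Bs j ≤ Loc F e n 0 := by
    apply (Subring.closure_le).2
    rintro z (⟨f, -, rfl⟩ | ⟨t, ht, rfl⟩)
    · exact Γ.cE_Loc _ f
    · have ht : t < j := ht
      exact Γ.psi_Loc (by omega) (by omega) (by omega) (by omega)
  have hfree := Γ.freeB (j + 1) (by omega) (fun c => b c * Γ.cE f - z c)
    (fun c => Subring.sub_mem _ (hLoc (Subring.mul_mem _ (hb c) (Γ.cBs j f)))
      (hLoc (LR_sub hA le_rfl (hz c)))) (by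
      simp only [mul_sub, Finset.sum_sub_distrib, ← mul_assoc]
      rw [← Finset.sum_mul, hze, sub_self])
  refine AddSubgroup.sum_mem _ fun c hc => ?_
  rw [Finset.mem_range] at hc
  have h1 := sub_eq_zero.1 (hfree c (by omega))
  have h2 : b c * Γ.cE f ∈ LR (Γ.Bs j) A (Γ.Bs j) := by rw [h1]; exact hz c
  have hBs : Γ.Bs j ≤ Γ.B (j + 1) := by
    apply (Subring.closure_le).2
    rintro z (hz | ⟨t, ht, rfl⟩)
    · exact gen_P hz
    · have ht : t < j := ht
      exact gen_a (by omega)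
  exact LR_left (hWB c (by omega)) (LR_mono hBs le_rfl le_rfl (hf (b c) (hb c) h2))

end Reg

end NB
end Paper

namespace Paper
namespace NB

/-! ### Part 5: intertwiners -/

section PPtwo
variable {k : Type} [CommRing k] {e n : ℕ} [NeZero n]

/-- Linear factor. -/
noncomputable def aF (e n : ℕ) [NeZero n] (j : ZMod e) (v : k) (t : ℕ) : PP k e n := fun i =>
  if i (pos n t) = j then MvPolynomial.X (pos n t) - MvPolynomial.C v else 1

/-- The cyclotomic polynomial at position `t`. -/
noncomputable def aP (e n : ℕ) [NeZero n] {ℓ : ℕ} (ρ : Fin ℓ → ZMod e) (ν : Fin ℓ → k) (t : ℕ) :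
    PP k e n := ∏ l, aF e n (ρ l) (ν l) t

theorem act_aF (σ : Equiv.Perm (Fin n)) (j : ZMod e) (v : k) {t t' : ℕ}
    (h : σ (pos n t) = pos n t') : act σ (aF e n j v t) = aF e n j v t' := by
  funext i
  simp only [act_apply, aF, Function.comp, h]
  split_ifs <;> simp [h]

theorem act_aP (σ : Equiv.Perm (Fin n)) {ℓ : ℕ} (ρ : Fin ℓ → ZMod e) (ν : Fin ℓ → k) {t t' : ℕ}
    (h : σ (pos n t) = pos n t') : act σ (aP e n ρ ν t) = aP e n ρ ν t' := by
  rw [aP, map_prod]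
  exact Finset.prod_congr rfl fun l _ => act_aF σ _ _ h

/-- The element `Q` with value one on equal residues. -/
noncomputable def Qt (e n : ℕ) [NeZero n] (wt : ZMod e → k) (a b : ℕ) : PP k e n := fun i =>
  if i (pos n a) = i (pos n b) then 1 else
    th (fun a => MvPolynomial.C (wt a)) (i (pos n a)) (i (pos n b))
      (MvPolynomial.X (pos n a)) (MvPolynomial.X (pos n b)) *
    th (fun a => MvPolynomial.C (wt a)) (i (pos n b)) (i (pos n a))
      (MvPolynomial.X (pos n b)) (MvPolynomial.X (pos n a))

theorem act_Qt (σ : Equiv.Perm (Fin n)) (wt : ZMod e → k) {a b a' b' : ℕ}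
    (ha : σ (pos n a) = pos n a') (hb : σ (pos n b) = pos n b') :
    act σ (Qt e n wt a b) = Qt e n wt a' b' := by
  funext i
  simp only [act_apply, Qt, Function.comp, ha, hb, th]
  split_ifs <;> simp [ha, hb]

/-- Moving through intertwiners. -/
noncomputable def mvd (n : ℕ) [NeZero n] : ℕ → PP k e n → PP k e n
  | 0, f => f
  | t + 1, f => mvd n t (act (sw n t) f)

theorem mvd_aP {ℓ : ℕ} (ρ : Fin ℓ → ZMod e) (ν : Fin ℓ → k) (t : ℕ) (ht : t + 2 ≤ n) :
    mvd n (t + 1) (aP e n ρ ν 0) = aP e n ρ ν 1 := by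
  induction t with
  | zero => exact act_aP _ _ _ (sw_left 0)
  | succ t ih =>
    rw [mvd, act_aP _ _ _ (sw_ne (by omega) (by omega) (by omega) (by omega) :
      sw n (t + 1) (pos n 0) = pos n 0)]
    exact ih (by omega)

theorem mvd_Qt (wt : ZMod e → k) (t b : ℕ) (htb : t < b) (hb : b < n) :
    mvd n t (Qt e n wt t b) = Qt e n wt 0 b := by
  induction t with
  | zero => rfl
  | succ t ih =>
    rw [mvd, act_Qt _ _ (sw_right t) (sw_ne (by omega) (by omega) (by omega) (by omega))]
    exact ih (by omega)

/-- Rotation. -/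
noncomputable def rt (n : ℕ) [NeZero n] : ℕ → ℕ → PP k e n → PP k e n
  | _, 0, f => f
  | c, d + 1, f => rt n (c + 1) d (act (sw n c) f)

theorem rt_surj (d : ℕ) : ∀ (c : ℕ) (f : PP k e n), ∃ f', rt n c d f' = f := by
  induction d with
  | zero => intro c f; exact ⟨f, rfl⟩
  | succ d ih =>
    intro c f
    obtain ⟨f', h⟩ := ih (c + 1) f
    exact ⟨act (sw n c) f', by rw [rt, act_sw_sw, h]⟩

theorem rt_aP0 {ℓ : ℕ} (ρ : Fin ℓ → ZMod e) (ν : Fin ℓ → k) (d : ℕ) : ∀ c, c + d + 2 ≤ n →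
    rt n (c + 1) d (aP e n ρ ν 0) = aP e n ρ ν 0 := by
  induction d with
  | zero => intro c _; rfl
  | succ d ih =>
    intro c h
    rw [rt, act_aP _ _ _ (sw_ne (by omega) (by omega) (by omega) (by omega) :
      sw n (c + 1) (pos n 0) = pos n 0)]
    exact ih (c + 1) (by omega)

theorem rt_aP {ℓ : ℕ} (ρ : Fin ℓ → ZMod e) (ν : Fin ℓ → k) (d : ℕ) (h : d + 2 ≤ n) :
    rt n 0 (d + 1) (aP e n ρ ν 1) = aP e n ρ ν 0 := by
  rw [rt, act_aP _ _ _ (sw_right 0)]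
  exact rt_aP0 ρ ν d 0 (by omega)

theorem P0s_aP {ℓ : ℕ} (ρ : Fin ℓ → ZMod e) (ν : Fin ℓ → k) (h : 2 ≤ n) :
    aP e n ρ ν 1 ∈ P0s k e n := by
  refine Subring.prod_mem _ fun l _ i => ?_
  simp only [aF]
  split_ifs
  · rw [map_sub, tau0_X (pos_ne_zero (by omega)), tau0_C]
  · exact map_one _

end PPtwo

section Inter
variable {k F : Type} [CommRing k] [IsDomain k] [Field F] {e n : ℕ} [NeZero n] [NeZero e]
  (Γ : Ctx k F e n)

theorem Ctx.RegF_aF (j : ℕ) (hj : j + 2 ≤ n ∨ j = 0) (A : Set (EE F e n))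
    (hA : ∀ a ∈ A, ∃ f ∈ P0s k e n, a = Γ.cE f) (r : ZMod e) (v : k) :
    Γ.RegF j A (aF e n r v 0) := by
  have := Γ.RegF_lin j hj A hA (cs e n v) (P0s_cs v) (fun i => i (pos n 0) = r) 1 (one_mul 1)
  convert this using 1
  funext i
  simp only [aF, ind, Yv, cs, Pi.add_apply, Pi.mul_apply, Pi.sub_apply, Pi.one_apply]
  by_cases h : i (pos n 0) = r
  · simp only [if_pos h]; ring
  · simp only [if_neg h]; ring

theorem Ctx.RegF_aP (j : ℕ) (hj : j + 2 ≤ n ∨ j = 0) (A : Set (EE F e n))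
    (hA : ∀ a ∈ A, ∃ f ∈ P0s k e n, a = Γ.cE f) {ℓ : ℕ} (ρ : Fin ℓ → ZMod e) (ν : Fin ℓ → k) :
    Γ.RegF j A (aP e n ρ ν 0) := Γ.RegF_prod _ _ fun _ _ => Γ.RegF_aF j hj A hA _ _

/-- A two-valued linear factor. -/
noncomputable def RegL (f0 : PP k e n) (q : (Fin n → ZMod e) → Prop) (u : PP k e n) : PP k e n :=
  ind k q * (u * (Yv k e n 0 - f0)) + (1 - ind k q)

theorem RegL_pos {f0 : PP k e n} {q : (Fin n → ZMod e) → Prop} {u : PP k e n}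
    {i : Fin n → ZMod e} (h : q i) : RegL f0 q u i = u i * (MvPolynomial.X (pos n 0) - f0 i) := by
  simp only [RegL, ind, Yv, Pi.add_apply, Pi.mul_apply, Pi.sub_apply, Pi.one_apply, if_pos h]
  ring

theorem RegL_neg {f0 : PP k e n} {q : (Fin n → ZMod e) → Prop} {u : PP k e n}
    {i : Fin n → ZMod e} (h : ¬ q i) : RegL f0 q u i = 1 := by
  simp only [RegL, ind, Yv, Pi.add_apply, Pi.mul_apply, Pi.sub_apply, Pi.one_apply, if_neg h]
  ring

theorem Qt_aux (wt : ZMod e → k) (b : ℕ) (i : Fin n → ZMod e) :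
    Qt e n wt 0 (b + 1) i =
    (RegL (Yv k e n (b + 1) - (fun i => MvPolynomial.C (wt (i (pos n 0))) : PP k e n))
      (fun i => i (pos n 0) ≠ i (pos n (b + 1)) ∧ i (pos n (b + 1)) = i (pos n 0) + 1) 1 *
     RegL (Yv k e n (b + 1) + (fun i => MvPolynomial.C (wt (i (pos n (b + 1)))) : PP k e n))
    (fun i => i (pos n 0) ≠ i (pos n (b + 1)) ∧ i (pos n 0) = i (pos n (b + 1)) + 1) (-1)) i := by
  rw [Pi.mul_apply, Qt]
  by_cases h : i (pos n 0) = i (pos n (b + 1))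
  · rw [if_pos h, RegL_neg (fun h' => h'.1 h), RegL_neg (fun h' => h'.1 h), one_mul]
  · rw [if_neg h]
    congr 1
    · by_cases h3 : i (pos n (b + 1)) = i (pos n 0) + 1
      · rw [RegL_pos ⟨h, h3⟩, th, if_pos h3]
        simp only [Pi.one_apply, Pi.sub_apply, Yv]; ring
      · rw [RegL_neg (fun h' => h3 h'.2), th, if_neg h3]
    · by_cases h3 : i (pos n 0) = i (pos n (b + 1)) + 1
      · rw [RegL_pos ⟨h, h3⟩, th, if_pos h3]
        simp only [Pi.one_apply, Pi.add_apply, Pi.neg_apply, Yv]; ring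
      · rw [RegL_neg (fun h' => h3 h'.2), th, if_neg h3]

theorem Ctx.RegF_RegL (j : ℕ) (hj : j + 2 ≤ n ∨ j = 0) (A : Set (EE F e n))
    (hA : ∀ a ∈ A, ∃ f ∈ P0s k e n, a = Γ.cE f) (f0 : PP k e n) (hf0 : f0 ∈ P0s k e n)
    (q : (Fin n → ZMod e) → Prop) (u : PP k e n) (hu : u * u = 1) :
    Γ.RegF j A (RegL f0 q u) := Γ.RegF_lin j hj A hA f0 hf0 q u hu

theorem P0s_wt (wt : ZMod e → k) (t : ℕ) :
    (fun i => MvPolynomial.C (wt (i (pos n t))) : PP k e n) ∈ P0s k e n := fun _ => tau0_C _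

theorem Ctx.RegF_Qt (j : ℕ) (hj : j + 2 ≤ n ∨ j = 0) (A : Set (EE F e n))
    (hA : ∀ a ∈ A, ∃ f ∈ P0s k e n, a = Γ.cE f) (b : ℕ) (hb : b + 1 < n) :
    Γ.RegF j A (Qt e n Γ.wt 0 (b + 1)) := by
  have hQ := funext (Qt_aux (n := n) Γ.wt b)
  rw [hQ]
  refine Γ.RegF_mul (Γ.RegF_RegL j hj A hA _ (Subring.sub_mem _ (P0s_Yv hb) (P0s_wt _ _)) _ _ ?_)
    (Γ.RegF_RegL j hj A hA _ (Subring.add_mem _ (P0s_Yv hb) (P0s_wt _ _)) _ _ ?_)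
  · exact one_mul 1
  · rw [neg_mul_neg, one_mul]

/-- Coefficient of the intertwiner. -/
noncomputable def Ctx.chi (r : ℕ) (p : Pt e n) : F :=
  if rs p r = rs p (r + 1) then 1 else th Γ.wF (rs p r) (rs p (r + 1)) (Γ.vr p r) (Γ.vr p (r + 1))

/-- The intertwiner. -/
noncomputable def Ctx.hh (r : ℕ) : EE F e n where
  toFun := fun μ p => Γ.chi r p * μ (mv p (sw n r))
  map_add' := by intro a b; funext p; simp; ring
  map_smul' := by intro a b; funext p; simp; ring

theorem Ctx.hh_apply (r : ℕ) (μ : Pt e n → F) (p : Pt e n) :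
    Γ.hh r μ p = Γ.chi r p * μ (mv p (sw n r)) := rfl

theorem Ctx.c_hh (r : ℕ) (f : PP k e n) : Γ.cE f * Γ.hh r = Γ.hh r * Γ.cE (act (sw n r) f) := by
  refine LinearMap.ext fun μ => funext fun p => ?_
  simp only [Module.End.mul_apply, Γ.hh_apply, Γ.cE_apply, Γ.ev_act, mv_sw_sw]
  ring

theorem Ctx.hh_eq {r : ℕ} (hr : r + 1 < n) : Γ.hh r = Γ.cE (1 - eta k e n r) * Γ.psi r +
    Γ.cE (eta k e n r) * (1 - Γ.cE (Yv k e n (r + 1) - Yv k e n r) * Γ.psi r) := by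
  refine LinearMap.ext fun μ => funext fun p => ?_
  have h0 := Γ.vr_inj p (t := r + 1) (t' := r) (by omega) (by omega) (by omega)
  simp only [Module.End.mul_apply, LinearMap.add_apply, LinearMap.sub_apply, Module.End.one_apply,
    Pi.add_apply, Pi.sub_apply, Γ.hh_apply, Γ.cE_apply, Γ.psi_apply, map_sub, map_one,
    Γ.ev_eta, Γ.ev_Yv, Ctx.chi, Ctx.alp, Ctx.bet, al, be]
  by_cases h : rs p r = rs p (r + 1)
  · simp only [if_pos h]; field_simp; ring
  · simp only [if_neg h]; ring

theorem Ctx.hh_mem {r j : ℕ} (hr : r + 1 < n) (hj : r < j) : Γ.hh r ∈ Γ.B j := by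
  rw [Γ.hh_eq hr]
  have hp : Γ.psi r ∈ Γ.B j := gen_a hj
  exact Subring.add_mem _ (Subring.mul_mem _ (Γ.cB _ _) hp) (Subring.mul_mem _ (Γ.cB _ _)
    (Subring.sub_mem _ (Subring.one_mem _) (Subring.mul_mem _ (Γ.cB _ _) hp)))

theorem Ctx.psi_hh_far {r t : ℕ} (hr : r + 1 < n) (ht : t + 1 < n) (h : r + 1 < t ∨ t + 1 < r) :
    Γ.psi r * Γ.hh t = Γ.hh t * Γ.psi r := by
  refine LinearMap.ext fun μ => funext fun p => ?_
  have e1 : rs (mv p (sw n r)) t = rs p t := rs_sw_ne _ hr (by omega) (by omega) (by omega)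
  have e2 : rs (mv p (sw n r)) (t + 1) = rs p (t + 1) :=
    rs_sw_ne _ hr (by omega) (by omega) (by omega)
  have e3 : rs (mv p (sw n t)) r = rs p r := rs_sw_ne _ ht (by omega) (by omega) (by omega)
  have e4 : rs (mv p (sw n t)) (r + 1) = rs p (r + 1) :=
    rs_sw_ne _ ht (by omega) (by omega) (by omega)
  have f1 : Γ.vr (mv p (sw n r)) t = Γ.vr p t := Γ.vr_sw_ne _ hr (by omega) (by omega) (by omega)
  have f2 : Γ.vr (mv p (sw n r)) (t + 1) = Γ.vr p (t + 1) :=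
    Γ.vr_sw_ne _ hr (by omega) (by omega) (by omega)
  have f3 : Γ.vr (mv p (sw n t)) r = Γ.vr p r := Γ.vr_sw_ne _ ht (by omega) (by omega) (by omega)
  have f4 : Γ.vr (mv p (sw n t)) (r + 1) = Γ.vr p (r + 1) :=
    Γ.vr_sw_ne _ ht (by omega) (by omega) (by omega)
  have g : mv (mv p (sw n r)) (sw n t) = mv (mv p (sw n t)) (sw n r) := by
    rw [mv_mv, mv_mv]
    rcases h with h | h
    · rw [sw_far h (by omega)]
    · rw [sw_far h (by omega)]
  simp only [Module.End.mul_apply, Γ.hh_apply, Γ.psi_apply, Ctx.chi, Ctx.alp, Ctx.bet, e1, e2, e3,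
    e4, f1, f2, f3, f4, g]
  ring

theorem Ctx.psi_hh_braid {r : ℕ} (hr : r + 2 < n) :
    Γ.psi r * (Γ.hh (r + 1) * Γ.hh r) = Γ.hh (r + 1) * Γ.hh r * Γ.psi (r + 1) := by
  refine LinearMap.ext fun μ => funext fun p => ?_
  have a1 : rs (mv p (sw n r)) (r + 1 + 1) = rs p (r + 1 + 1) :=
    rs_sw_ne _ (by omega) (by omega) (by omega) (by omega)
  have a2 : Γ.vr (mv p (sw n r)) (r + 1 + 1) = Γ.vr p (r + 1 + 1) :=
    Γ.vr_sw_ne _ (by omega) (by omega) (by omega) (by omega)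
  have a3 : ∀ p : Pt e n, rs (mv p (sw n (r + 1))) r = rs p r :=
    fun p => rs_sw_ne _ (by omega) (by omega) (by omega) (by omega)
  have a4 : ∀ p : Pt e n, Γ.vr (mv p (sw n (r + 1))) r = Γ.vr p r :=
    fun p => Γ.vr_sw_ne _ (by omega) (by omega) (by omega) (by omega)
  have a5 : rs (mv (mv p (sw n (r + 1))) (sw n r)) (r + 1 + 1) = rs p (r + 1) := by
    rw [rs_sw_ne _ (by omega) (by omega) (by omega) (by omega), rs_sw_r]
  have a6 : Γ.vr (mv (mv p (sw n (r + 1))) (sw n r)) (r + 1 + 1) = Γ.vr p (r + 1) := by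
    rw [Γ.vr_sw_ne _ (by omega) (by omega) (by omega) (by omega), Γ.vr_sw_r]
  have g : mv (mv (mv p (sw n r)) (sw n (r + 1))) (sw n r) =
      mv (mv (mv p (sw n (r + 1))) (sw n r)) (sw n (r + 1)) := by
    rw [mv_mv, mv_mv, mv_mv, mv_mv, ← mul_assoc, ← mul_assoc, sw_braid hr]
  simp only [Module.End.mul_apply, Γ.hh_apply, Γ.psi_apply, Ctx.chi, Ctx.alp, Ctx.bet, rs_sw_l,
    rs_sw_r, Γ.vr_sw_l, Γ.vr_sw_r, a1, a2, a3, a4, a5, a6, g]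
  ring

/-- Correction factor. -/
noncomputable def epsf (k : Type) [CommRing k] (e n : ℕ) [NeZero n] (r : ℕ) : PP k e n :=
  eta k e n r * (Yv k e n r - Yv k e n (r + 1)) + (1 - eta k e n r)

theorem Ctx.psi_g {r : ℕ} (hr : r + 1 < n) : Γ.psi r * (Γ.hh r * Γ.cE (epsf k e n r)) =
    Γ.cE (Qt e n Γ.wt r (r + 1)) + Γ.cE (eta k e n r) * Γ.hh r := by
  refine LinearMap.ext fun μ => funext fun p => ?_
  have h0 := Γ.vr_inj p (t := r + 1) (t' := r) (by omega) (by omega) (by omega)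
  have hQ : Γ.ev p (Qt e n Γ.wt r (r + 1)) = if rs p r = rs p (r + 1) then 1 else
      th Γ.wF (rs p r) (rs p (r + 1)) (Γ.vr p r) (Γ.vr p (r + 1)) *
      th Γ.wF (rs p (r + 1)) (rs p r) (Γ.vr p (r + 1)) (Γ.vr p r) := by
    rw [Γ.ev_apply, act_apply, Qt]
    have e1 : (p.1 ∘ p.2) (pos n r) = rs p r := rfl
    have e2 : (p.1 ∘ p.2) (pos n (r + 1)) = rs p (r + 1) := rfl
    rw [e1, e2]
    by_cases h : rs p r = rs p (r + 1)
    · rw [if_pos h, if_pos h, map_one, map_one]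
    · rw [if_neg h, if_neg h]
      unfold th
      split_ifs <;> simp [Ctx.wF, Ctx.vr]
  simp only [Module.End.mul_apply, LinearMap.add_apply, Pi.add_apply, Γ.hh_apply, Γ.cE_apply,
    Γ.psi_apply, mv_sw_sw]
  simp only [epsf, map_add, map_mul, map_sub, map_one, Γ.ev_eta, Γ.ev_Yv, Ctx.chi,
    Ctx.alp, Ctx.bet, rs_sw_l, rs_sw_r, Γ.vr_sw_l, Γ.vr_sw_r, al, be, hQ]
  by_cases h : rs p r = rs p (r + 1)
  · simp only [if_pos h, if_pos h.symm]; field_simp; ring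
  · simp only [if_neg h, if_neg (Ne.symm h)]; ring

/-- Product of intertwiners. -/
noncomputable def Ctx.Hd : ℕ → EE F e n
  | 0 => 1
  | t + 1 => Γ.hh t * Ctx.Hd t

/-- Product of corrected intertwiners. -/
noncomputable def Ctx.Gd : ℕ → EE F e n
  | 0 => 1
  | t + 1 => Γ.hh t * Γ.cE (epsf k e n t) * Ctx.Gd t

theorem Ctx.c_Hd (t : ℕ) : ∀ f : PP k e n, Γ.cE f * Γ.Hd t = Γ.Hd t * Γ.cE (mvd n t f) := by
  induction t with
  | zero => intro f; rw [Ctx.Hd, mul_one, one_mul, mvd]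
  | succ t ih =>
    intro f
    rw [Ctx.Hd, ← mul_assoc, Γ.c_hh, mul_assoc, ih, mvd, mul_assoc]

theorem Ctx.Gd_eq (t : ℕ) : ∃ E : PP k e n, Γ.Gd t = Γ.Hd t * Γ.cE E := by
  induction t with
  | zero => exact ⟨1, by rw [Ctx.Gd, Ctx.Hd, map_one, mul_one]⟩
  | succ t ih =>
    obtain ⟨E, hE⟩ := ih
    refine ⟨mvd n t (epsf k e n t) * E, ?_⟩
    rw [Ctx.Gd, Ctx.Hd, hE, mul_assoc, ← mul_assoc (Γ.cE _) (Γ.Hd t), Γ.c_Hd, map_mul]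
    simp only [mul_assoc]

theorem Ctx.c_Gd (t : ℕ) (f : PP k e n) : Γ.cE f * Γ.Gd t = Γ.Gd t * Γ.cE (mvd n t f) := by
  obtain ⟨E, hE⟩ := Γ.Gd_eq t
  rw [hE, ← mul_assoc, Γ.c_Hd, mul_assoc, mul_assoc, ← map_mul, ← map_mul, mul_comm E]

theorem Ctx.Hd_mem {t j : ℕ} (ht : t < n) (hj : t ≤ j) : Γ.Hd t ∈ Γ.B j := by
  induction t with
  | zero => exact Subring.one_mem _
  | succ t ih =>
    exact Subring.mul_mem _ (Γ.hh_mem ht (by omega)) (ih (by omega) (by omega))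

theorem Ctx.Gd_mem {t j : ℕ} (ht : t < n) (hj : t ≤ j) : Γ.Gd t ∈ Γ.B j := by
  obtain ⟨E, hE⟩ := Γ.Gd_eq t
  rw [hE]
  exact Subring.mul_mem _ (Γ.Hd_mem ht hj) (Γ.cB _ _)

theorem Ctx.psi_Hd_far (t : ℕ) : ∀ r, t < r → r + 1 < n → Γ.psi r * Γ.Hd t = Γ.Hd t * Γ.psi r := by
  induction t with
  | zero => intro r _ _; rw [Ctx.Hd, mul_one, one_mul]
  | succ t ih =>
    intro r h1 h2
    rw [Ctx.Hd, ← mul_assoc, Γ.psi_hh_far h2 (by omega) (by omega), mul_assoc,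
      ih r (by omega) h2, mul_assoc]

theorem Ctx.psi_Hd (t : ℕ) : ∀ r, r < t → t + 1 < n →
    Γ.psi r * Γ.Hd (t + 1) = Γ.Hd (t + 1) * Γ.psi (r + 1) := by
  induction t with
  | zero => intro r h; omega
  | succ t ih =>
    intro r h1 h2
    rcases Nat.lt_or_ge r t with h | h
    · rw [Ctx.Hd, ← mul_assoc, Γ.psi_hh_far (by omega) (by omega) (by omega), mul_assoc,
        ih r h (by omega), mul_assoc]
    · obtain rfl : r = t := by omega
      rw [Ctx.Hd, Ctx.Hd, ← mul_assoc, ← mul_assoc, mul_assoc (Γ.psi r), Γ.psi_hh_braid (by omega),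
        mul_assoc, Γ.psi_Hd_far r (r + 1) (by omega) (by omega), ← mul_assoc, ← mul_assoc]

theorem closure_tw {R : Type} [Ring R] {X : Set R} {S : Subring R} {H : R}
    (hX : ∀ x ∈ X, ∃ b' ∈ S, x * H = H * b') {b : R} (hb : b ∈ Subring.closure X) :
    ∃ b' ∈ S, b * H = H * b' := by
  induction hb using Subring.closure_induction with
  | mem x hx => exact hX x hx
  | zero => exact ⟨0, Subring.zero_mem _, by rw [zero_mul, mul_zero]⟩
  | one => exact ⟨1, Subring.one_mem _, by rw [one_mul, mul_one]⟩
  | add x y _ _ hx hy =>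
    obtain ⟨x', h1, h2⟩ := hx
    obtain ⟨y', h3, h4⟩ := hy
    exact ⟨x' + y', Subring.add_mem _ h1 h3, by rw [add_mul, h2, h4, mul_add]⟩
  | neg x _ hx =>
    obtain ⟨x', h1, h2⟩ := hx
    exact ⟨-x', Subring.neg_mem _ h1, by rw [neg_mul, h2, mul_neg]⟩
  | mul x y _ _ hx hy =>
    obtain ⟨x', h1, h2⟩ := hx
    obtain ⟨y', h3, h4⟩ := hy
    exact ⟨x' * y', Subring.mul_mem _ h1 h3, by rw [mul_assoc, h4, ← mul_assoc, h2, mul_assoc]⟩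

theorem Ctx.B_Hd (t : ℕ) (ht : t + 1 < n) {b : EE F e n} (hb : b ∈ Γ.B t) :
    ∃ b' ∈ Γ.Bs t, b * Γ.Hd (t + 1) = Γ.Hd (t + 1) * b' := by
  refine closure_tw ?_ hb
  intro x hx
  rcases hx with ⟨f, -, rfl⟩ | ⟨r, hr, rfl⟩
  · exact ⟨_, Γ.cBs _ _, Γ.c_Hd _ f⟩
  · have hr : r < t := hr
    refine ⟨_, gen_a (a := fun t => Γ.psi (1 + t)) hr, ?_⟩
    simp only [add_comm 1 r]
    exact Γ.psi_Hd t r hr ht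

theorem Ctx.Bs_mono {i j : ℕ} (h : i ≤ j) : Γ.Bs i ≤ Γ.Bs j := gen_mono le_rfl h
theorem Ctx.B_mono {i j : ℕ} (h : i ≤ j) : Γ.B i ≤ Γ.B j := gen_mono le_rfl h

/-- The product of the `Q`. -/
noncomputable def Ctx.Pi (t : ℕ) : PP k e n := ∏ a ∈ Finset.range t, Qt e n Γ.wt 0 (a + 1)

theorem Ctx.C_lemma {ℓ : ℕ} (ρ : Fin ℓ → ZMod e) (ν : Fin ℓ → k) (t : ℕ) (ht : t < n) :
    Γ.cE (aP e n ρ ν 0) * Wp Γ.psi 0 t * Γ.Gd t - Γ.cE (aP e n ρ ν 0) * Γ.cE (Γ.Pi t) ∈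
      LR (Γ.B t) {Γ.cE (aP e n ρ ν 1)} (Γ.Bs (t - 1)) := by
  induction t with
  | zero => simp [Wp, Ctx.Gd, Ctx.Pi]
  | succ t ih =>
    have ih := ih (by omega)
    have e1 : Γ.cE (aP e n ρ ν 0) * Wp Γ.psi 0 (t + 1) * Γ.Gd (t + 1) -
        Γ.cE (aP e n ρ ν 0) * Γ.cE (Γ.Pi (t + 1)) =
        (Γ.cE (aP e n ρ ν 0) * Wp Γ.psi 0 t * Γ.Gd t - Γ.cE (aP e n ρ ν 0) * Γ.cE (Γ.Pi t)) *
          Γ.cE (Qt e n Γ.wt 0 (t + 1)) +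
        Γ.cE (aP e n ρ ν 0) * ((Wp Γ.psi 0 t * Γ.cE (eta k e n t)) * (Γ.hh t * Γ.Gd t)) := by
      have h1 := Γ.psi_g ht
      have h2 := Γ.c_Gd t (Qt e n Γ.wt t (t + 1))
      rw [mvd_Qt _ _ _ (by omega) ht] at h2
      have h3 : Wp Γ.psi 0 (t + 1) * Γ.Gd (t + 1) =
          Wp Γ.psi 0 t * (Γ.Gd t * Γ.cE (Qt e n Γ.wt 0 (t + 1))) +
          Wp Γ.psi 0 t * (Γ.cE (eta k e n t) * Γ.hh t * Γ.Gd t) := by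
        rw [← h2, ← mul_add, ← add_mul, ← h1, Wp_succ_right, Ctx.Gd, zero_add]
        simp only [mul_assoc]
      rw [mul_assoc, h3, Ctx.Pi, Finset.prod_range_succ, ← Ctx.Pi, map_mul]
      simp only [mul_add, sub_mul, mul_assoc]
      abel
    rw [e1]
    refine AddSubgroup.add_mem _ ?_ ?_
    · exact LR_mono (Γ.B_mono (by omega)) le_rfl (Γ.Bs_mono (by omega))
        (LR_right (Γ.cBs _ _) ih)
    · obtain ⟨E, hE⟩ := Γ.Gd_eq t
      obtain ⟨b', hb', h⟩ := Γ.B_Hd t ht (b := Wp Γ.psi 0 t * Γ.cE (eta k e n t))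
        (Subring.mul_mem _ (Wp_mem _ _ _ _ fun s _ _ => gen_a (by omega)) (Γ.cB _ _))
      have h2 : Γ.cE (aP e n ρ ν 0) *
          ((Wp Γ.psi 0 t * Γ.cE (eta k e n t)) * (Γ.hh t * Γ.Gd t)) =
          Γ.Hd (t + 1) * Γ.cE (aP e n ρ ν 1) * (b' * Γ.cE E) := by
        rw [hE, ← mul_assoc (Γ.hh t), ← Ctx.Hd, ← mul_assoc _ (Γ.Hd (t + 1)), h, ← mul_assoc,
          ← mul_assoc, Γ.c_Hd, mvd_aP _ _ _ (by omega)]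
        simp only [mul_assoc]
      rw [h2]
      exact LR_base (Γ.Hd_mem ht le_rfl) rfl (Subring.mul_mem _ hb' (Γ.cBs _ _))

end Inter

end NB
end Paper

namespace Paper
namespace NB

/-! ### Part 6: torsion freeness -/

theorem Chain.rel_a {S : Type*} [Ring S] {P0 : Subring S} {a : ℕ → S} {m : ℕ} (H : Chain P0 a m)
    (r : ℕ) (hr : r + 1 < m) : a (r + 1) * Wp a 0 m - Wp a 0 m * a r ∈ TT P0 a m 1 := by
  obtain ⟨D, hD, hbr⟩ := H.braid r (by omega)
  have e1 : Wp a 0 m = Wp a 0 r * (a r * (a (r + 1) * Wp a (r + 2) (m - (r + 2)))) := by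
    have : Wp a 0 m = Wp a 0 (r + ((m - (r + 2)) + 1 + 1)) := by congr 1; omega
    rw [this, Wp_add, Nat.zero_add, Wp, Wp]
  have e2 : Commute (a (r + 1)) (Wp a 0 r) :=
    Wp_commute a _ _ 0 (fun t h4 h5 => (H.far t (r + 1) (by omega) (by omega)).symm)
  have e3 : Commute (a r) (Wp a (r + 2) (m - (r + 2))) :=
    Wp_commute a _ _ _ (fun t h4 h5 => H.far r t (by omega) (by omega))
  have e4 : a (r + 1) * Wp a 0 m = Wp a 0 m * a r +
      Wp a 0 r * (D * Wp a (r + 2) (m - (r + 2))) := by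
    rw [e1, ← mul_assoc, e2.eq, mul_assoc]
    have : a (r + 1) * (a r * (a (r + 1) * Wp a (r + 2) (m - (r + 2)))) =
        (a (r + 1) * a r * a (r + 1)) * Wp a (r + 2) (m - (r + 2)) := by simp only [mul_assoc]
    rw [this, hbr, add_mul, mul_add]
    congr 1
    simp only [mul_assoc]
    rw [e3.eq]
  rw [e4, add_sub_cancel_left]
  refine TT_mono _ _ _ (show 1 ≤ r + 2 by omega) ?_
  exact H.W_TT _ _ (by omega) (H.P_W (m - (r + 2)) (r + 2) (by omega) D hD)

theorem KRep.chF0 {k : Type} [CommRing k] [IsDomain k] {e n : ℕ} [NeZero n] {S : Type} [Ring S]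
    {wt : ZMod e → k} (H : KRep k e n wt S) (m : ℕ) (h : m + 1 ≤ n) : Chain H.P H.ψ m := by
  have := H.chF 0 m (by omega)
  simpa only [zero_add] using this

theorem KRep.rot {k : Type} [CommRing k] [IsDomain k] {e n : ℕ} [NeZero n] {S : Type} [Ring S]
    {wt : ZMod e → k} (H : KRep k e n wt S) {m : ℕ} (hm : m + 1 ≤ n) (d : ℕ) :
    ∀ c, c + d = m → ∀ f, H.c f * Wp H.ψ c d - Wp H.ψ c d * H.c (rt n c d f) ∈
      TT H.P H.ψ m (c + 1) := by
  have hch := H.chF0 m hm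
  induction d with
  | zero => intro c _ f; simp only [Wp, rt, mul_one, one_mul, sub_self]; exact AddSubgroup.zero_mem _
  | succ d ih =>
    intro c hc f
    obtain ⟨g, -, hg⟩ := H.cpsi (r := c) (by omega) f
    have e1 : H.c f * Wp H.ψ c (d + 1) - Wp H.ψ c (d + 1) * H.c (rt n c (d + 1) f) =
        H.ψ c * (H.c (act (sw n c) f) * Wp H.ψ (c + 1) d -
          Wp H.ψ (c + 1) d * H.c (rt n (c + 1) d (act (sw n c) f))) + H.c g * Wp H.ψ (c + 1) d := by
      rw [Wp, rt, ← mul_assoc, hg]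
      simp only [mul_sub, add_mul, mul_assoc]
      abel
    rw [e1]
    refine AddSubgroup.add_mem _ ?_ ?_
    · have h1 := hch.W_TT c 1 (c0 := c + 2) (by omega) (ih (c + 1) (by omega) (act (sw n c) f))
      rw [Wp, Wp, mul_one] at h1
      exact TT_mono _ _ _ (by omega) h1
    · have h1 := hch.P_W d (c + 1) (by omega) _ (H.c_mem g)
      rwa [show m - (c + 1) = d by omega] at h1

theorem closure_rel {S : Type*} [Ring S] (R : S → S → Prop) (X : Set S) (h0 : R 0 0) (h1 : R 1 1)
    (hadd : ∀ a b c d, R a b → R c d → R (a + c) (b + d)) (hneg : ∀ a b, R a b → R (-a) (-b))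
    (hmul : ∀ a b c d, R a b → R c d → R (a * c) (b * d)) (hX : ∀ x ∈ X, ∃ y, R x y) {b : S}
    (hb : b ∈ Subring.closure X) : ∃ y, R b y := by
  induction hb using Subring.closure_induction with
  | mem x hx => exact hX x hx
  | zero => exact ⟨0, h0⟩
  | one => exact ⟨1, h1⟩
  | add x y _ _ hx hy => exact ⟨_, hadd _ _ _ _ hx.choose_spec hy.choose_spec⟩
  | neg x _ hx => exact ⟨_, hneg _ _ hx.choose_spec⟩
  | mul x y _ _ hx hy => exact ⟨_, hmul _ _ _ _ hx.choose_spec hy.choose_spec⟩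

/-- The relation used to move `A w` around. -/
structure RelW {S : Type*} [Ring S] (A w : S) (J : AddSubgroup S) (B' B : Subring S) (b' b : S) :
    Prop where
  l : b' ∈ B'
  r : b ∈ B
  c : A * b' = b' * A
  h : A * b' * w - A * w * b ∈ J

section RelS
variable {S : Type*} [Ring S] {A w : S} {J : AddSubgroup S} {B' B : Subring S}

theorem RelW.zero : RelW A w J B' B 0 0 :=
  ⟨B'.zero_mem, B.zero_mem, by simp, by simp⟩
theorem RelW.one : RelW A w J B' B 1 1 :=
  ⟨B'.one_mem, B.one_mem, by simp, by simp⟩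
theorem RelW.add (a b c d : S) (h1 : RelW A w J B' B a b) (h2 : RelW A w J B' B c d) :
    RelW A w J B' B (a + c) (b + d) := by
  refine ⟨B'.add_mem h1.l h2.l, B.add_mem h1.r h2.r, by rw [mul_add, add_mul, h1.c, h2.c], ?_⟩
  have := J.add_mem h1.h h2.h
  convert this using 1
  noncomm_ring
theorem RelW.neg (a b : S) (h1 : RelW A w J B' B a b) : RelW A w J B' B (-a) (-b) := by
  refine ⟨B'.neg_mem h1.l, B.neg_mem h1.r, by rw [mul_neg, neg_mul, h1.c], ?_⟩
  have := J.neg_mem h1.h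
  convert this using 1
  noncomm_ring
theorem RelW.mul (hL : ∀ b ∈ B', ∀ z ∈ J, b * z ∈ J) (hR : ∀ b ∈ B, ∀ z ∈ J, z * b ∈ J) (a b c d : S) (h1 : RelW A w J B' B a b) (h2 : RelW A w J B' B c d) :
    RelW A w J B' B (a * c) (b * d) := by
  refine ⟨B'.mul_mem h1.l h2.l, B.mul_mem h1.r h2.r, by
    rw [← mul_assoc, h1.c, mul_assoc, h2.c, mul_assoc], ?_⟩
  have := J.add_mem (hL _ h1.l _ h2.h) (hR _ h2.r _ h1.h)
  convert this using 1
  have e1 : a * (A * c * w) = A * (a * c) * w := by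
    rw [← mul_assoc, ← mul_assoc, ← h1.c]; simp only [mul_assoc]
  have e2 : a * (A * w * d) = A * a * w * d := by
    rw [← mul_assoc, ← mul_assoc, ← h1.c]
  rw [mul_sub, sub_mul, e1, e2]
  simp only [mul_assoc]
  abel
end RelS

section Tors
variable {k F : Type} [CommRing k] [IsDomain k] [Field F] {e n : ℕ} [NeZero n] [NeZero e]
  (Γ : Ctx k F e n)

theorem Ctx.Bs_le_B (j : ℕ) : Γ.Bs j ≤ Γ.B (j + 1) := by
  apply (Subring.closure_le).2
  rintro z (⟨f, -, rfl⟩ | ⟨t, ht, rfl⟩)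
  · exact Γ.cB _ f
  · have ht : t < j := ht
    exact gen_a (a := Γ.psi) (by omega)

theorem Ctx.psi_mem {r j : ℕ} (h : r < j) : Γ.psi r ∈ Γ.B j := gen_a h

theorem Ctx.cs_comm (s : k) (j : ℕ) (hj : j + 1 ≤ n) {b : EE F e n} (hb : b ∈ Γ.B j) :
    Γ.cE (cs e n s) * b = b * Γ.cE (cs e n s) := by
  have h : Γ.B j ≤ Subring.centralizer {Γ.cE (cs e n s)} := by
    apply (Subring.closure_le).2
    rintro z (⟨f, -, rfl⟩ | ⟨t, ht, rfl⟩) x hx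
    · obtain rfl : x = _ := hx
      change Γ.cE _ * Γ.cE f = Γ.cE f * Γ.cE _
      rw [← map_mul, ← map_mul, mul_comm]
    · obtain rfl : x = _ := hx
      have ht : t < j := ht
      exact Γ.c_psi_comm (by omega) _ (act_cs _ _)
  exact h hb _ rfl

section step
variable {ℓ : ℕ} (ρ : Fin ℓ → ZMod e) (ν : Fin ℓ → k)

/-- The ideal. -/
noncomputable def Ctx.JJ (j : ℕ) : AddSubgroup (EE F e n) :=
  LR (Γ.B j) {Γ.cE (aP e n ρ ν 0)} (Γ.B j)

theorem Ctx.A_psi {r : ℕ} (hr : r + 2 < n) : Γ.cE (aP e n ρ ν 0) * Γ.psi (r + 1) =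
    Γ.psi (r + 1) * Γ.cE (aP e n ρ ν 0) :=
  Γ.c_psi_comm (by omega) _ (act_aP _ _ _ (sw_ne (by omega) (by omega) (by omega) (by omega)))

theorem Ctx.A_TT (j : ℕ) (hj : j + 2 ≤ n) {z : EE F e n} (hz : z ∈ TT Γ.rep.P Γ.psi (j + 1) 1) :
    Γ.cE (aP e n ρ ν 0) * z ∈ LR (Γ.B (j + 1)) {Γ.cE (aP e n ρ ν 0)} (Γ.B j) := by
  have h : TT Γ.rep.P Γ.psi (j + 1) 1 ≤
      (LR (Γ.B (j + 1)) {Γ.cE (aP e n ρ ν 0)} (Γ.B j)).comap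
        (AddMonoidHom.mulLeft (Γ.cE (aP e n ρ ν 0))) := by
    apply (AddSubgroup.closure_le _).2
    rintro z ⟨c, b, h1, h2, h3, rfl⟩
    change Γ.cE (aP e n ρ ν 0) * (Wp Γ.psi c (j + 1 - c) * b) ∈
      LR (Γ.B (j + 1)) {Γ.cE (aP e n ρ ν 0)} (Γ.B j)
    have h4 : Commute (Γ.cE (aP e n ρ ν 0)) (Wp Γ.psi c (j + 1 - c)) := by
      refine Wp_commute _ _ _ _ fun t ht1 ht2 => ?_
      obtain ⟨t, rfl⟩ : ∃ t', t = t' + 1 := ⟨t - 1, by omega⟩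
      exact Γ.A_psi ρ ν (by omega)
    rw [← mul_assoc, h4.eq]
    exact LR_base (Wp_mem _ _ _ _ fun t ht1 ht2 => Γ.psi_mem (by omega)) rfl h3
  exact h hz

theorem Ctx.rel_c (j : ℕ) (hj : j + 2 ≤ n) (f : PP k e n) :
    RelW (Γ.cE (aP e n ρ ν 0)) (Wp Γ.psi 0 (j + 1))
      (LR (Γ.B (j + 1)) {Γ.cE (aP e n ρ ν 0)} (Γ.B j)) (Γ.Bs j) (Γ.B j) (Γ.cE f)
      (Γ.cE (rt n 0 (j + 1) f)) := by
  refine ⟨Γ.cBs _ _, Γ.cB _ _, by rw [← map_mul, ← map_mul, mul_comm], ?_⟩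
  rw [mul_assoc, mul_assoc, ← mul_sub]
  exact Γ.A_TT ρ ν j hj (Γ.rep.rot (by omega) (j + 1) 0 (by omega) f)

theorem Ctx.rel_psi (j : ℕ) (hj : j + 2 ≤ n) (r : ℕ) (hr : r < j) :
    RelW (Γ.cE (aP e n ρ ν 0)) (Wp Γ.psi 0 (j + 1))
      (LR (Γ.B (j + 1)) {Γ.cE (aP e n ρ ν 0)} (Γ.B j)) (Γ.Bs j) (Γ.B j) (Γ.psi (1 + r))
      (Γ.psi r) := by
  refine ⟨gen_a (a := fun t => Γ.psi (1 + t)) hr, Γ.psi_mem hr, by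
    rw [add_comm]; exact Γ.A_psi ρ ν (by omega), ?_⟩
  rw [mul_assoc, mul_assoc, ← mul_sub, add_comm 1 r]
  exact Γ.A_TT ρ ν j hj ((Γ.rep.chF0 (j + 1) (by omega)).rel_a r (by omega))

theorem Ctx.rel2 (j : ℕ) (hj : j + 2 ≤ n) {b : EE F e n} (hb : b ∈ Γ.Bs j) :
    ∃ b', RelW (Γ.cE (aP e n ρ ν 0)) (Wp Γ.psi 0 (j + 1))
      (LR (Γ.B (j + 1)) {Γ.cE (aP e n ρ ν 0)} (Γ.B j)) (Γ.Bs j) (Γ.B j) b b' := by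
  have hL : ∀ b ∈ Γ.Bs j, ∀ z ∈ LR (Γ.B (j + 1)) {Γ.cE (aP e n ρ ν 0)} (Γ.B j),
    b * z ∈ LR (Γ.B (j + 1)) {Γ.cE (aP e n ρ ν 0)} (Γ.B j) :=
    fun b hb z hz => LR_left (Γ.Bs_le_B j hb) hz
  have hR : ∀ b ∈ Γ.B j, ∀ z ∈ LR (Γ.B (j + 1)) {Γ.cE (aP e n ρ ν 0)} (Γ.B j),
    z * b ∈ LR (Γ.B (j + 1)) {Γ.cE (aP e n ρ ν 0)} (Γ.B j) :=
    fun b hb z hz => LR_right hb hz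
  refine closure_rel (RelW _ _ _ _ _) _ RelW.zero RelW.one RelW.add
    RelW.neg (RelW.mul hL hR) ?_ hb
  rintro z (⟨f, -, rfl⟩ | ⟨t, ht, rfl⟩)
  · exact ⟨_, Γ.rel_c ρ ν j hj f⟩
  · exact ⟨_, Γ.rel_psi ρ ν j hj t ht⟩

theorem Ctx.rel1 (j : ℕ) (hj : j + 2 ≤ n) {b : EE F e n} (hb : b ∈ Γ.B j) :
    ∃ b', RelW (Γ.cE (aP e n ρ ν 0)) (Wp Γ.psi 0 (j + 1))
      (LR (Γ.B (j + 1)) {Γ.cE (aP e n ρ ν 0)} (Γ.B j)) (Γ.Bs j) (Γ.B j) b' b := by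
  have hL : ∀ b ∈ Γ.Bs j, ∀ z ∈ LR (Γ.B (j + 1)) {Γ.cE (aP e n ρ ν 0)} (Γ.B j),
    b * z ∈ LR (Γ.B (j + 1)) {Γ.cE (aP e n ρ ν 0)} (Γ.B j) :=
    fun b hb z hz => LR_left (Γ.Bs_le_B j hb) hz
  have hR : ∀ b ∈ Γ.B j, ∀ z ∈ LR (Γ.B (j + 1)) {Γ.cE (aP e n ρ ν 0)} (Γ.B j),
    z * b ∈ LR (Γ.B (j + 1)) {Γ.cE (aP e n ρ ν 0)} (Γ.B j) :=
    fun b hb z hz => LR_right hb hz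
  refine closure_rel (fun x y => RelW _ _ _ _ _ y x) _ RelW.zero RelW.one
    (fun a b c d => RelW.add b a d c)
    (fun a b => RelW.neg b a) (fun a b c d => RelW.mul hL hR b a d c) ?_ hb
  rintro z (⟨f, -, rfl⟩ | ⟨t, ht, rfl⟩)
  · obtain ⟨f', hf⟩ := rt_surj (n := n) (j + 1) 0 f
    have := Γ.rel_c ρ ν j hj f'
    rw [hf] at this
    exact ⟨_, this⟩
  · exact ⟨_, Γ.rel_psi ρ ν j hj t ht⟩

theorem Ctx.JJ_dec (j : ℕ) (hj : j + 2 ≤ n) {z : EE F e n} (hz : z ∈ Γ.JJ ρ ν (j + 1)) :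
    ∃ v ∈ Γ.B (j + 1), z - v * (Γ.cE (aP e n ρ ν 0) * Wp Γ.psi 0 (j + 1)) ∈
      LR (Γ.B (j + 1)) {Γ.cE (aP e n ρ ν 0)} (Γ.B j) := by
  set A := Γ.cE (aP e n ρ ν 0) with hA
  set w := Wp Γ.psi 0 (j + 1) with hw
  let M : AddSubgroup (EE F e n) := LR (Γ.B (j + 1)) {A} (Γ.B j) ⊔
    (Γ.B (j + 1)).toAddSubgroup.map (AddMonoidHom.mulRight (A * w))
  have hM : ∀ z ∈ M, ∃ v ∈ Γ.B (j + 1), z - v * (A * w) ∈ LR (Γ.B (j + 1)) {A} (Γ.B j) := by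
    intro z hz
    obtain ⟨u, hu, _, ⟨v, hv, rfl⟩, rfl⟩ := AddSubgroup.mem_sup.1 hz
    refine ⟨v, hv, ?_⟩
    change u + v * (A * w) - v * (A * w) ∈ _
    rwa [add_sub_cancel_right]
  apply hM
  have h1 : ∀ y ∈ TT Γ.rep.P Γ.psi (j + 1) 0, ∀ x ∈ Γ.B (j + 1), x * A * y ∈ M := by
    intro y hy x hx
    have h : TT Γ.rep.P Γ.psi (j + 1) 0 ≤ M.comap (AddMonoidHom.mulLeft (x * A)) := by
      apply (AddSubgroup.closure_le _).2
      rintro z ⟨c, b, h1, h2, h3, rfl⟩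
      change x * A * (Wp Γ.psi c (j + 1 - c) * b) ∈ M
      rcases Nat.eq_zero_or_pos c with rfl | hc
      · rw [Nat.sub_zero, ← hw]
        obtain ⟨b', hb'⟩ := Γ.rel1 ρ ν j hj (b := b) h3
        rw [← hA, ← hw] at hb'
        have e1 : x * A * (w * b) = -(x * (A * b' * w - A * w * b)) + (x * b') * (A * w) := by
          have := hb'.c
          simp only [mul_sub, mul_assoc] at this ⊢
          rw [← mul_assoc A b', this]
          simp only [mul_assoc]
          abel
        rw [e1]
        exact AddSubgroup.add_mem _ (AddSubgroup.mem_sup_left (AddSubgroup.neg_mem _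
          (LR_left hx hb'.h))) (AddSubgroup.mem_sup_right ⟨_, Subring.mul_mem _ hx
            (Γ.Bs_le_B j hb'.l), rfl⟩)
      · rw [mul_assoc]
        exact AddSubgroup.mem_sup_left (LR_left hx (Γ.A_TT ρ ν j hj (TT_base hc h2 h3)))
    exact h hy
  have h2 : Γ.JJ ρ ν (j + 1) ≤ M := by
    refine LR_le fun x hx a ha y hy => ?_
    obtain rfl : a = A := ha
    exact h1 y ((Γ.rep.chF0 (j + 1) (by omega)).gen_TT hy) x hx
  exact h2 hz

theorem Ctx.Jp_Aw (j : ℕ) (hj : j + 2 ≤ n) {z : EE F e n}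
    (hz : z ∈ LR (Γ.B (j + 1)) {Γ.cE (aP e n ρ ν 1)} (Γ.Bs j)) :
    z * (Γ.cE (aP e n ρ ν 0) * Wp Γ.psi 0 (j + 1)) ∈
      LR (Γ.B (j + 1)) {Γ.cE (aP e n ρ ν 0)} (Γ.B j) := by
  set A := Γ.cE (aP e n ρ ν 0) with hA
  set w := Wp Γ.psi 0 (j + 1) with hw
  have h : LR (Γ.B (j + 1)) {Γ.cE (aP e n ρ ν 1)} (Γ.Bs j) ≤
      (LR (Γ.B (j + 1)) {A} (Γ.B j)).comap (AddMonoidHom.mulRight (A * w)) := by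
    refine LR_le fun x hx a ha y hy => ?_
    change x * a * y * (A * w) ∈ LR (Γ.B (j + 1)) {A} (Γ.B j)
    obtain rfl : a = _ := ha
    obtain ⟨b, hb⟩ := Γ.rel2 ρ ν j hj hy
    have hr := Γ.rel_c ρ ν j hj (aP e n ρ ν 1)
    rw [rt_aP _ _ _ hj] at hr
    rw [← hA, ← hw] at hb hr
    have e1 : x * Γ.cE (aP e n ρ ν 1) * y * (A * w) =
        (x * Γ.cE (aP e n ρ ν 1)) * (A * y * w - A * w * b) +
        (x * (A * Γ.cE (aP e n ρ ν 1) * w - A * w * A)) * b + x * w * A * 0 + (x * A * w) * A * b := by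
      have h1 := hb.c
      have h2 := hr.c
      simp only [mul_sub, sub_mul, mul_assoc, mul_zero, add_zero] at h1 h2 ⊢
      rw [← mul_assoc A y, h1, ← mul_assoc A (Γ.cE _), h2]
      simp only [mul_assoc]
      abel
    rw [e1, mul_zero, add_zero]
    refine AddSubgroup.add_mem _ (AddSubgroup.add_mem _ ?_ ?_) ?_
    · exact LR_left (Subring.mul_mem _ hx (Γ.cB _ _)) hb.h
    · exact LR_right hb.r (LR_left hx hr.h)
    · exact LR_base (Subring.mul_mem _ (Subring.mul_mem _ hx (Γ.cB _ _))
        (Wp_mem _ _ _ _ fun t ht1 ht2 => Γ.psi_mem (by omega))) rfl hb.r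
  exact h hz

theorem Ctx.J_Gd (j : ℕ) (hj : j + 2 ≤ n) {z : EE F e n}
    (hz : z ∈ LR (Γ.B (j + 1)) {Γ.cE (aP e n ρ ν 0)} (Γ.B j)) :
    z * Γ.Gd (j + 1) ∈ LR (Γ.B (j + 1)) {Γ.cE (aP e n ρ ν 1)} (Γ.Bs j) := by
  have h : LR (Γ.B (j + 1)) {Γ.cE (aP e n ρ ν 0)} (Γ.B j) ≤
      (LR (Γ.B (j + 1)) {Γ.cE (aP e n ρ ν 1)} (Γ.Bs j)).comap
        (AddMonoidHom.mulRight (Γ.Gd (j + 1))) := by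
    refine LR_le fun x hx a ha y hy => ?_
    change x * a * y * Γ.Gd (j + 1) ∈ LR (Γ.B (j + 1)) {Γ.cE (aP e n ρ ν 1)} (Γ.Bs j)
    obtain rfl : a = _ := ha
    obtain ⟨E, hE⟩ := Γ.Gd_eq (j + 1)
    obtain ⟨y', hy', h⟩ := Γ.B_Hd j (by omega) hy
    have h3 := Γ.c_Hd (j + 1) (aP e n ρ ν 0)
    rw [mvd_aP _ _ _ hj] at h3
    have e1 : x * Γ.cE (aP e n ρ ν 0) * y * Γ.Gd (j + 1) =
        (x * Γ.Hd (j + 1)) * Γ.cE (aP e n ρ ν 1) * (y' * Γ.cE E) := by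
      rw [hE]
      simp only [mul_assoc]
      rw [← mul_assoc y, h, ← mul_assoc (Γ.cE (aP e n ρ ν 0)), ← mul_assoc (Γ.cE (aP e n ρ ν 0)), h3]
      simp only [mul_assoc]
    rw [e1]
    exact LR_base (Subring.mul_mem _ hx (Γ.Hd_mem (by omega) le_rfl)) rfl
      (Subring.mul_mem _ hy' (Γ.cBs _ _))
  exact h hz

theorem Ctx.J_sat (j : ℕ) (hj : j + 2 ≤ n) (s : k)
    (ih : ∀ b ∈ Γ.B j, Γ.cE (cs e n s) * b ∈ Γ.JJ ρ ν j → b ∈ Γ.JJ ρ ν j) {u : EE F e n}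
    (hu : u ∈ Γ.B (j + 1))
    (h : Γ.cE (cs e n s) * u ∈ LR (Γ.B (j + 1)) {Γ.cE (aP e n ρ ν 0)} (Γ.B j)) :
    u ∈ LR (Γ.B (j + 1)) {Γ.cE (aP e n ρ ν 0)} (Γ.B j) := by
  have hch := Γ.rep.chF0 (j + 1) (by omega)
  obtain ⟨b, hb, hbu⟩ := hch.span hu
  have hcl : LR (Γ.B (j + 1)) {Γ.cE (aP e n ρ ν 0)} (Γ.B j) ≤
      AddSubgroup.closure {z | ∃ c b, c ≤ j + 1 ∧ b ∈ Γ.JJ ρ ν j ∧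
        z = Wp Γ.psi c (j + 1 - c) * b} := by
    refine LR_le fun x hx a ha y hy => ?_
    obtain rfl : a = _ := ha
    obtain ⟨d, hd, hdx⟩ := hch.span hx
    rw [hdx, mul_assoc, Finset.sum_mul]
    refine AddSubgroup.sum_mem _ fun c hc => AddSubgroup.subset_closure ⟨c, d c * Γ.cE (aP e n ρ ν 0) * y,
      ?_, LR_base (hd c) rfl hy, by simp only [mul_assoc]; rfl⟩
    have := Finset.mem_range.1 hc
    omega
  obtain ⟨d, hd, hdu⟩ := closure_sum (fun c => Wp Γ.psi c (j + 1 - c)) (j + 1) (Γ.JJ ρ ν j) (hcl h)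
  have hJB : ∀ z ∈ Γ.JJ ρ ν j, z ∈ Γ.B j := fun z hz =>
    LR_sub (by rintro _ rfl; exact Γ.cB _ _) le_rfl hz
  have h0 : ∀ c, c ≤ j + 1 → Γ.cE (cs e n s) * b c - d c = 0 := by
    refine Γ.freeF 0 (j + 1) (by omega) _ ?_ ?_
    · intro c
      have h1 := Γ.genF_Loc 0 j (by omega)
      have e1 : gen Γ.rep.P (fun t => Γ.rep.ψ (0 + t)) j = Γ.B j := by
        simp only [zero_add]; rfl
      rw [e1] at h1
      rw [show 0 + (j + 1) = 0 + j + 1 by omega]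
      exact h1 (Subring.sub_mem _ (Subring.mul_mem _ (Γ.cB _ _) (hb c)) (hJB _ (hd c)))
    · simp only [zero_add, mul_sub, Finset.sum_sub_distrib]
      rw [← hdu, hbu, Finset.mul_sum, sub_eq_zero]
      refine Finset.sum_congr rfl fun c hc => ?_
      rw [← mul_assoc, ← mul_assoc]
      congr 1
      exact (Γ.cs_comm s (j + 1) (by omega)
        (Wp_mem _ _ _ _ fun t ht1 ht2 => Γ.psi_mem (by have := Finset.mem_range.1 hc; omega))).symm
  rw [hbu]
  refine AddSubgroup.sum_mem _ fun c hc => LR_left (Wp_mem _ _ _ _ fun t ht1 ht2 =>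
    Γ.psi_mem (by have := Finset.mem_range.1 hc; omega)) ?_
  have h1 := ih (b c) (hb c) (by
    rw [sub_eq_zero.1 (h0 c (by have := Finset.mem_range.1 hc; omega))]; exact hd c)
  exact LR_mono (Γ.B_mono (Nat.le_succ j)) le_rfl le_rfl h1

theorem Ctx.tors (s : k) (hs : s ≠ 0) (j : ℕ) : j + 1 ≤ n → ∀ b ∈ Γ.B j,
    Γ.cE (cs e n s) * b ∈ Γ.JJ ρ ν j → b ∈ Γ.JJ ρ ν j := by
  induction j with
  | zero =>
    intro hn b hb h
    have hP : ∀ x ∈ Γ.B 0, ∃ f, x = Γ.cE f := by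
      intro x hx
      rw [Ctx.B, gen_zero] at hx
      obtain ⟨f, -, rfl⟩ := hx
      exact ⟨f, rfl⟩
    obtain ⟨f0, rfl⟩ := hP b hb
    have h1 : ∀ z ∈ Γ.JJ ρ ν 0, ∃ f, z = Γ.cE (aP e n ρ ν 0 * f) := by
      intro z hz
      have : Γ.JJ ρ ν 0 ≤ ((⊤ : AddSubgroup (PP k e n)).map
          (AddMonoidHom.mulLeft (aP e n ρ ν 0))).map Γ.cE.toAddMonoidHom := by
        refine LR_le fun x hx a ha y hy => ?_
        obtain ⟨f, rfl⟩ := hP x hx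
        obtain ⟨g, rfl⟩ := hP y hy
        obtain rfl : a = _ := ha
        refine ⟨_, ⟨f * g, trivial, rfl⟩, ?_⟩
        change Γ.cE (aP e n ρ ν 0 * (f * g)) = _
        rw [← map_mul, ← map_mul]
        congr 1
        ring
      obtain ⟨_, ⟨f, -, rfl⟩, rfl⟩ := this hz
      exact ⟨f, rfl⟩
    obtain ⟨f1, hf1⟩ := h1 _ h
    rw [← map_mul] at hf1
    have h2 : cs e n s * f0 = aP e n ρ ν 0 * f1 := sub_eq_zero.1 (Γ.cE_inj _ (by
      rw [map_sub, hf1, sub_self]))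
    have hreg := Γ.RegF_aP 0 (Or.inr rfl) {Γ.cE (cs e n s)}
      (by rintro _ rfl; exact ⟨_, P0s_cs s, rfl⟩) ρ ν
    have h3 := hreg (Γ.cE f1) (Γ.cBs _ _) (by
      rw [← map_mul, mul_comm, ← h2]
      have := LR_base (B := Γ.Bs 0) (A := {Γ.cE (cs e n s)}) (B0 := Γ.Bs 0) (Subring.one_mem _)
        rfl (Γ.cBs 0 f0)
      rwa [one_mul, ← map_mul] at this)
    have hP' : ∀ x ∈ Γ.Bs 0, ∃ f, x = Γ.cE f := by
      intro x hx
      rw [Ctx.Bs, gen_zero] at hx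
      obtain ⟨f, -, rfl⟩ := hx
      exact ⟨f, rfl⟩
    have h4 : ∃ f2, Γ.cE f1 = Γ.cE (cs e n s * f2) := by
      have : LR (Γ.Bs 0) {Γ.cE (cs e n s)} (Γ.Bs 0) ≤ ((⊤ : AddSubgroup (PP k e n)).map
          (AddMonoidHom.mulLeft (cs e n s))).map Γ.cE.toAddMonoidHom := by
        refine LR_le fun x hx a ha y hy => ?_
        obtain ⟨f, rfl⟩ := hP' x hx
        obtain ⟨g, rfl⟩ := hP' y hy
        obtain rfl : a = _ := ha
        refine ⟨_, ⟨f * g, trivial, rfl⟩, ?_⟩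
        change Γ.cE (cs e n s * (f * g)) = _
        rw [← map_mul, ← map_mul]
        congr 1
        ring
      obtain ⟨_, ⟨f, -, rfl⟩, hf⟩ := this h3
      exact ⟨f, hf.symm⟩
    obtain ⟨f2, hf2⟩ := h4
    have h5 : f1 = cs e n s * f2 := sub_eq_zero.1 (Γ.cE_inj _ (by rw [map_sub, hf2, sub_self]))
    have h6 : f0 = aP e n ρ ν 0 * f2 := by
      funext i
      have := congrFun h2 i
      rw [h5] at this
      simp only [Pi.mul_apply] at this ⊢
      have hC : (cs e n s : PP k e n) i ≠ 0 := by
        simp only [cs]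
        exact (map_ne_zero_iff _ (MvPolynomial.C_injective _ _)).2 hs
      apply mul_left_cancel₀ hC
      rw [this]; ring
    rw [h6]
    have := LR_base (B := Γ.B 0) (A := {Γ.cE (aP e n ρ ν 0)}) (B0 := Γ.B 0) (Subring.one_mem _)
        rfl (Γ.cB 0 f2)
    rwa [one_mul, ← map_mul] at this
  | succ j ih =>
    intro hn b hb h
    have ih := ih (by omega)
    have hj : j + 2 ≤ n := by omega
    set A := Γ.cE (aP e n ρ ν 0) with hA
    set w := Wp Γ.psi 0 (j + 1) with hw
    set σ := Γ.cE (cs e n s) with hσ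
    have hwB : w ∈ Γ.B (j + 1) := Wp_mem _ _ _ _ fun t ht1 ht2 => Γ.psi_mem (by omega)
    obtain ⟨v, hv, hu⟩ := Γ.JJ_dec ρ ν j hj h
    have hu2 := Γ.J_Gd ρ ν j hj hu
    have hC := LR_left hv (Γ.C_lemma ρ ν (j + 1) (by omega))
    rw [← hA, ← hw] at hu2 hC
    have hle : LR (Γ.B (j + 1)) {Γ.cE (aP e n ρ ν 1)} (Γ.Bs j) ≤
        LR (Γ.B (j + 1)) {σ, Γ.cE (aP e n ρ ν 1)} (Γ.Bs j) :=
      LR_mono le_rfl (by rintro _ rfl; exact Or.inr rfl) le_rfl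
    have hGB := Γ.Gd_mem (t := j + 1) (j := j + 1) (by omega) le_rfl
    have h3 : v * Γ.cE (aP e n ρ ν 0 * Γ.Pi (j + 1)) ∈
        LR (Γ.B (j + 1)) {σ, Γ.cE (aP e n ρ ν 1)} (Γ.Bs j) := by
      have e1 : v * Γ.cE (aP e n ρ ν 0 * Γ.Pi (j + 1)) =
          (b * Γ.Gd (j + 1)) * σ * 1 - (σ * b - v * (A * w)) * Γ.Gd (j + 1) -
          v * (A * w * Γ.Gd (j + 1) - A * Γ.cE (Γ.Pi (j + 1))) := by
        rw [← Γ.cs_comm s (j + 1) (by omega) (Subring.mul_mem _ hb hGB), map_mul]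
        simp only [mul_sub, sub_mul, mul_assoc, mul_one]
        abel
      rw [e1]
      exact AddSubgroup.sub_mem _ (AddSubgroup.sub_mem _ (LR_base (Subring.mul_mem _ hb hGB)
        (Or.inl rfl) (Subring.one_mem _)) (hle hu2)) (hle hC)
    have hA' : ∀ a ∈ ({σ, Γ.cE (aP e n ρ ν 1)} : Set (EE F e n)), ∃ f ∈ P0s k e n, a = Γ.cE f := by
      rintro _ (rfl | rfl)
      · exact ⟨_, P0s_cs s, rfl⟩
      · exact ⟨_, P0s_aP ρ ν (by omega), rfl⟩
    have hreg : Γ.RegF j {σ, Γ.cE (aP e n ρ ν 1)} (aP e n ρ ν 0 * Γ.Pi (j + 1)) := by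
      refine Γ.RegF_mul (Γ.RegF_aP j (Or.inl hj) _ hA' ρ ν) (Γ.RegF_prod _ _ fun a ha => ?_)
      exact Γ.RegF_Qt j (Or.inl hj) _ hA' a (by have := Finset.mem_range.1 ha; omega)
    have h4 := Γ.reg_B j hj {σ, Γ.cE (aP e n ρ ν 1)} _ (by
      intro a ha
      obtain ⟨f, -, rfl⟩ := hA' a ha
      exact Γ.cBs _ _) hreg hv h3
    have h5 : ∃ v1 ∈ Γ.B (j + 1), ∃ z ∈ LR (Γ.B (j + 1)) {Γ.cE (aP e n ρ ν 1)} (Γ.Bs j),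
        σ * v1 + z = v := by
      have : LR (Γ.B (j + 1)) {σ, Γ.cE (aP e n ρ ν 1)} (Γ.Bs j) ≤
          ((Γ.B (j + 1)).toAddSubgroup.map (AddMonoidHom.mulLeft σ)) ⊔
          LR (Γ.B (j + 1)) {Γ.cE (aP e n ρ ν 1)} (Γ.Bs j) := by
        refine LR_le fun x hx a ha y hy => ?_
        rcases ha with rfl | rfl
        · refine AddSubgroup.mem_sup_left ⟨x * y, Subring.mul_mem _ hx (Γ.Bs_le_B j hy), ?_⟩
          change σ * (x * y) = x * σ * y
          rw [← mul_assoc, Γ.cs_comm s (j + 1) (by omega) hx]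
        · exact AddSubgroup.mem_sup_right (LR_base hx rfl hy)
      obtain ⟨_, ⟨v1, hv1, rfl⟩, z, hz, h⟩ := AddSubgroup.mem_sup.1 (this h4)
      exact ⟨v1, hv1, z, hz, h⟩
    obtain ⟨v1, hv1, z, hz, rfl⟩ := h5
    have h6 : σ * (b - v1 * (A * w)) ∈ LR (Γ.B (j + 1)) {A} (Γ.B j) := by
      have e1 : σ * (b - v1 * (A * w)) = (σ * b - (σ * v1 + z) * (A * w)) + z * (A * w) := by
        simp only [mul_sub, add_mul, mul_assoc]
        abel
      rw [e1]
      exact AddSubgroup.add_mem _ hu (Γ.Jp_Aw ρ ν j hj hz)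
    have hvA : v1 * (A * w) ∈ Γ.B (j + 1) :=
      Subring.mul_mem _ hv1 (Subring.mul_mem _ (Γ.cB _ _) hwB)
    have h7 := Γ.J_sat ρ ν j hj s ih (Subring.sub_mem _ hb hvA) h6
    have h8 : b - v1 * (A * w) ∈ Γ.JJ ρ ν (j + 1) :=
      LR_mono le_rfl le_rfl (Γ.B_mono (Nat.le_succ j)) h7
    have h9 : v1 * A * w ∈ Γ.JJ ρ ν (j + 1) := LR_base hv1 rfl hwB
    have e1 : b = (b - v1 * (A * w)) + v1 * A * w := by rw [mul_assoc, sub_add_cancel]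
    rw [e1]
    exact AddSubgroup.add_mem _ h8 h9

end step
end Tors
end NB
end Paper

namespace Paper
namespace NB

/-! ### Part 7: the spectrum -/

/-- Modules. -/
structure KMod (k : Type) [CommRing k] (e n : ℕ) [NeZero n] (wt : ZMod e → k) (V : Type)
    [AddCommGroup V] [Module (PP k e n) V] where
  ψ : ℕ → V →+ V
  h1 : ∀ r, r + 1 < n → ∀ f g : PP k e n,
    (Yv k e n (r + 1) - Yv k e n r) * g = eta k e n r * (f - act (sw n r) f) →
    ∀ v, ψ r (f • v) = act (sw n r) f • ψ r v + g • v
  h2 : ∀ r, r + 1 < n → ∀ v, ψ r (ψ r v) = Qr e n wt r • v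
  h4 : ∀ r, r + 2 < n → ∀ v,
    ψ (r + 1) (ψ r (ψ (r + 1) v)) = ψ r (ψ (r + 1) (ψ r v)) + Dr e n wt r • v
  tf : ∀ s : k, s ≠ 0 → ∀ v : V, cs e n s • v = 0 → v = 0

/-- Weights. -/
def wg {ℓ : ℕ} (κ : Fin ℓ → ℤ) (c : ℕ → ℤ) (m : ℕ) (d : ℤ) : ℤ :=
  (∑ l, if κ l = d then 1 else 0) + ∑ t ∈ Finset.range m,
    ((if d = c t + 1 then 1 else 0) + (if d = c t - 1 then 1 else 0) -
      2 * (if d = c t then 1 else 0))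

/-- Good sequences. -/
def good {ℓ : ℕ} (κ : Fin ℓ → ℤ) (c : ℕ → ℤ) (m : ℕ) : Prop := ∀ t, t < m → wg κ c t (c t) = 1

/-- Spectral data. -/
structure SD (k : Type) [CommRing k] (e n : ℕ) (wt : ZMod e → k) {ℓ : ℕ} (κ : Fin ℓ → ℤ) where
  val : ℤ → k
  hv1 : ∀ c, val (c + 1) = val c + wt (c : ZMod e)
  hv2 : ∀ c d : ℤ, (c : ZMod e) = d → val c = val d → c = d
  he : (1 : ZMod e) ≠ 0
  inj : Function.Injective κ
  w1 : ∀ c m, m + 1 ≤ n → good κ c m → ∀ d, wg κ c m d = -1 ∨ wg κ c m d = 0 ∨ wg κ c m d = 1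
  w2 : ∀ c m, m + 2 ≤ n → good κ c m → ∀ a, wg κ c m a = 1 → wg κ c m (a + 1) = 1 → False

section PPthree
variable {k : Type} [CommRing k] {e n : ℕ} [NeZero n]

theorem cs_mul (a b : k) : (cs e n (a * b) : PP k e n) = cs e n a * cs e n b := by
  funext i; simp [cs]
theorem cs_add (a b : k) : (cs e n (a + b) : PP k e n) = cs e n a + cs e n b := by
  funext i; simp [cs]
theorem cs_sub (a b : k) : (cs e n (a - b) : PP k e n) = cs e n a - cs e n b := by
  funext i; simp [cs]
theorem cs_zero : (cs e n (0 : k) : PP k e n) = 0 := by funext i; simp [cs]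
theorem cs_one : (cs e n (1 : k) : PP k e n) = 1 := by funext i; simp [cs]

/-- Residue idempotents. -/
noncomputable def eps (k : Type) [CommRing k] (e n : ℕ) [NeZero n] (t : ℕ) (j : ZMod e) :
    PP k e n := ind k fun i => i (pos n t) = j

theorem eps_sq (t : ℕ) (j : ZMod e) : eps k e n t j * eps k e n t j = eps k e n t j := by
  funext i; simp only [eps, ind, Pi.mul_apply]; split_ifs <;> simp

theorem eps_ne (t : ℕ) {j j' : ZMod e} (h : j ≠ j') : eps k e n t j * eps k e n t j' = 0 := by
  funext i
  simp only [eps, ind, Pi.mul_apply, Pi.zero_apply]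
  split_ifs with h1 h2
  · exact absurd (h1.symm.trans h2) h
  all_goals simp

theorem act_eps (σ : Equiv.Perm (Fin n)) {t t' : ℕ} (h : σ (pos n t) = pos n t') (j : ZMod e) :
    act σ (eps k e n t j) = eps k e n t' j := by
  rw [eps, act_ind]
  simp only [Function.comp, h]
  rfl

theorem act_Yv' (σ : Equiv.Perm (Fin n)) {t t' : ℕ} (h : σ (pos n t) = pos n t') :
    act σ (Yv k e n t) = Yv k e n t' := by
  rw [act_Yv, h]; rfl

theorem eta_eps (r : ℕ) (j : ZMod e) :
    eta k e n r * (eps k e n r j - eps k e n (r + 1) j) = 0 := by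
  funext i
  simp only [eta, eps, ind, Pi.mul_apply, Pi.sub_apply, Pi.zero_apply]
  split_ifs <;> simp_all

theorem eta_same (r : ℕ) (j : ZMod e) :
    eta k e n r * (eps k e n r j * eps k e n (r + 1) j) = eps k e n r j * eps k e n (r + 1) j := by
  funext i
  simp only [eta, eps, ind, Pi.mul_apply]
  split_ifs with h1 h2 h3 <;> simp_all

theorem eta_diff (r : ℕ) {j j' : ZMod e} (h : j ≠ j') :
    eta k e n r * (eps k e n r j * eps k e n (r + 1) j') = 0 := by
  funext i
  simp only [eta, eps, ind, Pi.mul_apply, Pi.zero_apply]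
  split_ifs with h1 h2 h3 <;> simp_all

theorem eta_sq (r : ℕ) : eta k e n r * eta k e n r = eta k e n r := by
  funext i; simp only [eta, ind, Pi.mul_apply]; split_ifs <;> simp

/-- Products of linear factors. -/
noncomputable def pf (e n : ℕ) [NeZero n] (val : ℤ → k) (t : ℕ) (S : Finset ℤ) : PP k e n :=
  ∏ d ∈ S, (Yv k e n t - cs e n (val d))

theorem act_pf (σ : Equiv.Perm (Fin n)) {t t' : ℕ} (h : σ (pos n t) = pos n t') (val : ℤ → k)
    (S : Finset ℤ) : act σ (pf e n val t S) = pf e n val t' S := by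
  rw [pf, map_prod]
  exact Finset.prod_congr rfl fun d _ => by rw [map_sub, act_Yv' σ h, act_cs]

theorem Qr_eps (wt : ZMod e → k) (r : ℕ) {i j : ZMod e} (h : i ≠ j) :
    Qr e n wt r * (eps k e n r i * eps k e n (r + 1) j) =
    th (fun a => cs e n (wt a)) i j (Yv k e n r) (Yv k e n (r + 1)) *
      th (fun a => cs e n (wt a)) j i (Yv k e n (r + 1)) (Yv k e n r) *
      (eps k e n r i * eps k e n (r + 1) j) := by
  funext x
  simp only [eps, ind, Pi.mul_apply, Qr]
  by_cases h1 : x (pos n r) = i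
  · by_cases h2 : x (pos n (r + 1)) = j
    · rw [if_pos h1, if_pos h2, h1, h2, QQ, if_neg h]
      unfold th
      split_ifs <;> simp [cs, Yv]
    · rw [if_neg h2]; simp
  · rw [if_neg h1]; simp

theorem Qr_same (wt : ZMod e → k) (r : ℕ) (j : ZMod e) :
    Qr e n wt r * (eps k e n r j * eps k e n (r + 1) j) = 0 := by
  funext x
  simp only [eps, ind, Pi.mul_apply, Qr, Pi.zero_apply]
  by_cases h1 : x (pos n r) = j
  · by_cases h2 : x (pos n (r + 1)) = j
    · rw [if_pos h1, if_pos h2, h1, h2, QQ, if_pos rfl, zero_mul]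
    · rw [if_neg h2]; simp
  · rw [if_neg h1]; simp

theorem Dr_eps (wt : ZMod e → k) (r : ℕ) {i j : ZMod e} (h : i ≠ j) :
    Dr e n wt r * (eps k e n r i * eps k e n (r + 1) j * eps k e n (r + 2) i) =
    ((if j = i + 1 then 1 else 0) *
      th (fun a => cs e n (wt a)) j i (Yv k e n (r + 1)) (Yv k e n r) +
      th (fun a => cs e n (wt a)) i j (Yv k e n (r + 2)) (Yv k e n (r + 1)) *
      (if i = j + 1 then -1 else 0)) *
      (eps k e n r i * eps k e n (r + 1) j * eps k e n (r + 2) i) := by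
  funext x
  simp only [eps, ind, Pi.mul_apply, Dr]
  by_cases h1 : x (pos n r) = i
  · by_cases h2 : x (pos n (r + 1)) = j
    · by_cases h3 : x (pos n (r + 2)) = i
      · rw [if_pos h1, if_pos h2, if_pos h3, h1, h2, h3, DD, if_pos ⟨rfl, h⟩]
        unfold th
        split_ifs <;> simp [cs, Yv]
      · rw [if_neg h3]; simp
    · rw [if_neg h2]; simp
  · rw [if_neg h1]; simp

end PPthree

section Spec
variable {k : Type} [CommRing k] [IsDomain k] {e n : ℕ} [NeZero n] {wt : ZMod e → k}
  {V : Type} [AddCommGroup V] [Module (PP k e n) V] (M : KMod k e n wt V)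
  {ℓ : ℕ} {κ : Fin ℓ → ℤ} (D : SD k e n wt κ)

/-- Eigenvector condition at one position. -/
structure SD.Ep (D : SD k e n wt κ) (t : ℕ) (x : ℤ) (v : V) : Prop where
  ep : eps k e n t (x : ZMod e) • v = v
  Y : Yv k e n t • v = cs e n (D.val x) • v

theorem SD.Ep.smul {D : SD k e n wt κ} {t : ℕ} {x : ℤ} {v : V} (h : D.Ep t x v) (f : PP k e n) :
    D.Ep t x (f • v) :=
  ⟨by rw [smul_comm, h.ep], by rw [smul_comm, h.Y, smul_comm]⟩

theorem KMod.psi_fix {r : ℕ} (hr : r + 1 < n) {f f' : PP k e n} (hf : act (sw n r) f = f')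
    (h0 : eta k e n r * (f - f') = 0) (v : V) : M.ψ r (f • v) = f' • M.ψ r v := by
  rw [M.h1 r hr f 0 (by rw [hf, h0, mul_zero]), hf, zero_smul, add_zero]

theorem KMod.psi_cs {r : ℕ} (hr : r + 1 < n) (s : k) (v : V) :
    M.ψ r (cs e n s • v) = cs e n s • M.ψ r v :=
  M.psi_fix hr (act_cs _ _) (by rw [sub_self, mul_zero]) v

theorem KMod.psi_eps_l {r : ℕ} (hr : r + 1 < n) (j : ZMod e) (v : V) :
    M.ψ r (eps k e n r j • v) = eps k e n (r + 1) j • M.ψ r v :=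
  M.psi_fix hr (act_eps _ (sw_left r) j) (eta_eps r j) v

theorem KMod.psi_eps_r {r : ℕ} (hr : r + 1 < n) (j : ZMod e) (v : V) :
    M.ψ r (eps k e n (r + 1) j • v) = eps k e n r j • M.ψ r v :=
  M.psi_fix hr (act_eps _ (sw_right r) j) (by
    rw [← neg_sub, mul_neg, eta_eps, neg_zero]) v

theorem KMod.psi_Y_r {r : ℕ} (hr : r + 1 < n) (v : V) :
    M.ψ r (Yv k e n (r + 1) • v) = Yv k e n r • M.ψ r v + eta k e n r • v := by
  rw [M.h1 r hr _ (eta k e n r) (by rw [act_Yv' _ (sw_right r), mul_comm]), act_Yv' _ (sw_right r)]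

theorem KMod.psi_Y_l {r : ℕ} (hr : r + 1 < n) (v : V) :
    M.ψ r (Yv k e n r • v) = Yv k e n (r + 1) • M.ψ r v - eta k e n r • v := by
  rw [M.h1 r hr _ (-eta k e n r) (by rw [act_Yv' _ (sw_left r)]; ring), act_Yv' _ (sw_left r),
    neg_smul, sub_eq_add_neg]

theorem KMod.Ep_far {D : SD k e n wt κ} {r t : ℕ} (hr : r + 1 < n) (ht : t < n) (h1 : t ≠ r)
    (h2 : t ≠ r + 1) {x : ℤ} {v : V} (h : D.Ep t x v) : D.Ep t x (M.ψ r v) := by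
  have hs := sw_ne hr ht h1 h2
  constructor
  · rw [← M.psi_fix hr (act_eps _ hs _) (by rw [sub_self, mul_zero]), h.ep]
  · rw [← M.psi_fix hr (act_Yv' _ hs) (by rw [sub_self, mul_zero]), h.Y, M.psi_cs hr]

theorem KMod.Ep_l {D : SD k e n wt κ} {r : ℕ} (hr : r + 1 < n) {x : ℤ} {v : V} (h : D.Ep r x v)
    (h0 : eta k e n r • v = 0) : D.Ep (r + 1) x (M.ψ r v) := by
  constructor
  · rw [← M.psi_eps_l hr, h.ep]
  · have := M.psi_Y_l hr v
    rw [h0, sub_zero, h.Y, M.psi_cs hr] at this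
    exact this.symm

theorem KMod.Ep_r {D : SD k e n wt κ} {r : ℕ} (hr : r + 1 < n) {x : ℤ} {v : V}
    (h : D.Ep (r + 1) x v) (h0 : eta k e n r • v = 0) : D.Ep r x (M.ψ r v) := by
  constructor
  · rw [← M.psi_eps_r hr, h.ep]
  · have := M.psi_Y_r hr v
    rw [h0, add_zero, h.Y, M.psi_cs hr] at this
    exact this.symm

theorem eta_zero {r : ℕ} {i j : ZMod e} (h : i ≠ j) {v : V} (h1 : eps k e n r i • v = v)
    (h2 : eps k e n (r + 1) j • v = v) : eta k e n r • v = 0 := by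
  rw [← h1, ← h2, smul_smul, smul_smul, mul_assoc, eta_diff r h, zero_smul]

theorem eta_one {r : ℕ} {j : ZMod e} {v : V} (h1 : eps k e n r j • v = v)
    (h2 : eps k e n (r + 1) j • v = v) : eta k e n r • v = v := by
  have h3 : (eps k e n r j * eps k e n (r + 1) j) • v = v := by rw [mul_smul, h2, h1]
  conv_lhs => rw [← h3]
  rw [smul_smul, eta_same, h3]

theorem Ep_res {D : SD k e n wt κ} {t : ℕ} {x : ℤ} {v : V} (h : D.Ep t x v) {j : ZMod e}
    (h2 : eps k e n t j • v = v) (hj : (x : ZMod e) ≠ j) : v = 0 := by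
  rw [← h.ep, ← h2, smul_smul, eps_ne t hj, zero_smul]

theorem eig_pf {D : SD k e n wt κ} {t : ℕ} {x : ℤ} {v : V} (h : D.Ep t x v) (S : Finset ℤ) :
    pf e n D.val t S • v = cs e n (∏ d ∈ S, (D.val x - D.val d)) • v := by
  induction S using Finset.induction_on with
  | empty => rw [pf, Finset.prod_empty, Finset.prod_empty, cs_one]
  | insert d S hd ih =>
    rw [Finset.prod_insert hd, cs_mul, mul_smul, ← ih, pf, Finset.prod_insert hd, ← pf, mul_smul,
      smul_comm, sub_smul, h.Y, ← sub_smul, ← cs_sub, smul_comm]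

theorem KMod.eig_mem (M : KMod k e n wt V) {D : SD k e n wt κ} {t : ℕ} {x : ℤ} {v : V}
    (h : D.Ep t x v) {S : Finset ℤ}
    (hS : ∀ d ∈ S, (d : ZMod e) = x) (h0 : pf e n D.val t S • v = 0) (hx : x ∉ S) : v = 0 := by
  rw [eig_pf h] at h0
  refine M.tf _ (Finset.prod_ne_zero_iff.2 fun d hd h1 => hx ?_) v h0
  rwa [D.hv2 x d (hS d hd).symm (sub_eq_zero.1 h1)]

theorem th_val_l {x : ℤ} {j : ZMod e} {r r' : ℕ} {v : V} (h : D.Ep r x v) :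
    th (fun a => cs e n (wt a)) (x : ZMod e) j (Yv k e n r) (Yv k e n r') • v =
      (if j = x + 1 then cs e n (D.val (x + 1)) - Yv k e n r' else 1) • v := by
  unfold th
  split_ifs
  · rw [D.hv1, cs_add, add_smul, sub_smul, h.Y]
    simp only [sub_smul, add_smul]; abel
  · rfl

theorem th_val_r {x : ℤ} {j : ZMod e} {r r' : ℕ} {v : V} (h : D.Ep r x v) :
    th (fun a => cs e n (wt a)) j (x : ZMod e) (Yv k e n r') (Yv k e n r) • v =
      (if (x : ZMod e) = j + 1 then Yv k e n r' - cs e n (D.val (x - 1)) else 1) • v := by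
  unfold th
  split_ifs with h1
  · have h2 := D.hv1 (x - 1)
    have h3 : ((x - 1 : ℤ) : ZMod e) = j := by push_cast; rw [h1]; ring
    rw [sub_add_cancel, h3] at h2
    rw [add_smul, sub_smul, h.Y, h2, cs_add]
    simp only [sub_smul, add_smul]; abel
  · rfl

end Spec
end NB
end Paper

namespace Paper
namespace NB

/-! ### Part 8: the spectrum, continued -/

section Wg
variable {ℓ : ℕ} {κ : Fin ℓ → ℤ}

theorem wg_succ (c : ℕ → ℤ) (m : ℕ) (d : ℤ) : wg κ c (m + 1) d = wg κ c m d +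
    ((if d = c m + 1 then 1 else 0) + (if d = c m - 1 then 1 else 0) -
      2 * (if d = c m then 1 else 0)) := by
  rw [wg, wg, Finset.sum_range_succ, add_assoc]

theorem wg_congr {c c' : ℕ → ℤ} {m : ℕ} (h : ∀ t, t < m → c t = c' t) (d : ℤ) :
    wg κ c m d = wg κ c' m d := by
  rw [wg, wg]
  congr 1
  refine Finset.sum_congr rfl fun t ht => ?_
  rw [h t (Finset.mem_range.1 ht)]

theorem good_congr {c c' : ℕ → ℤ} {m : ℕ} (h : ∀ t, t < m → c t = c' t) (hg : good κ c m) :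
    good κ c' m := fun t ht => by
  rw [← h t ht, ← wg_congr (fun s hs => h s (hs.trans ht))]
  exact hg t ht

theorem good_le {c : ℕ → ℤ} {m m' : ℕ} (h : m' ≤ m) (hg : good κ c m) : good κ c m' :=
  fun t ht => hg t (ht.trans_le h)

theorem wg_swap_lt (c : ℕ → ℤ) {p m : ℕ} (h : m ≤ p) (d : ℤ) :
    wg κ (fun t => c (swn p t)) m d = wg κ c m d := by
  refine wg_congr (fun t ht => ?_) d
  rw [swn, if_neg (by omega), if_neg (by omega)]

theorem wg_swap_ge (c : ℕ → ℤ) (p q : ℕ) (d : ℤ) :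
    wg κ (fun t => c (swn p t)) (p + 2 + q) d = wg κ c (p + 2 + q) d := by
  induction q with
  | zero =>
    rw [Nat.add_zero, wg_succ, wg_succ, wg_succ c (p + 1), wg_succ c p, wg_swap_lt c le_rfl]
    have h1 : swn p p = p + 1 := by simp [swn]
    have h2 : swn p (p + 1) = p := by simp [swn]
    rw [h1, h2]
    ring
  | succ q ih =>
    rw [← Nat.add_assoc, wg_succ, wg_succ c, ih]
    have h1 : swn p (p + 2 + q) = p + 2 + q := by
      rw [swn, if_neg (by omega), if_neg (by omega)]
    rw [h1]

theorem good_swap {c : ℕ → ℤ} {p m : ℕ} (hp : p + 1 < m) (hg : good κ c m)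
    (h0 : c p ≠ c (p + 1)) (h1 : c p ≠ c (p + 1) + 1) (h2 : c p ≠ c (p + 1) - 1) :
    good κ (fun t => c (swn p t)) m := by
  have e1 : swn p p = p + 1 := by simp [swn]
  have e2 : swn p (p + 1) = p := by simp [swn]
  intro t ht
  rcases lt_trichotomy t p with h | h | h
  · rw [wg_swap_lt c h.le]
    have : swn p t = t := by rw [swn, if_neg (by omega), if_neg (by omega)]
    simp only [this]
    exact hg t ht
  · subst h
    rw [wg_swap_lt c le_rfl]
    simp only [e1]
    have := hg _ hp
    rw [wg_succ, if_neg (by omega), if_neg (by omega), if_neg (by omega)] at this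
    omega
  · rcases Nat.lt_or_ge (p + 1) t with h' | h'
    · obtain ⟨q, rfl⟩ := Nat.exists_eq_add_of_le (show p + 2 ≤ t by omega)
      rw [wg_swap_ge]
      have : swn p (p + 2 + q) = p + 2 + q := by rw [swn, if_neg (by omega), if_neg (by omega)]
      simp only [this]
      exact hg _ ht
    · have : t = p + 1 := by omega
      subst this
      rw [wg_succ, wg_swap_lt c le_rfl]
      simp only [e1, e2]
      rw [if_neg (by omega), if_neg (by omega), if_neg (by omega)]
      have := hg p (by omega)
      omega

end Wg

section SpecTwo
variable {k : Type} [CommRing k] [IsDomain k] {e n : ℕ} [NeZero n] {wt : ZMod e → k}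
  {V : Type} [AddCommGroup V] [Module (PP k e n) V] (M : KMod k e n wt V)
  {ℓ : ℕ} {κ : Fin ℓ → ℤ} (D : SD k e n wt κ)

/-- The spectral statement at level `m`. -/
def SD.PC (D : SD k e n wt κ) (V : Type) [AddCommGroup V] [Module (PP k e n) V] (m : ℕ) : Prop :=
  ∀ c, good κ c m → ∀ j : ZMod e, ∃ S : Finset ℤ, (∀ d ∈ S, (d : ZMod e) = j ∧ wg κ c m d = 1) ∧
    ∀ v : V, (∀ t, t < m → D.Ep t (c t) v) → eps k e n m j • v = v → pf e n D.val m S • v = 0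

theorem pf_erase (val : ℤ → k) (t : ℕ) {S : Finset ℤ} {d : ℤ} (h : d ∈ S) :
    pf e n val t S = (Yv k e n t - cs e n (val d)) * pf e n val t (S.erase d) :=
  (Finset.mul_prod_erase S _ h).symm

theorem pf_insert (val : ℤ → k) (t : ℕ) {S : Finset ℤ} {d : ℤ} (h : d ∉ S) :
    pf e n val t (insert d S) = (Yv k e n t - cs e n (val d)) * pf e n val t S :=
  Finset.prod_insert h

theorem aP_eps (hκ : Function.Injective κ) (val : ℤ → k) (j : ZMod e) (t : ℕ) :
    aP e n (fun l => (κ l : ZMod e)) (fun l => val (κ l)) t * eps k e n t j =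
    pf e n val t ((Finset.univ.filter fun l => (κ l : ZMod e) = j).image κ) * eps k e n t j := by
  rw [pf, Finset.prod_image (fun a _ b _ h => hκ h), Finset.prod_filter, aP]
  funext i
  simp only [Pi.mul_apply, Finset.prod_apply, eps, ind]
  split_ifs with h
  · congr 1
    refine Finset.prod_congr rfl fun l _ => ?_
    simp only [aF, h]
    by_cases h2 : (κ l : ZMod e) = j
    · rw [if_pos h2.symm, if_pos h2]; rfl
    · rw [if_neg (Ne.symm h2), if_neg h2]; rfl
  · simp

theorem PC_zero (hA : ∀ v : V, aP e n (fun l => (κ l : ZMod e)) (fun l => D.val (κ l)) 0 • v = 0) :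
    D.PC V 0 := by
  intro c _ j
  refine ⟨(Finset.univ.filter fun l => (κ l : ZMod e) = j).image κ, ?_, ?_⟩
  · intro d hd
    obtain ⟨l, hl, rfl⟩ := Finset.mem_image.1 hd
    refine ⟨(Finset.mem_filter.1 hl).2, ?_⟩
    rw [wg, Finset.range_zero, Finset.sum_empty, add_zero]
    rw [Finset.sum_eq_single l (fun b _ hb => if_neg fun h => hb (D.inj h)) (by simp)]
    simp
  · intro v _ hv
    rw [← hv, smul_smul, ← aP_eps D.inj, mul_smul, hv, hA]

theorem g_eta {m : ℕ} (hr : m + 1 < n) {h g : PP k e n}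
    (hg : (Yv k e n (m + 1) - Yv k e n m) * g = eta k e n m * h) : eta k e n m * g = g := by
  refine Yv_sub_cancel (by omega) (by omega) (by omega) (r := m + 1) (s := m) ?_
  rw [mul_left_comm, hg, ← mul_assoc, eta_sq]

theorem KMod.psi_off {m : ℕ} (hr : m + 1 < n) (f : PP k e n) {v : V} (hv : eta k e n m • v = 0) :
    M.ψ m (f • v) = act (sw n m) f • M.ψ m v := by
  obtain ⟨g, hg⟩ := dd_exists m f
  rw [M.h1 m hr f g hg, ← g_eta hr hg, mul_comm, mul_smul, hv, smul_zero, add_zero]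

theorem act_eta (m : ℕ) : act (sw n m) (eta k e n m) = eta k e n m := by
  rw [eta, act_ind]
  simp only [Function.comp, sw_left, sw_right]
  funext i
  simp only [ind]
  split_ifs with h1 h2 h2
  · rfl
  · exact absurd h1.symm h2
  · exact absurd h2.symm h1
  · rfl

theorem KMod.same {m : ℕ} (hr : m + 1 < n) (W : V → Prop) (hs : ∀ (f : PP k e n) v, W v → W (f • v))
    (hη : ∀ v, W v → eta k e n m • v = v) (hψ : ∀ v, W v → W (M.ψ m v))
    (hQ : ∀ v, W v → Qr e n wt m • v = 0)
    {p g : PP k e n} (hp : ∀ v, W v → p • v = 0)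
    (hg : (Yv k e n (m + 1) - Yv k e n m) * g = eta k e n m * (p - act (sw n m) p)) :
    ∀ v, W v → g • v = 0 := by
  have hgs : act (sw n m) g = g := by
    refine Yv_sub_cancel (by omega) (by omega) (by omega) (r := m + 1) (s := m) ?_
    have := congrArg (act (sw n m)) hg
    rw [map_mul, map_mul, map_sub, map_sub, act_sw_sw, act_eta, act_Yv' _ (sw_right m),
      act_Yv' _ (sw_left m)] at this
    linear_combination -this - hg
  have h1 : ∀ v, W v → g • v = -(act (sw n m) p • M.ψ m v) := by
    intro v hv
    have := M.h1 m hr p g hg v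
    rw [hp v hv, map_zero] at this
    exact (neg_eq_of_add_eq_zero_right this.symm).symm
  have h2 : ∀ v, M.ψ m (g • v) = g • M.ψ m v := fun v =>
    M.psi_fix hr hgs (by rw [sub_self, mul_zero]) v
  have h3 : ∀ v, W v → M.ψ m (g • v) = 0 := by
    intro v hv
    rw [h2, h1 _ (hψ v hv), M.h2 m hr, hQ v hv, smul_zero, neg_zero]
  intro v hv
  have h4 := h3 _ (hs (Yv k e n (m + 1)) v hv)
  rw [smul_comm, M.psi_Y_r hr, h3 v hv, smul_zero, zero_add, hη _ (hs g v hv)] at h4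
  exact h4

theorem SD.res_ne {D : SD k e n wt κ} {a d : ℤ} (h : (d : ZMod e) = a) : d ≠ a + 1 ∧ d ≠ a - 1 := by
  constructor <;> rintro rfl <;> push_cast at h
  · exact D.he (by linear_combination h)
  · exact D.he (by linear_combination -h)

theorem KMod.step_same (M : KMod k e n wt V) {D : SD k e n wt κ} {m : ℕ} (hr : m + 2 ≤ n)
    (hP : D.PC V m) (c : ℕ → ℤ) (hc : good κ c (m + 1)) :
    ∃ S : Finset ℤ, (∀ d ∈ S, (d : ZMod e) = c m ∧ wg κ c (m + 1) d = 1) ∧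
    ∀ v : V, (∀ t, t < m + 1 → D.Ep t (c t) v) → eps k e n (m + 1) (c m : ZMod e) • v = v →
      pf e n D.val (m + 1) S • v = 0 := by
  obtain ⟨S, hS, hS2⟩ := hP c (good_le (Nat.le_succ m) hc) (c m)
  by_cases ha : c m ∈ S
  · refine ⟨S.erase (c m), ?_, ?_⟩
    · intro d hd
      obtain ⟨h1, h2⟩ := Finset.mem_erase.1 hd
      obtain ⟨h3, h4⟩ := hS d h2
      have := SD.res_ne (D := D) h3
      refine ⟨h3, ?_⟩
      rw [wg_succ, h4, if_neg this.1, if_neg this.2, if_neg h1]; rfl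
    · intro v hE hv
      obtain ⟨g, hg⟩ := dd_exists m (pf e n D.val m (S.erase (c m)))
      have hr' : m + 1 < n := by omega
      have ha1 : ∀ T, act (sw n m) (pf e n D.val m T) = pf e n D.val (m + 1) T := fun T =>
        act_pf _ (sw_left m) _ _
      have key := M.same hr' (fun v => (∀ t, t < m → D.Ep t (c t) v) ∧
        eps k e n m (c m : ZMod e) • v = v ∧ eps k e n (m + 1) (c m : ZMod e) • v = v)
        (fun f v h => ⟨fun t ht => (h.1 t ht).smul f, by rw [smul_comm, h.2.1],
          by rw [smul_comm, h.2.2]⟩)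
        (fun v h => eta_one h.2.1 h.2.2)
        (fun v h => ⟨fun t ht => M.Ep_far hr' (by omega) (by omega) (by omega) (h.1 t ht),
          by rw [← M.psi_eps_r hr', h.2.2], by rw [← M.psi_eps_l hr', h.2.1]⟩)
        (fun v h => by
          rw [← h.2.1, ← h.2.2, smul_smul, smul_smul, mul_assoc, Qr_same, zero_smul])
        (p := pf e n D.val m S)
        (g := (Yv k e n m - cs e n (D.val (c m))) * g -
          eta k e n m * pf e n D.val (m + 1) (S.erase (c m)))
        (fun v h => hS2 v h.1 h.2.1)
        (by
          rw [ha1, pf_erase _ _ ha, pf_erase _ _ ha]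
          rw [ha1] at hg
          linear_combination (Yv k e n m - cs e n (D.val (c m))) * hg)
        v ⟨fun t ht => hE t (by omega), (hE m (by omega)).ep, hv⟩
      rw [sub_smul, mul_comm, mul_smul, sub_smul, (hE m (by omega)).Y, sub_self, smul_zero, zero_sub,
        neg_eq_zero, mul_comm, mul_smul, eta_one (hE m (by omega)).ep hv] at key
      exact key
  · refine ⟨∅, by simp, fun v hE hv => ?_⟩
    have : v = 0 := M.eig_mem (hE m (by omega)) (fun d hd => (hS d hd).1)
      (hS2 v (fun t ht => hE t (by omega)) (hE m (by omega)).ep) ha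
    rw [this, smul_zero]

theorem pf_remove {D : SD k e n wt κ} {t : ℕ} {j : ZMod e} (q : ℤ → Prop)
    [DecidablePred q] (S : Finset ℤ) :
    (∀ d ∈ S, (d : ZMod e) = j) → ∀ W : V → Prop, (∀ (f : PP k e n) v, W v → W (f • v)) →
    (∀ v, W v → eps k e n t j • v = v) → (∀ v, W v → pf e n D.val t S • v = 0) →
    (∀ d ∈ S, q d ∨ ∀ v, W v → D.Ep t d v → v = 0) →
    ∀ v, W v → pf e n D.val t (S.filter q) • v = 0 := by
  induction S using Finset.induction_on with
  | empty => intro _ W _ _ h _ v hv; simpa using h v hv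
  | insert d S hd ih =>
    intro hS W hs he h hq v hv
    by_cases hqd : q d
    · rw [Finset.filter_insert, if_pos hqd, pf_insert _ _ (by simp [hd]), mul_comm, mul_smul]
      refine ih (fun x hx => hS x (Finset.mem_insert_of_mem hx))
        (fun w => W w ∧ pf e n D.val t S • w = 0)
        (fun f v h => ⟨hs f v h.1, by rw [smul_comm, h.2, smul_zero]⟩) (fun v h => he v h.1)
        (fun v h => h.2) (fun x hx => ?_) _ ⟨hs _ _ hv, ?_⟩
      · rcases hq x (Finset.mem_insert_of_mem hx) with h1 | h1
        · exact Or.inl h1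
        · exact Or.inr fun v h => h1 v h.1
      · rw [smul_smul, mul_comm, ← pf_insert _ _ hd]; exact h v hv
    · rw [Finset.filter_insert, if_neg hqd]
      refine ih (fun x hx => hS x (Finset.mem_insert_of_mem hx)) W hs he (fun v hv => ?_)
        (fun x hx => hq x (Finset.mem_insert_of_mem hx)) v hv
      rcases hq d (Finset.mem_insert_self d S) with h1 | h1
      · exact absurd h1 hqd
      · refine h1 _ (hs _ v hv) ⟨?_, ?_⟩
        · rw [hS d (Finset.mem_insert_self d S)]; exact he _ (hs _ v hv)
        · have := h v hv
          rw [pf_insert _ _ hd, mul_smul, sub_smul] at this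
          exact sub_eq_zero.1 this

/-- The action of `Q` on a vector with known eigenvalue. -/
theorem Qr_val {D : SD k e n wt κ} {r : ℕ} {x : ℤ} {j : ZMod e} (hxj : (x : ZMod e) ≠ j) {v : V}
    (h : D.Ep r x v) (hj : eps k e n (r + 1) j • v = v) : Qr e n wt r • v =
    (if j = x + 1 then cs e n (D.val (x + 1)) - Yv k e n (r + 1) else 1 : PP k e n) •
      (if (x : ZMod e) = j + 1 then Yv k e n (r + 1) - cs e n (D.val (x - 1)) else 1 : PP k e n) •
        v := by
  have h3 : (eps k e n r (x : ZMod e) * eps k e n (r + 1) j) • v = v := by rw [mul_smul, hj, h.ep]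
  conv_lhs => rw [← h3]
  rw [smul_smul, Qr_eps wt r hxj, mul_smul, h3, mul_smul, th_val_r D h, smul_comm, th_val_l D h,
    smul_comm]

theorem KMod.SW (M : KMod k e n wt V) {D : SD k e n wt κ} {p : ℕ} (hr : p + 1 < n) {x y : ℤ} {v : V}
    (hx : D.Ep p x v) (hy : D.Ep (p + 1) y v) (h1 : x ≠ y + 1) (h2 : x ≠ y - 1) :
    ∃ u : V, D.Ep p y u ∧ D.Ep (p + 1) x u ∧
      (∀ t, t < n → t ≠ p → t ≠ p + 1 → ∀ z, D.Ep t z v → D.Ep t z u) ∧ (u = 0 → v = 0) := by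
  by_cases hxy : (x : ZMod e) = y
  · have hη : eta k e n p • v = v := eta_one hx.ep (by rw [hxy]; exact hy.ep)
    have e1 : Yv k e n p • M.ψ p v = cs e n (D.val y) • M.ψ p v - v := by
      have := M.psi_Y_r hr v
      rw [hy.Y, M.psi_cs hr, hη] at this
      rw [this]; abel
    have e2 : Yv k e n (p + 1) • M.ψ p v = cs e n (D.val x) • M.ψ p v + v := by
      have := M.psi_Y_l hr v
      rw [hx.Y, M.psi_cs hr, hη] at this
      rw [this]; abel
    have e3 : eps k e n p (y : ZMod e) • M.ψ p v = M.ψ p v := by rw [← M.psi_eps_r hr, hy.ep]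
    have e4 : eps k e n (p + 1) (x : ZMod e) • M.ψ p v = M.ψ p v := by
      rw [← M.psi_eps_l hr, hx.ep]
    refine ⟨(cs e n (D.val y) - cs e n (D.val x)) • M.ψ p v - v, ⟨?_, ?_⟩, ⟨?_, ?_⟩, ?_, ?_⟩
    · rw [smul_sub, smul_comm, e3, ← hxy, hx.ep]
    · rw [smul_sub, smul_comm, e1, hx.Y]
      simp only [smul_sub, sub_smul, smul_comm (cs e n (D.val x) : PP k e n) (cs e n (D.val y))]
      abel
    · rw [smul_sub, smul_comm, e4, hxy, hy.ep]
    · rw [smul_sub, smul_comm, e2, hy.Y]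
      simp only [smul_sub, sub_smul, smul_add, smul_comm (cs e n (D.val x) : PP k e n) (cs e n (D.val y))]
      abel
    · intro t ht ht1 ht2 z hz
      have := M.Ep_far hr ht ht1 ht2 hz
      refine ⟨?_, ?_⟩
      · rw [smul_sub, smul_comm, this.ep, hz.ep]
      · rw [smul_sub, smul_comm, this.Y, hz.Y, smul_sub, smul_comm]
    · intro h0
      have hQ : M.ψ p (M.ψ p v) = 0 := by
        have h3 : (eps k e n p (x : ZMod e) * eps k e n (p + 1) x) • v = v := by
          rw [mul_smul, hxy, hy.ep, ← hxy, hx.ep]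
        rw [M.h2 p hr, ← h3, smul_smul, Qr_same, zero_smul]
      have h4 : M.ψ p v = 0 := by
        have := congrArg (M.ψ p) h0
        rw [map_sub, ← cs_sub, M.psi_cs hr, hQ, smul_zero, map_zero, zero_sub, neg_eq_zero] at this
        exact this
      rw [h4, smul_zero, zero_sub, neg_eq_zero] at h0
      exact h0
  · have hη := eta_zero hxy hx.ep hy.ep
    refine ⟨M.ψ p v, M.Ep_r hr hy hη, M.Ep_l hr hx hη,
      fun t ht ht1 ht2 z hz => M.Ep_far hr ht ht1 ht2 hz, fun h0 => ?_⟩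
    have hQ := M.h2 p hr v
    rw [h0, map_zero, Qr_val hxy hx hy.ep] at hQ
    have q1 : (if (x : ZMod e) = y + 1 then Yv k e n (p + 1) - cs e n (D.val (x - 1)) else 1 :
        PP k e n) • v =
        cs e n (if (x : ZMod e) = y + 1 then D.val y - D.val (x - 1) else 1) • v := by
      split_ifs
      · rw [sub_smul, hy.Y, cs_sub, sub_smul]
      · rw [cs_one]
    have q2 : (if (y : ZMod e) = x + 1 then cs e n (D.val (x + 1)) - Yv k e n (p + 1) else 1 :
        PP k e n) • v =
        cs e n (if (y : ZMod e) = x + 1 then D.val (x + 1) - D.val y else 1) • v := by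
      split_ifs
      · rw [sub_smul, hy.Y, cs_sub, sub_smul]
      · rw [cs_one]
    rw [q1, smul_comm, q2, smul_smul, ← cs_mul] at hQ
    refine M.tf _ (mul_ne_zero ?_ ?_) v hQ.symm
    · split_ifs with h
      · intro h'
        have := D.hv2 y (x - 1) (by push_cast; rw [h]; ring) (sub_eq_zero.1 h')
        omega
      · exact one_ne_zero
    · split_ifs with h
      · intro h'
        have := D.hv2 (x + 1) y (by push_cast; rw [h]) (sub_eq_zero.1 h')
        omega
      · exact one_ne_zero

theorem SD.ab_ne {D : SD k e n wt κ} {a b : ℤ} (h : b = a + 1 ∨ b = a - 1) :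
    (a : ZMod e) ≠ b := by
  intro h1
  have := SD.res_ne (D := D) h1.symm
  omega

theorem KMod.Zbase (M : KMod k e n wt V) {D : SD k e n wt κ} {p : ℕ} (hr : p + 3 ≤ n)
    (hP0 : D.PC V p) (hP1 : D.PC V (p + 1)) (c : ℕ → ℤ) (hc : good κ c (p + 2)) {a b : ℤ}
    (hab : b = a + 1 ∨ b = a - 1) (ha : c (p + 1) = a) (hb : c p = b)
    (hw : wg κ c (p + 1) b = -1) {v : V} (hE : ∀ t, t < p + 2 → D.Ep t (c t) v)
    (hv : D.Ep (p + 2) b v) : v = 0 := by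
  have hne : (a : ZMod e) ≠ b := SD.ab_ne (D := D) hab
  have E0 : D.Ep p b v := hb ▸ hE p (by omega)
  have E1 : D.Ep (p + 1) a v := ha ▸ hE (p + 1) (by omega)
  have z1 : M.ψ (p + 1) v = 0 := by
    have hη : eta k e n (p + 1) • v = 0 := eta_zero hne E1.ep hv.ep
    have F : D.Ep (p + 1) b (M.ψ (p + 1) v) := M.Ep_r (by omega) hv hη
    obtain ⟨S, hS, hS2⟩ := hP1 c (good_le (by omega) hc) b
    refine M.eig_mem F (fun d hd => (hS d hd).1) (hS2 _ (fun t ht => ?_) F.ep) fun h => ?_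
    · exact M.Ep_far (by omega) (by omega) (by omega) (by omega) (hE t (by omega))
    · have := (hS b h).2; omega
  have z0 : M.ψ p v = 0 := by
    have hη : eta k e n p • v = 0 := eta_zero hne.symm E0.ep E1.ep
    have F : D.Ep p a (M.ψ p v) := M.Ep_r (by omega) E1 hη
    obtain ⟨S, hS, hS2⟩ := hP0 c (good_le (by omega) hc) a
    refine M.eig_mem F (fun d hd => (hS d hd).1) (hS2 _ (fun t ht => ?_) F.ep) fun h => ?_
    · exact M.Ep_far (by omega) (by omega) (by omega) (by omega) (hE t (by omega))
    · have h1 := (hS a h).2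
      have h2 := hc (p + 1) (by omega)
      rw [ha, wg_succ, hb, h1] at h2
      split_ifs at h2 <;> omega
  have hD := M.h4 p (by omega) v
  rw [z0, z1, map_zero, map_zero, map_zero, zero_add] at hD
  have h3 : (eps k e n p (b : ZMod e) * eps k e n (p + 1) (a : ZMod e) *
      eps k e n (p + 2) (b : ZMod e)) • v = v := by
    rw [mul_smul, hv.ep, mul_smul, E1.ep, E0.ep]
  rw [← h3, smul_smul, Dr_eps wt p hne.symm, mul_smul, h3, add_smul, mul_smul, mul_comm, mul_smul,
    th_val_l D E1, th_val_l D hv] at hD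
  have q1 : (if (b : ZMod e) = a + 1 then cs e n (D.val (a + 1)) - Yv k e n p else 1 :
        PP k e n) • v =
        cs e n (if (b : ZMod e) = a + 1 then D.val (a + 1) - D.val b else 1) • v := by
    split_ifs
    · rw [sub_smul, E0.Y, cs_sub, sub_smul]
    · rw [cs_one]
  have q2 : (if (a : ZMod e) = b + 1 then cs e n (D.val (b + 1)) - Yv k e n (p + 1) else 1 :
        PP k e n) • v =
        cs e n (if (a : ZMod e) = b + 1 then D.val (b + 1) - D.val a else 1) • v := by
    split_ifs
    · rw [sub_smul, E1.Y, cs_sub, sub_smul]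
    · rw [cs_one]
  rw [q1, q2] at hD
  have q3 : (if (a : ZMod e) = b + 1 then 1 else 0 : PP k e n) =
      cs e n (if (a : ZMod e) = b + 1 then 1 else 0) := by
    split_ifs
    · rw [cs_one]
    · rw [cs_zero]
  have q4 : (if (b : ZMod e) = a + 1 then -1 else 0 : PP k e n) =
      cs e n (if (b : ZMod e) = a + 1 then -1 else 0) := by
    split_ifs
    · rw [← zero_sub (1 : k), cs_sub, cs_one, cs_zero, zero_sub]
    · rw [cs_zero]
  rw [q3, q4, smul_smul, smul_smul, ← cs_mul, ← cs_mul, ← add_smul, ← cs_add] at hD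
  refine M.tf _ ?_ v hD.symm
  rcases hab with h | h
  · have h1 : (b : ZMod e) = a + 1 := by rw [h]; push_cast; ring
    rw [if_pos h1, if_pos h1]
    split_ifs with h2
    · have h4 : D.val (b + 1) - D.val a ≠ 0 := fun h' => by
        have := D.hv2 (b + 1) a (by push_cast; rw [h2]) (sub_eq_zero.1 h')
        omega
      have h5 : D.val (a + 1) - D.val b = 0 := by rw [h, sub_self]
      rw [h5, mul_zero, zero_add, neg_one_mul]
      exact neg_ne_zero.2 h4
    · simp
  · have h1 : (a : ZMod e) = b + 1 := by rw [h]; push_cast; ring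
    rw [if_pos h1, if_pos h1]
    have h5 : D.val (b + 1) - D.val a = 0 := by rw [h, sub_add_cancel, sub_self]
    rw [h5, mul_zero, add_zero, one_mul]
    split_ifs with h2
    · intro h'
      have := D.hv2 (a + 1) b (by push_cast; rw [h2]) (sub_eq_zero.1 h')
      omega
    · exact one_ne_zero

theorem KMod.Zind (M : KMod k e n wt V) {D : SD k e n wt κ} {m : ℕ} (hr : m + 2 ≤ n)
    (hP : ∀ m', m' ≤ m → D.PC V m') {a b : ℤ} (hab : b = a + 1 ∨ b = a - 1) (q : ℕ) :
    ∀ (p : ℕ) (c : ℕ → ℤ) (v : V), m = p + 1 + q → good κ c (m + 1) → c m = a → c p = b →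
    (∀ t, p < t → t < m → c t ≠ b ∧ c t ≠ b + 1 ∧ c t ≠ b - 1) →
    wg κ c m b = -1 → (∀ t, t < m + 1 → D.Ep t (c t) v) → D.Ep (m + 1) b v → v = 0 := by
  induction q with
  | zero =>
    intro p c v hm hc ha hb _ hw hE hv
    subst hm
    exact M.Zbase (by omega) (hP _ (by omega)) (hP _ (by omega)) c hc hab ha hb hw hE hv
  | succ q ih =>
    intro p c v hm hc ha hb hfar hw hE hv
    have hf := hfar (p + 1) (by omega) (by omega)
    obtain ⟨u, hu1, hu2, hu3, hu4⟩ := M.SW (by omega) (hE p (by omega)) (hE (p + 1) (by omega))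
      (by rw [hb]; omega) (by rw [hb]; omega)
    apply hu4
    have e1 : swn p p = p + 1 := by simp [swn]
    have e2 : swn p (p + 1) = p := by simp [swn]
    have e3 : ∀ t, t ≠ p → t ≠ p + 1 → swn p t = t := fun t h1 h2 => by
      rw [swn, if_neg h1, if_neg h2]
    refine ih (p + 1) (fun t => c (swn p t)) u (by omega)
      (good_swap (by omega) hc (by rw [hb]; omega) (by rw [hb]; omega) (by rw [hb]; omega)) ?_ ?_
      ?_ ?_ ?_ (hu3 _ (by omega) (by omega) (by omega) _ hv)
    · simp only [e3 m (by omega) (by omega)]; exact ha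
    · simp only [e2]; exact hb
    · intro t h1 h2
      simp only [e3 t (by omega) (by omega)]
      exact hfar t (by omega) h2
    · obtain ⟨q', rfl⟩ := Nat.exists_eq_add_of_le (show p + 2 ≤ m by omega)
      rw [wg_swap_ge]; exact hw
    · intro t ht
      by_cases h1 : t = p
      · subst h1; simp only [e1]; exact hu1
      · by_cases h2 : t = p + 1
        · subst h2; simp only [e2]; exact hu2
        · simp only [e3 t h1 h2]; exact hu3 t (by omega) h1 h2 _ (hE t ht)

theorem wg_const {c : ℕ → ℤ} {b : ℤ} {p : ℕ} (q : ℕ)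
    (h : ∀ t, p ≤ t → t < p + q → c t ≠ b ∧ c t ≠ b + 1 ∧ c t ≠ b - 1) :
    wg κ c (p + q) b = wg κ c p b := by
  induction q with
  | zero => rfl
  | succ q ih =>
    have := h (p + q) (by omega) (by omega)
    rw [← Nat.add_assoc, wg_succ, if_neg (by omega), if_neg (by omega), if_neg (by omega),
      ih fun t h1 h2 => h t h1 (by omega)]
    simp

theorem KMod.Z (M : KMod k e n wt V) {D : SD k e n wt κ} {m : ℕ} (hr : m + 2 ≤ n)
    (hP : ∀ m', m' ≤ m → D.PC V m') {a b : ℤ} (hab : b = a + 1 ∨ b = a - 1)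
    (c : ℕ → ℤ) (v : V) (hc : good κ c (m + 1)) (ha : c m = a)
    (hw : wg κ c m b = -1) (hE : ∀ t, t < m + 1 → D.Ep t (c t) v) (hv : D.Ep (m + 1) b v) :
    v = 0 := by
  have hex : ∃ t, t < m ∧ (c t = b ∨ c t = b + 1 ∨ c t = b - 1) := by
    by_contra hno
    push Not at hno
    have := wg_const (κ := κ) (c := c) (b := b) (p := 0) m (fun t _ ht => hno t (by omega))
    rw [Nat.zero_add, hw] at this
    have h0 : (0 : ℤ) ≤ wg κ c 0 b := by
      rw [wg, Finset.range_zero, Finset.sum_empty, add_zero]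
      exact Finset.sum_nonneg fun l _ => by split_ifs <;> simp
    omega
  obtain ⟨p, hp1, hp2⟩ : ∃ p, (p < m ∧ (c p = b ∨ c p = b + 1 ∨ c p = b - 1)) ∧
      ∀ t, p < t → t < m → c t ≠ b ∧ c t ≠ b + 1 ∧ c t ≠ b - 1 := by
    let F := (Finset.range m).filter fun t => c t = b ∨ c t = b + 1 ∨ c t = b - 1
    have hF : F.Nonempty := by
      obtain ⟨t, h1, h2⟩ := hex
      exact ⟨t, Finset.mem_filter.2 ⟨Finset.mem_range.2 h1, h2⟩⟩
    have hm := Finset.mem_filter.1 (F.max'_mem hF)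
    refine ⟨F.max' hF, ⟨Finset.mem_range.1 hm.1, hm.2⟩, fun t h1 h2 => ?_⟩
    have : t ∉ F := fun h => absurd (F.le_max' t h) (by omega)
    rw [Finset.mem_filter, Finset.mem_range] at this
    tauto
  obtain ⟨q, hq⟩ := Nat.exists_eq_add_of_le (show p + 1 ≤ m by omega)
  have h1 : wg κ c (p + 1) b = -1 := by
    rw [← wg_const (κ := κ) (c := c) (b := b) q (fun t h1 h2 => hp2 t (by omega) (by omega)), ← hq,
      hw]
  have h2 := D.w1 c p (by omega) (good_le (by omega) hc) b
  have h3 : c p = b := by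
    rw [wg_succ] at h1
    have := hp1.2
    by_contra hb
    rw [if_neg (Ne.symm hb)] at h1
    split_ifs at h1 <;> omega
  exact M.Zind hr hP hab q p c v hq hc ha h3 hp2 hw hE hv

theorem KMod.step_diff (M : KMod k e n wt V) {D : SD k e n wt κ} {m : ℕ} (hr : m + 2 ≤ n)
    (hP : ∀ m', m' ≤ m → D.PC V m') (c : ℕ → ℤ) (hc : good κ c (m + 1)) (j : ZMod e)
    (hj : (c m : ZMod e) ≠ j) :
    ∃ S : Finset ℤ, (∀ d ∈ S, (d : ZMod e) = j ∧ wg κ c (m + 1) d = 1) ∧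
    ∀ v : V, (∀ t, t < m + 1 → D.Ep t (c t) v) → eps k e n (m + 1) j • v = v →
      pf e n D.val (m + 1) S • v = 0 := by
  obtain ⟨S, hS, hS2⟩ := hP m le_rfl c (good_le (Nat.le_succ m) hc) j
  have hm1 := hc m (by omega)
  let N1 : Finset ℤ := if j = (c m : ZMod e) + 1 then {c m + 1} else ∅
  let N2 : Finset ℤ := if (c m : ZMod e) = j + 1 then {c m - 1} else ∅
  have hN1 : ∀ d ∈ N1, d = c m + 1 ∧ j = (c m : ZMod e) + 1 := by
    intro d hd; simp only [N1] at hd; split_ifs at hd with h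
    · exact ⟨Finset.mem_singleton.1 hd, h⟩
    · simp at hd
  have hN2 : ∀ d ∈ N2, d = c m - 1 ∧ (c m : ZMod e) = j + 1 := by
    intro d hd; simp only [N2] at hd; split_ifs at hd with h
    · exact ⟨Finset.mem_singleton.1 hd, h⟩
    · simp at hd
  have hgm : good κ c m := good_le (by omega) hc
  have hw1 : wg κ c m (c m + 1) ≠ 1 := fun h => D.w2 c m hr hgm _ hm1 h
  have hw2 : wg κ c m (c m - 1) ≠ 1 := fun h => D.w2 c m hr hgm _ h (by
    rw [sub_add_cancel]; exact hm1)
  have hd1 : Disjoint N1 N2 := Finset.disjoint_left.2 fun d h1 h2 => by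
    have := (hN1 d h1).1; have := (hN2 d h2).1; omega
  have hd2 : Disjoint S (N1 ∪ N2) := Finset.disjoint_left.2 fun d h1 h2 => by
    have h3 := (hS d h1).2
    rcases Finset.mem_union.1 h2 with h | h
    · rw [(hN1 d h).1] at h3; exact hw1 h3
    · rw [(hN2 d h).1] at h3; exact hw2 h3
  have hr' : m + 1 < n := by omega
  refine ⟨(S ∪ (N1 ∪ N2)).filter fun d => wg κ c (m + 1) d = 1, ?_, ?_⟩
  · intro d hd
    obtain ⟨h1, h2⟩ := Finset.mem_filter.1 hd
    refine ⟨?_, h2⟩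
    rcases Finset.mem_union.1 h1 with h | h
    · exact (hS d h).1
    · rcases Finset.mem_union.1 h with h | h
      · rw [(hN1 d h).1, (hN1 d h).2]; push_cast; ring
      · rw [(hN2 d h).1]; push_cast; rw [(hN2 d h).2]; ring
  · intro v hE hv
    refine pf_remove (D := D) (j := j) (fun d => wg κ c (m + 1) d = 1) (S ∪ (N1 ∪ N2)) ?_
      (fun v => (∀ t, t < m + 1 → D.Ep t (c t) v) ∧ eps k e n (m + 1) j • v = v) ?_
      (fun v h => h.2) ?_ ?_ v ⟨hE, hv⟩
    · intro d h1
      rcases Finset.mem_union.1 h1 with h | h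
      · exact (hS d h).1
      · rcases Finset.mem_union.1 h with h | h
        · rw [(hN1 d h).1, (hN1 d h).2]; push_cast; ring
        · rw [(hN2 d h).1]; push_cast; rw [(hN2 d h).2]; ring
    · exact fun f v h => ⟨fun t ht => (h.1 t ht).smul f, by rw [smul_comm, h.2]⟩
    · rintro v ⟨hE, hv⟩
      have Em := hE m (by omega)
      have hη : eta k e n m • v = 0 := eta_zero hj Em.ep hv
      have u1 : eps k e n m j • M.ψ m v = M.ψ m v := by rw [← M.psi_eps_r hr', hv]
      have u2 : D.Ep (m + 1) (c m) (M.ψ m v) := M.Ep_l hr' Em hη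
      have hη' : eta k e n m • M.ψ m v = 0 := eta_zero (Ne.symm hj) u1 u2.ep
      have h0 := hS2 (M.ψ m v) (fun t ht => M.Ep_far hr' (by omega) (by omega) (by omega)
        (hE t (by omega))) u1
      have h1 := M.psi_off hr' (pf e n D.val m S) hη'
      rw [h0, map_zero, act_pf _ (sw_left m), M.h2 m hr', Qr_val hj Em hv] at h1
      have p1 : pf e n D.val (m + 1) N2 =
          (if (c m : ZMod e) = j + 1 then Yv k e n (m + 1) - cs e n (D.val (c m - 1)) else 1 :
            PP k e n) := by
        simp only [N2]
        split_ifs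
        · rw [pf, Finset.prod_singleton]
        · rw [pf, Finset.prod_empty]
      have p2 : (if j = (c m : ZMod e) + 1 then cs e n (D.val (c m + 1)) - Yv k e n (m + 1) else 1 :
            PP k e n) = (if j = (c m : ZMod e) + 1 then -1 else 1) * pf e n D.val (m + 1) N1 := by
        simp only [N1]
        split_ifs
        · rw [pf, Finset.prod_singleton]; ring
        · rw [pf, Finset.prod_empty, one_mul]
      have p3 : pf e n D.val (m + 1) (S ∪ (N1 ∪ N2)) = pf e n D.val (m + 1) S *
          (pf e n D.val (m + 1) N1 * pf e n D.val (m + 1) N2) := by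
        rw [pf, Finset.prod_union hd2, Finset.prod_union hd1]; rfl
      rw [← p1, p2, smul_smul, smul_smul] at h1
      rw [p3]
      have h2 := congrArg (fun w => (if j = (c m : ZMod e) + 1 then -1 else 1 : PP k e n) • w) h1
      simp only [smul_zero, smul_smul] at h2
      rw [h2]
      congr 1
      split_ifs <;> ring
    · intro d hd
      by_cases hq : wg κ c (m + 1) d = 1
      · exact Or.inl hq
      · refine Or.inr ?_
        rintro v ⟨hE, hv⟩ hd'
        rcases Finset.mem_union.1 hd with h | h
        · exfalso
          apply hq
          have h1 := (hS d h).1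
          have h2 : d ≠ c m := fun h => hj (by rw [← h, h1])
          have h3 : d ≠ c m + 1 := fun h' => hw1 (h' ▸ (hS d h).2)
          have h4 : d ≠ c m - 1 := fun h' => hw2 (h' ▸ (hS d h).2)
          rw [wg_succ, if_neg h2, if_neg h3, if_neg h4, (hS d h).2]; rfl
        · have hab : d = c m + 1 ∨ d = c m - 1 := by
            rcases Finset.mem_union.1 h with h | h
            · exact Or.inl (hN1 d h).1
            · exact Or.inr (hN2 d h).1
          refine M.Z hr hP hab c v hc rfl ?_ hE hd'
          have h1 := D.w1 c m (by omega) hgm d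
          have h2 : wg κ c m d ≠ 1 := by
            rcases hab with h | h <;> rw [h] <;> assumption
          rw [wg_succ] at hq
          split_ifs at hq <;> omega

theorem KMod.PC_all (M : KMod k e n wt V)
    (hA : ∀ v : V, aP e n (fun l => (κ l : ZMod e)) (fun l => D.val (κ l)) 0 • v = 0) (m : ℕ) :
    m + 1 ≤ n → D.PC V m := by
  induction m using Nat.strong_induction_on with
  | _ m ih =>
    intro hm
    rcases m with _ | m
    · exact PC_zero D hA
    · intro c hc j
      by_cases hj : (c m : ZMod e) = j
      · subst hj
        exact M.step_same hm (ih m (by omega) (by omega)) c hc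
      · exact M.step_diff hm (fun m' h => ih m' (by omega) (by omega)) c hc j hj

theorem KMod.final (M : KMod k e n wt V) (hP : ∀ m, m + 1 ≤ n → D.PC V m)
    (i : Fin n → ZMod e) {r : ℕ} (hrn : r < n) (C : Finset ℤ)
    (hC : ∀ c, good κ c n → (∀ t, t < n → (c t : ZMod e) = i (pos n t)) → c r ∈ C) (q : ℕ) :
    ∀ (m : ℕ) (c : ℕ → ℤ) (v : V), m + q = n → good κ c m → (∀ t, t < m → D.Ep t (c t) v) →
    (∀ t, t < n → eps k e n t (i (pos n t)) • v = v) → pf e n D.val r C • v = 0 := by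
  induction q with
  | zero =>
    intro m c v hm hc hE hi
    obtain rfl : m = n := hm
    by_cases hres : ∀ t, t < m → (c t : ZMod e) = i (pos m t)
    · rw [eig_pf (hE r hrn), Finset.prod_eq_zero (hC c hc hres) (sub_self (D.val (c r))), cs_zero, zero_smul]
    · push Not at hres
      obtain ⟨t, ht, h⟩ := hres
      rw [Ep_res (hE t ht) (hi t ht) h, smul_zero]
  | succ q ih =>
    intro m c v hm hc hE hi
    obtain ⟨S, hS, hS2⟩ := hP m (by omega) c hc (i (pos n m))
    have key : ∀ T : Finset ℤ, T ⊆ S → ∀ v : V, (∀ t, t < m → D.Ep t (c t) v) →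
        (∀ t, t < n → eps k e n t (i (pos n t)) • v = v) → pf e n D.val m T • v = 0 →
        pf e n D.val r C • v = 0 := by
      intro T
      induction T using Finset.strongInduction with
      | H T ihT =>
        intro hT v hE hi h0
        have hcl : ∀ d ∈ T, (∃ d' ∈ T, d' ≠ d) → (Yv k e n m - cs e n (D.val d)) •
            pf e n D.val r C • v = 0 := by
          intro d hd _
          rw [smul_comm]
          refine ihT (T.erase d) (Finset.erase_ssubset hd) ((Finset.erase_subset _ _).trans hT) _
            (fun t ht => (hE t ht).smul _) (fun t ht => by rw [smul_comm, hi t ht]) ?_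
          rw [smul_smul, mul_comm, ← pf_erase _ _ hd, h0]
        rcases T.eq_empty_or_nonempty with rfl | ⟨d, hd⟩
        · rw [pf, Finset.prod_empty, one_smul] at h0
          rw [h0, smul_zero]
        · by_cases hd2 : ∃ d' ∈ T, d' ≠ d
          · have h1 := hcl d hd hd2
            obtain ⟨d', hd', hne⟩ := hd2
            have h2 := hcl d' hd' ⟨d, hd, hne.symm⟩
            have h3 : cs e n (D.val d' - D.val d) • pf e n D.val r C • v = 0 := by
              rw [cs_sub, sub_smul]
              rw [sub_smul, sub_eq_zero] at h1 h2
              rw [← h1, ← h2, sub_self]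
            refine M.tf _ (fun h => hne ?_) _ h3
            exact D.hv2 _ _ ((hS d' (hT hd')).1.trans (hS d (hT hd)).1.symm) (sub_eq_zero.1 h)
          · have hT1 : T = {d} := Finset.eq_singleton_iff_unique_mem.2 ⟨hd, fun x hx => by
              by_contra h; exact hd2 ⟨x, hx, h⟩⟩
            rw [hT1, pf, Finset.prod_singleton, sub_smul, sub_eq_zero] at h0
            have hEd : D.Ep m d v := ⟨by rw [(hS d (hT hd)).1]; exact hi m (by omega), h0⟩
            have hag : ∀ t, t < m → c t = Function.update c m d t := fun t ht => by
              rw [Function.update_of_ne (by omega)]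
            refine ih (m + 1) (Function.update c m d) v (by omega) ?_ ?_ hi
            · intro t ht
              by_cases htm : t = m
              · subst htm
                rw [Function.update_self, ← wg_congr hag]
                exact (hS d (hT hd)).2
              · exact good_congr hag hc t (by omega)
            · intro t ht
              by_cases htm : t = m
              · subst htm
                rw [Function.update_self]; exact hEd
              · rw [← hag t (by omega)]; exact hE t (by omega)
    exact key S (Finset.Subset.refl S) v hE hi (hS2 v hE (hi m (by omega)))

/-- The spectral theorem. -/
theorem KMod.SP (M : KMod k e n wt V)
    (hA : ∀ v : V, aP e n (fun l => (κ l : ZMod e)) (fun l => D.val (κ l)) 0 • v = 0)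
    (i : Fin n → ZMod e) {r : ℕ} (hrn : r < n) (C : Finset ℤ)
    (hC : ∀ c, good κ c n → (∀ t, t < n → (c t : ZMod e) = i (pos n t)) → c r ∈ C) (v : V) :
    pf e n D.val r C • (ind k (fun x => x = i) : PP k e n) • v = 0 := by
  refine M.final D (M.PC_all D hA) i hrn C hC n 0 (fun _ => 0) _ (by omega)
    (fun t ht => absurd ht (by omega)) (fun t ht => absurd ht (by omega)) fun t _ => ?_
  rw [smul_smul]
  congr 1
  funext x
  simp only [eps, ind, Pi.mul_apply]
  by_cases h : x = i
  · subst h; simp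
  · simp [h]

end SpecTwo
end NB
end Paper

namespace Paper
namespace NB

/-! ### Part 9: applying the spectral theorem -/

section Inst
variable {k F : Type} [CommRing k] [IsDomain k] [Field F] {e n : ℕ} [NeZero e] [NeZero n]
  (Γ : Ctx k F e n) {ℓ : ℕ} {κ : Fin ℓ → ℤ} (D : SD k e n Γ.wt κ)

/-- The left ideal. -/
noncomputable def JI : Submodule (Γ.B (n - 1)) (Γ.B (n - 1)) where
  carrier := {x | (x : EE F e n) ∈ Γ.JJ (fun l => (κ l : ZMod e)) (fun l => D.val (κ l)) (n - 1)}
  add_mem' := fun ha hb => (Γ.JJ _ _ _).add_mem ha hb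
  zero_mem' := (Γ.JJ _ _ _).zero_mem
  smul_mem' := fun c _ hx => LR_left c.2 hx

/-- The quotient. -/
def VQ : Type := Γ.B (n - 1) ⧸ JI Γ D

noncomputable instance VQgrp : AddCommGroup (VQ Γ D) :=
  inferInstanceAs (AddCommGroup (Γ.B (n - 1) ⧸ JI Γ D))

noncomputable instance VQmodB : Module (Γ.B (n - 1)) (VQ Γ D) :=
  inferInstanceAs (Module (Γ.B (n - 1)) (Γ.B (n - 1) ⧸ JI Γ D))

/-- The quotient map. -/
noncomputable def vmk (x : Γ.B (n - 1)) : VQ Γ D := (Submodule.Quotient.mk x : _ ⧸ JI Γ D)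

theorem vmk_surj (v : VQ Γ D) : ∃ x, vmk Γ D x = v := Submodule.Quotient.mk_surjective _ v

theorem vmk_zero {x : Γ.B (n - 1)} : vmk Γ D x = 0 ↔ x ∈ JI Γ D := Submodule.Quotient.mk_eq_zero _

/-- Polynomials in the algebra. -/
noncomputable def cBr : PP k e n →+* Γ.B (n - 1) :=
  Γ.cE.codRestrict (Γ.B (n - 1)) (Γ.cB (n - 1))

noncomputable instance VQmod : Module (PP k e n) (VQ Γ D) := Module.compHom _ (cBr Γ)

/-- The generators inside the algebra. -/
noncomputable def psB (r : ℕ) : Γ.B (n - 1) :=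
  if h : r < n - 1 then ⟨Γ.psi r, Γ.psi_mem h⟩ else 0

theorem VQ_smul (f : PP k e n) (x : Γ.B (n - 1)) :
    f • vmk Γ D x = vmk Γ D (cBr Γ f * x) := rfl

theorem psB_coe {r : ℕ} (h : r + 1 < n) : (psB Γ r : EE F e n) = Γ.psi r := by
  rw [psB, dif_pos (by omega)]

theorem cBr_coe (f : PP k e n) : (cBr Γ f : EE F e n) = Γ.cE f := rfl

/-- The module structure. -/
noncomputable def VQM : KMod k e n Γ.wt (VQ Γ D) where
  ψ r := DistribSMul.toAddMonoidHom (VQ Γ D) (psB Γ r)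
  h1 r hr f g hfg v := by
    have h := Γ.rep.h1 r hr f g hfg
    have h' : psB Γ r * cBr Γ f = cBr Γ (act (sw n r) f) * psB Γ r + cBr Γ g := by
      apply Subtype.ext
      push_cast
      rw [psB_coe Γ hr]; exact h
    change psB Γ r • (cBr Γ f • v) = cBr Γ (act (sw n r) f) • (psB Γ r • v) + cBr Γ g • v
    rw [smul_smul, smul_smul, h', add_smul]
  h2 r hr v := by
    have h' : psB Γ r * psB Γ r = cBr Γ (Qr e n Γ.wt r) := by
      apply Subtype.ext
      push_cast
      rw [psB_coe Γ hr]; exact Γ.rep.h2 r hr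
    change psB Γ r • (psB Γ r • v) = cBr Γ (Qr e n Γ.wt r) • v
    rw [smul_smul, h']
  h4 r hr v := by
    have h' : psB Γ (r + 1) * psB Γ r * psB Γ (r + 1) = psB Γ r * psB Γ (r + 1) * psB Γ r +
        cBr Γ (Dr e n Γ.wt r) := by
      apply Subtype.ext
      push_cast
      rw [psB_coe Γ (by omega), psB_coe Γ (by omega)]; exact Γ.rep.h4 r hr
    change psB Γ (r + 1) • (psB Γ r • (psB Γ (r + 1) • v)) =
      psB Γ r • (psB Γ (r + 1) • (psB Γ r • v)) + cBr Γ (Dr e n Γ.wt r) • v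
    rw [smul_smul, smul_smul, h', smul_smul, smul_smul, add_smul]
  tf s hs v h := by
    obtain ⟨x, rfl⟩ := vmk_surj Γ D v
    rw [VQ_smul, vmk_zero] at h
    rw [vmk_zero]
    have hn : n - 1 + 1 ≤ n := by have := NeZero.ne n; omega
    exact Γ.tors _ _ s hs (n - 1) hn x x.2 h

theorem spec_mem (i : Fin n → ZMod e) {r : ℕ} (hrn : r < n) (C : Finset ℤ)
    (hC : ∀ c, good κ c n → (∀ t, t < n → (c t : ZMod e) = i (pos n t)) → c r ∈ C) :
    Γ.cE (pf e n D.val r C * ind k fun x => x = i) ∈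
      Γ.JJ (fun l => (κ l : ZMod e)) (fun l => D.val (κ l)) (n - 1) := by
  have h := (VQM Γ D).SP D (by
    intro v
    obtain ⟨x, rfl⟩ := vmk_surj Γ D v
    rw [VQ_smul, vmk_zero]
    change Γ.cE _ * (x : EE F e n) ∈ Γ.JJ _ _ _
    have := LR_base (Γ.B (n - 1)).one_mem (Set.mem_singleton
      (Γ.cE (aP e n (fun l => (κ l : ZMod e)) (fun l => D.val (κ l)) 0))) x.2
    rw [one_mul] at this
    exact this) i hrn C hC (vmk Γ D 1)
  rw [smul_smul, VQ_smul, vmk_zero, mul_one] at h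
  exact h

end Inst

section Prod
variable {k F : Type} [CommRing k] [IsDomain k] [Field F] {e n : ℕ} [NeZero e] [NeZero n]
  (Γ : Ctx k F e n) {R : Type} [Ring R]

/-- The product representation. -/
noncomputable def prodRep (H : KRep k e n Γ.wt R) : KRep k e n Γ.wt (R × EE F e n) where
  c := RingHom.prod H.c Γ.cE
  ψ r := (H.ψ r, Γ.psi r)
  h1 r hr f g hfg := Prod.ext (H.h1 r hr f g hfg) (Γ.rep.h1 r hr f g hfg)
  h2 r hr := Prod.ext (H.h2 r hr) (Γ.rep.h2 r hr)
  h3 r s hr hs := Prod.ext (H.h3 r s hr hs) (Γ.rep.h3 r s hr hs)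
  h4 r hr := Prod.ext (H.h4 r hr) (Γ.rep.h4 r hr)

theorem B_lift (H : KRep k e n Γ.wt R) {j : ℕ} {x : EE F e n} (hx : x ∈ Γ.B j) :
    ∃ z ∈ gen (prodRep Γ H).P (prodRep Γ H).ψ j, z.2 = x := by
  have : Γ.B j ≤ (gen (prodRep Γ H).P (prodRep Γ H).ψ j).map (RingHom.snd R (EE F e n)) := by
    apply (Subring.closure_le).2
    rintro z (⟨f, -, rfl⟩ | ⟨t, ht, rfl⟩)
    · exact ⟨_, gen_P ((prodRep Γ H).c_mem f), rfl⟩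
    · exact ⟨_, gen_a ht, rfl⟩
  exact this hx

/-- Transfer: an element of the ideal vanishes in any representation killing the cyclotomic
polynomial. -/
theorem transfer (H : KRep k e n Γ.wt R) {A h : PP k e n} {j : ℕ} (hj : j + 1 ≤ n)
    (hA : H.c A = 0) (hh : Γ.cE h ∈ LR (Γ.B j) {Γ.cE A} (Γ.B j)) : H.c h = 0 := by
  have key : ∃ z ∈ gen (prodRep Γ H).P (prodRep Γ H).ψ j, z.1 = 0 ∧ z.2 = Γ.cE h := by
    have : LR (Γ.B j) {Γ.cE A} (Γ.B j) ≤
        ((gen (prodRep Γ H).P (prodRep Γ H).ψ j).toAddSubgroup ⊓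
          (RingHom.fst R (EE F e n)).toAddMonoidHom.ker).map
          (RingHom.snd R (EE F e n)).toAddMonoidHom := by
      refine LR_le ?_
      rintro x hx _ rfl y hy
      obtain ⟨zx, h1, rfl⟩ := B_lift Γ H hx
      obtain ⟨zy, h2, rfl⟩ := B_lift Γ H hy
      refine ⟨zx * (prodRep Γ H).c A * zy, ⟨?_, ?_⟩, rfl⟩
      · exact Subring.mul_mem _ (Subring.mul_mem _ h1 (gen_P ((prodRep Γ H).c_mem A))) h2
      · change zx.1 * H.c A * zy.1 = 0
        rw [hA, mul_zero, zero_mul]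
    obtain ⟨z, ⟨h1, h2⟩, h3⟩ := this hh
    exact ⟨z, h1, h2, h3⟩
  obtain ⟨z, h1, h2, h3⟩ := key
  have h4 := iota_inj Γ (prodRep Γ H) (RingHom.snd R (EE F e n)) (fun f => rfl) (fun r => rfl) j hj
    (z - (prodRep Γ H).c h) (Subring.sub_mem _ h1 (gen_P ((prodRep Γ H).c_mem h)))
    (by change z.2 - Γ.cE h = 0; rw [h3, sub_self])
  have h5 : z.1 - H.c h = 0 := congrArg Prod.fst h4
  rw [h2, zero_sub, neg_eq_zero] at h5
  exact h5

end Prod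
end NB
end Paper

namespace Paper
namespace NB

/-! ### Part 10: combinatorics of tableaux -/

section Comb

/-- The beta set of one component. -/
def inT (κ : ℕ → ℤ) (p : ℕ → ℕ → ℕ) (l : ℕ) (x : ℤ) : Prop := ∃ r : ℕ, x = κ l - r + p l r

/-- The weight of one component. -/
noncomputable def wl (κ : ℕ → ℤ) (p : ℕ → ℕ → ℕ) (l : ℕ) (x : ℤ) : ℤ :=
  (if inT κ p l x then 1 else 0) - (if inT κ p l (x + 1) then 1 else 0)

theorem node_eq {ℓ m : ℕ} (T : StdTableau ℓ m) {A : Node} (hA : A ∈ T.shape.diagram) :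
    T.node (T.entry A) = A := by
  have h : ∃ a ∈ T.shape.diagram, T.entry a = T.entry A := ⟨A, hA, rfl⟩
  exact T.bijOn.injOn (Function.invFunOn_mem h) hA (Function.invFunOn_eq h)

theorem node_spec {ℓ m : ℕ} (T : StdTableau ℓ m) {k : ℕ} (h1 : 1 ≤ k) (h2 : k ≤ m) :
    T.node k ∈ T.shape.diagram ∧ T.entry (T.node k) = k := by
  have h : ∃ a ∈ T.shape.diagram, T.entry a = k := T.bijOn.surjOn ⟨h1, h2⟩
  exact ⟨Function.invFunOn_mem h, Function.invFunOn_eq h⟩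

/-- Adding a box to the row lengths. -/
def addB (p : ℕ → ℕ → ℕ) (l r : ℕ) : ℕ → ℕ → ℕ := fun l' r' =>
  if l' = l ∧ r' = r then p l' r' + 1 else p l' r'

/-- Adding an addable box to a multipartition. -/
def addMP {ℓ m : ℕ} (μ : Multipartition ℓ m) (l r : ℕ) (hl : l < ℓ)
    (hr : ∀ s, s < r → μ.part l r < μ.part l s) : Multipartition ℓ (m + 1) where
  part := addB μ.part l r
  comp_bound l' h r' := by
    rw [addB, if_neg (by omega), μ.comp_bound l' h]
  antitone l' := by
    intro s t hst
    have h1 := μ.antitone l' hst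
    simp only [addB]
    by_cases hs : l' = l ∧ s = r
    · rw [if_pos hs]
      split_ifs <;> omega
    · rw [if_neg hs]
      split_ifs with ht
      · obtain ⟨rfl, rfl⟩ := ht
        have := hr s (by omega)
        omega
      · exact h1
  row_bound l' r' h := by
    rw [addB, if_neg, μ.row_bound l' r' (by omega)]
    rintro ⟨rfl, rfl⟩
    have h1 := hr m (by omega)
    rw [μ.row_bound l' m le_rfl] at h1
    omega
  size := by
    have hrm : r < m + 1 := by
      by_contra h
      have h1 := hr m (by omega)
      rw [μ.row_bound l m le_rfl] at h1
      omega
    have h2 : ∀ l' r', addB μ.part l r l' r' =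
        μ.part l' r' + (if l' = l then (if r' = r then 1 else 0) else 0) := by
      intro l' r'
      simp only [addB]
      split_ifs <;> simp_all
    simp only [h2, Finset.sum_add_distrib]
    congr 1
    · refine Eq.trans (Finset.sum_congr rfl fun l' _ => ?_) μ.size
      rw [Finset.sum_range_succ, μ.row_bound l' m le_rfl, add_zero]
    · rw [Finset.sum_eq_single l]
      · rw [Finset.sum_eq_single r]
        · simp
        · intro b _ hb; simp [hb]
        · intro h; exact absurd (Finset.mem_range.2 hrm) h
      · intro b _ hb; simp [hb]
      · intro h; exact absurd (Finset.mem_range.2 hl) h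

theorem addMP_diag {ℓ m : ℕ} (μ : Multipartition ℓ m) (l r : ℕ) (hl : l < ℓ)
    (hr : ∀ s, s < r → μ.part l r < μ.part l s) (A : Node) :
    A ∈ (addMP μ l r hl hr).diagram ↔ A ∈ μ.diagram ∨ A = (l, r, μ.part l r) := by
  obtain ⟨a, b, c⟩ := A
  simp only [Multipartition.diagram, addMP, addB, Set.mem_ofPred_eq, Prod.mk.injEq]
  split_ifs with h
  · obtain ⟨rfl, rfl⟩ := h
    simp only [true_and]
    omega
  · constructor
    · exact Or.inl
    · rintro (h1 | ⟨rfl, rfl, -⟩)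
      · exact h1
      · exact absurd ⟨rfl, rfl⟩ h

/-- Adding an addable box to a tableau. -/
noncomputable def addTab {ℓ m : ℕ} (T : StdTableau ℓ m) (l r : ℕ) (hl : l < ℓ)
    (hr : ∀ s, s < r → T.shape.part l r < T.shape.part l s) : StdTableau ℓ (m + 1) where
  shape := addMP T.shape l r hl hr
  entry := Function.update T.entry (l, r, T.shape.part l r) (m + 1)
  entry_zero A hA := by
    rw [addMP_diag, not_or] at hA
    rw [Function.update_of_ne hA.2, T.entry_zero A hA.1]
  bijOn := by
    have hn : ((l, r, T.shape.part l r) : Node) ∉ T.shape.diagram := by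
      simp [Multipartition.diagram]
    have hne : ∀ A ∈ T.shape.diagram, A ≠ (l, r, T.shape.part l r) := by
      rintro A hA rfl; exact hn hA
    refine ⟨?_, ?_, ?_⟩
    · intro A hA
      rcases (addMP_diag _ _ _ _ _ _).1 hA with h | h
      · rw [Function.update_of_ne (hne A h)]
        have := T.bijOn.mapsTo h
        exact ⟨this.1, this.2.trans (Nat.le_succ m)⟩
      · rw [h, Function.update_self]; exact ⟨by omega, le_rfl⟩
    · intro A hA B hB hAB
      rcases (addMP_diag _ _ _ _ _ _).1 hA with h | h <;>
        rcases (addMP_diag _ _ _ _ _ _).1 hB with h' | h'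
      · rw [Function.update_of_ne (hne A h), Function.update_of_ne (hne B h')] at hAB
        exact T.bijOn.injOn h h' hAB
      · rw [h', Function.update_of_ne (hne A h), Function.update_self] at hAB
        have := (T.bijOn.mapsTo h).2
        omega
      · rw [h, Function.update_of_ne (hne B h'), Function.update_self] at hAB
        have := (T.bijOn.mapsTo h').2
        omega
      · rw [h, h']
    · intro k hk
      by_cases hkm : k = m + 1
      · exact ⟨_, (addMP_diag _ _ _ _ _ _).2 (Or.inr rfl), by rw [Function.update_self, hkm]⟩
      · obtain ⟨A, hA, rfl⟩ := T.bijOn.surjOn (show k ∈ Set.Icc 1 m from ⟨hk.1, by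
          have := hk.2; omega⟩)
        exact ⟨A, (addMP_diag _ _ _ _ _ _).2 (Or.inl hA), by rw [Function.update_of_ne (hne A hA)]⟩
  row_inc a b c h := by
    have hle : ∀ A ∈ T.shape.diagram, T.entry A < m + 1 := fun A hA =>
      Nat.lt_succ_of_le (T.bijOn.mapsTo hA).2
    rw [addMP_diag] at h
    rcases h with h | h
    · have hn : ((a, b, c + 1) : Node) ≠ (l, r, T.shape.part l r) := by
        rintro h'; rw [h'] at h; simp [Multipartition.diagram] at h
      have hn' : ((a, b, c) : Node) ≠ (l, r, T.shape.part l r) := by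
        rintro h'
        simp only [Prod.mk.injEq] at h'
        obtain ⟨rfl, rfl, h3⟩ := h'
        simp only [Multipartition.diagram, Set.mem_ofPred_eq] at h
        omega
      rw [Function.update_of_ne hn, Function.update_of_ne hn']
      exact T.row_inc a b c h
    · rw [h, Function.update_self, Function.update_of_ne]
      · apply hle
        simp only [Prod.mk.injEq] at h
        obtain ⟨rfl, rfl, h3⟩ := h
        simp only [Multipartition.diagram, Set.mem_ofPred_eq]
        omega
      · intro h'
        simp only [Prod.mk.injEq] at h h'
        omega
  col_inc a b c h := by
    have hle : ∀ A ∈ T.shape.diagram, T.entry A < m + 1 := fun A hA =>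
      Nat.lt_succ_of_le (T.bijOn.mapsTo hA).2
    rw [addMP_diag] at h
    rcases h with h | h
    · have hn : ((a, b + 1, c) : Node) ≠ (l, r, T.shape.part l r) := by
        rintro h'; rw [h'] at h; simp [Multipartition.diagram] at h
      have hn' : ((a, b, c) : Node) ≠ (l, r, T.shape.part l r) := by
        rintro h'
        simp only [Prod.mk.injEq] at h'
        obtain ⟨rfl, rfl, h3⟩ := h'
        simp only [Multipartition.diagram, Set.mem_ofPred_eq] at h
        have : T.shape.part a (b + 1) ≤ T.shape.part a b := T.shape.antitone a (by omega)
        omega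
      rw [Function.update_of_ne hn, Function.update_of_ne hn']
      exact T.col_inc a b c h
    · rw [h, Function.update_self, Function.update_of_ne]
      · apply hle
        simp only [Prod.mk.injEq] at h
        obtain ⟨rfl, rfl, rfl⟩ := h
        exact hr b (Nat.lt_succ_self b)
      · intro h'
        simp only [Prod.mk.injEq] at h h'
        omega

theorem addTab_content_last {ℓ m : ℕ} (κ : ℕ → ℤ) (T : StdTableau ℓ m) (l r : ℕ) (hl : l < ℓ)
    (hr : ∀ s, s < r → T.shape.part l r < T.shape.part l s) :
    content κ (addTab T l r hl hr) (m + 1) = κ l - r + T.shape.part l r := by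
  have h1 : (addTab T l r hl hr).entry (l, r, T.shape.part l r) = m + 1 := Function.update_self ..
  have h2 := node_eq (addTab T l r hl hr) ((addMP_diag T.shape l r hl hr _).2 (Or.inr rfl))
  rw [h1] at h2
  rw [content, h2]
  ring

theorem addTab_content {ℓ m : ℕ} (κ : ℕ → ℤ) (T : StdTableau ℓ m) (l r : ℕ) (hl : l < ℓ)
    (hr : ∀ s, s < r → T.shape.part l r < T.shape.part l s) {k : ℕ} (hk1 : 1 ≤ k) (hk : k ≤ m) :
    content κ (addTab T l r hl hr) k = content κ T k := by
  obtain ⟨h1, h2⟩ := node_spec T hk1 hk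
  have hn : T.node k ≠ (l, r, T.shape.part l r) := by
    intro h; rw [h] at h1; simp [Multipartition.diagram] at h1
  have h3 : (addTab T l r hl hr).entry (T.node k) = k := by
    rw [← h2]; simp only [addTab]; rw [h2, Function.update_of_ne hn, h2]
  have h4 := node_eq (addTab T l r hl hr) ((addMP_diag T.shape l r hl hr _).2 (Or.inl h1))
  rw [h3] at h4
  rw [content, h4, content]

theorem tstrict (κ : ℕ → ℤ) (p : ℕ → ℕ → ℕ) (hp : ∀ l, Antitone (p l)) (l : ℕ) {s t : ℕ}
    (h : κ l - s + p l s = κ l - t + p l t) : s = t := by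
  rcases lt_trichotomy s t with h1 | h1 | h1
  · have := hp l h1.le; omega
  · exact h1
  · have := hp l h1.le; omega

theorem inT_add (κ : ℕ → ℤ) (p : ℕ → ℕ → ℕ) (hp : ∀ l, Antitone (p l)) (l r l' : ℕ) (x d : ℤ)
    (hd : d = κ l - r + p l r) (hd1 : ¬ inT κ p l (d + 1)) :
    (if inT κ (addB p l r) l' x then (1 : ℤ) else 0) = (if inT κ p l' x then 1 else 0) +
      (if l' = l then (if x = d + 1 then 1 else 0) - (if x = d then 1 else 0) else 0) := by
  by_cases hl : l' = l
  · subst hl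
    rw [if_pos rfl]
    have h1 : inT κ (addB p l' r) l' x ↔ (inT κ p l' x ∧ x ≠ d) ∨ x = d + 1 := by
      constructor
      · rintro ⟨s, hs⟩
        by_cases hsr : s = r
        · subst hsr
          right
          rw [addB, if_pos ⟨rfl, rfl⟩] at hs
          push_cast at hs
          omega
        · left
          rw [addB, if_neg (fun h => hsr h.2)] at hs
          refine ⟨⟨s, hs⟩, fun h => hsr ?_⟩
          exact tstrict κ p hp l' (by rw [← hs, h, hd])
      · rintro (⟨⟨s, hs⟩, h⟩ | h)
        · refine ⟨s, ?_⟩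
          rw [addB, if_neg, hs]
          rintro ⟨-, rfl⟩
          exact h (hs.trans hd.symm)
        · refine ⟨r, ?_⟩
          rw [addB, if_pos ⟨rfl, rfl⟩]
          push_cast
          omega
    have h2 : inT κ p l' d := ⟨r, hd⟩
    by_cases hx1 : x = d + 1
    · subst hx1
      rw [if_pos (h1.2 (Or.inr rfl)), if_neg hd1, if_pos rfl, if_neg (by omega)]
      norm_num
    · by_cases hx2 : x = d
      · subst hx2
        rw [if_neg (fun h => (h1.1 h).elim (fun h => h.2 rfl) hx1), if_pos h2, if_neg hx1,
          if_pos rfl]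
        norm_num
      · rw [if_neg hx1, if_neg hx2]
        by_cases h3 : inT κ p l' x
        · rw [if_pos h3, if_pos (h1.2 (Or.inl ⟨h3, hx2⟩))]; norm_num
        · rw [if_neg h3, if_neg (fun h => (h1.1 h).elim (fun h => h3 h.1) hx1)]; norm_num
  · rw [if_neg hl, add_zero]
    have : inT κ (addB p l r) l' x ↔ inT κ p l' x := by
      simp only [inT, addB]
      simp [hl]
    simp only [this]

theorem wl_add (κ : ℕ → ℤ) (p : ℕ → ℕ → ℕ) (hp : ∀ l, Antitone (p l)) (l r l' : ℕ) (x d : ℤ)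
    (hd : d = κ l - r + p l r) (hd1 : ¬ inT κ p l (d + 1)) :
    wl κ (addB p l r) l' x = wl κ p l' x + (if l' = l then
      ((if x = d + 1 then 1 else 0) + (if x = d - 1 then 1 else 0) -
        2 * (if x = d then 1 else 0)) else 0) := by
  have e1 : (x + 1 = d + 1) ↔ x = d := by omega
  have e2 : (x + 1 = d) ↔ x = d - 1 := by omega
  rw [wl, inT_add κ p hp l r l' x d hd hd1, inT_add κ p hp l r l' (x + 1) d hd hd1, wl]
  simp only [e1, e2]
  split_ifs <;> ring

theorem wl_le (κ : ℕ → ℤ) (p : ℕ → ℕ → ℕ) (l : ℕ) (x : ℤ) :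
    wl κ p l x = 1 ∧ inT κ p l x ∧ ¬ inT κ p l (x + 1) ∨
      wl κ p l x = -1 ∧ ¬ inT κ p l x ∧ inT κ p l (x + 1) ∨ wl κ p l x = 0 := by
  rw [wl]
  split_ifs <;> simp_all

/-- The empty tableau. -/
noncomputable def emptyTab (ℓ : ℕ) : StdTableau ℓ 0 where
  shape :=
    { part := fun _ _ => 0
      comp_bound := fun _ _ _ => rfl
      antitone := fun _ _ _ _ => le_rfl
      row_bound := fun _ _ _ => rfl
      size := by simp }
  entry := fun _ => 0
  entry_zero := fun _ _ => rfl
  bijOn := by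
    refine ⟨?_, ?_, ?_⟩
    · intro A hA; simp [Multipartition.diagram] at hA
    · intro A hA; simp [Multipartition.diagram] at hA
    · intro k hk; exact absurd hk.1 (by have := hk.2; omega)
  row_inc := fun _ _ _ h => by simp [Multipartition.diagram] at h
  col_inc := fun _ _ _ h => by simp [Multipartition.diagram] at h

theorem exists_tab {ℓ : ℕ} (κ : ℕ → ℤ) (c : ℕ → ℤ) (m : ℕ)
    (hg : good (fun l : Fin ℓ => κ l) c m) :
    ∃ T : StdTableau ℓ m, (∀ t, t < m → content κ T (t + 1) = c t) ∧
      ∀ d, wg (fun l : Fin ℓ => κ l) c m d = ∑ l : Fin ℓ, wl κ T.shape.part l d := by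
  induction m with
  | zero =>
    refine ⟨emptyTab ℓ, fun t ht => absurd ht (by omega), fun d => ?_⟩
    have h : ∀ l x, inT κ (emptyTab ℓ).shape.part l x ↔ x ≤ κ l := by
      intro l x
      constructor
      · rintro ⟨r, hr⟩
        simp only [emptyTab] at hr
        push_cast at hr
        omega
      · intro h
        refine ⟨(κ l - x).toNat, ?_⟩
        simp only [emptyTab]
        push_cast
        omega
    rw [wg, Finset.sum_range_zero, add_zero]
    have h2 : ∀ l : ℕ, wl κ (emptyTab ℓ).shape.part l d = if κ l = d then 1 else 0 := by
      intro l
      rw [wl]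
      simp only [h]
      split_ifs <;> omega
    simp only [h2]
    try simp [Finset.sum_boole]
  | succ m ih =>
    obtain ⟨T, h1, h2⟩ := ih (good_le (Nat.le_succ m) hg)
    have h3 := hg m (Nat.lt_succ_self m)
    rw [h2] at h3
    obtain ⟨l, -, hl⟩ : ∃ l ∈ (Finset.univ : Finset (Fin ℓ)), 0 < wl κ T.shape.part l (c m) := by
      by_contra hc
      push Not at hc
      have := Finset.sum_nonpos hc
      omega
    rcases wl_le κ T.shape.part l (c m) with ⟨-, ⟨r, hr⟩, h4⟩ | ⟨h4, -⟩ | h4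
    · have hadd : ∀ s, s < r → T.shape.part l r < T.shape.part l s := by
        intro s hs
        obtain ⟨q, rfl⟩ : ∃ q, r = q + 1 := ⟨r - 1, by omega⟩
        have h5 : T.shape.part l q ≤ T.shape.part l s := T.shape.antitone l (by omega)
        have h6 : T.shape.part l (q + 1) ≤ T.shape.part l q := T.shape.antitone l (by omega)
        have h7 : T.shape.part l (q + 1) ≠ T.shape.part l q := by
          intro h7
          refine h4 ⟨q, ?_⟩
          rw [hr, h7]; push_cast; ring
        omega
      refine ⟨addTab T l r l.2 hadd, ?_, ?_⟩
      · intro t ht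
        by_cases htm : t = m
        · subst htm; rw [addTab_content_last, hr]
        · rw [addTab_content κ T l r l.2 hadd (by omega) (by omega)]
          exact h1 t (by omega)
      · intro d
        have h5 : ∀ l' : Fin ℓ, wl κ (addTab T l r l.2 hadd).shape.part l' d =
            wl κ T.shape.part l' d + (if l' = l then
              ((if d = c m + 1 then 1 else 0) + (if d = c m - 1 then 1 else 0) -
                2 * (if d = c m then 1 else 0)) else 0) := by
          intro l'
          have := wl_add κ T.shape.part T.shape.antitone l r l' d (c m) hr h4
          simp only [Fin.val_inj] at this
          exact this
        simp only [h5]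
        rw [wg_succ, h2, Finset.sum_add_distrib]
        congr 1
        rw [Finset.sum_ite_eq' Finset.univ l]
        simp
    · omega
    · omega

/-- Size of one component. -/
def csz {ℓ m : ℕ} (μ : Multipartition ℓ m) (l : ℕ) : ℕ := ∑ r ∈ Finset.range m, μ.part l r

theorem csz_col {ℓ m : ℕ} (μ : Multipartition ℓ m) (l r : ℕ) : μ.part l r ≤ csz μ l := by
  by_cases h : r < m
  · exact Finset.single_le_sum (f := fun r => μ.part l r) (fun _ _ => Nat.zero_le _)
      (Finset.mem_range.2 h)
  · rw [μ.row_bound l r (by omega)]; exact Nat.zero_le _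

theorem csz_row {ℓ m : ℕ} (μ : Multipartition ℓ m) (l r : ℕ) (h : ∀ s, s < r → 0 < μ.part l s) :
    r ≤ csz μ l := by
  have hrm : r ≤ m := by
    by_contra hc
    have := h m (by omega)
    rw [μ.row_bound l m le_rfl] at this
    omega
  calc r = ∑ s ∈ Finset.range r, 1 := by simp
    _ ≤ ∑ s ∈ Finset.range r, μ.part l s :=
      Finset.sum_le_sum fun s hs => h s (Finset.mem_range.1 hs)
    _ ≤ csz μ l := Finset.sum_le_sum_of_subset (Finset.range_mono hrm)

theorem wl_local {ℓ m : ℕ} (κ : ℕ → ℤ) (μ : Multipartition ℓ m) (l : ℕ) (d : ℤ)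
    (h : wl κ μ.part l d ≠ 0) : |d - κ l| ≤ csz μ l := by
  rw [abs_le]
  rcases wl_le κ μ.part l d with ⟨-, ⟨r, hr⟩, h4⟩ | ⟨-, h4, ⟨r, hr⟩⟩ | h4
  · have h1 := csz_col μ l r
    have h2 : r ≤ csz μ l := by
      refine csz_row μ l r fun s hs => ?_
      by_contra h0
      have h5 : μ.part l (r - 1) ≤ μ.part l s := μ.antitone l (by omega)
      have h6 : μ.part l r ≤ μ.part l (r - 1) := μ.antitone l (by omega)
      refine h4 ⟨r - 1, ?_⟩
      have : ((r - 1 : ℕ) : ℤ) = r - 1 := by omega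
      rw [this, hr]
      omega
    constructor <;> omega
  · have h1 := csz_col μ l r
    have h2 : r + 1 ≤ csz μ l := by
      refine csz_row μ l (r + 1) fun s hs => ?_
      by_contra h0
      have h5 : μ.part l r ≤ μ.part l s := μ.antitone l (by omega)
      have h6 : μ.part l (r + 1) ≤ μ.part l r := μ.antitone l (by omega)
      refine h4 ⟨r + 1, ?_⟩
      push_cast
      omega
    constructor <;> omega
  · exact absurd h4 h

theorem csz_pair {ℓ m : ℕ} (μ : Multipartition ℓ m) {l l' : Fin ℓ} (h : l ≠ l') :
    csz μ l + csz μ l' ≤ m := by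
  have h1 : ∑ l : Fin ℓ, csz μ l = m := by
    rw [← Finset.sum_range (fun l => csz μ l)]; exact μ.size
  have h2 : ∑ x ∈ ({l, l'} : Finset (Fin ℓ)), csz μ x ≤ ∑ l : Fin ℓ, csz μ l :=
    Finset.sum_le_sum_of_subset (Finset.subset_univ _)
  rw [Finset.sum_pair h, h1] at h2
  exact h2

theorem kdiff {ℓ n : ℕ} {κ : ℕ → ℤ} (hκ : ∀ l, l + 1 < ℓ → (n : ℤ) ≤ κ l - κ (l + 1))
    (l q : ℕ) (h : l + q + 1 < ℓ) : (n : ℤ) ≤ κ l - κ (l + q + 1) := by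
  induction q with
  | zero => exact hκ l h
  | succ q ih =>
    have h1 := ih (by omega)
    have h2 := hκ (l + q + 1) (by omega)
    have h3 : l + (q + 1) + 1 = l + q + 1 + 1 := by omega
    rw [h3]
    omega

theorem kabs {ℓ n : ℕ} {κ : ℕ → ℤ} (hκ : ∀ l, l + 1 < ℓ → (n : ℤ) ≤ κ l - κ (l + 1))
    {l l' : Fin ℓ} (h : l ≠ l') : (n : ℤ) ≤ |κ l - κ l'| := by
  have hne : l.1 ≠ l'.1 := fun h' => h (Fin.ext h')
  rcases Nat.lt_or_gt_of_ne hne with h1 | h1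
  · have := kdiff hκ l.1 (l'.1 - l.1 - 1) (by have := l'.2; omega)
    rw [show l.1 + (l'.1 - l.1 - 1) + 1 = l'.1 by omega] at this
    exact this.trans (le_abs_self _)
  · have := kdiff hκ l'.1 (l.1 - l'.1 - 1) (by have := l.2; omega)
    rw [show l'.1 + (l.1 - l'.1 - 1) + 1 = l.1 by omega] at this
    rw [abs_sub_comm]
    exact this.trans (le_abs_self _)

theorem wl_two {ℓ n m : ℕ} {κ : ℕ → ℤ} (hκ : ∀ l, l + 1 < ℓ → (n : ℤ) ≤ κ l - κ (l + 1))
    (μ : Multipartition ℓ m) {l l' : Fin ℓ} {d d' : ℤ} (h1 : wl κ μ.part l d ≠ 0)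
    (h2 : wl κ μ.part l' d' ≠ 0) (h : (m : ℤ) + |d - d'| < n) : l = l' := by
  by_contra hne
  have e1 := wl_local κ μ l d h1
  have e2 := wl_local κ μ l' d' h2
  have e3 := csz_pair μ hne
  have e4 := kabs hκ hne
  have e5 : |κ l - κ l'| ≤ |d - κ l| + |d - d'| + |d' - κ l'| := by
    have : κ l - κ l' = -(d - κ l) + (d - d') + (d' - κ l') := by ring
    rw [this]
    refine (abs_add_le _ _).trans (add_le_add ((abs_add_le _ _).trans ?_) le_rfl)
    rw [abs_neg]
  omega

theorem comb_w1 {ℓ n : ℕ} {κ : ℕ → ℤ} (hκ : ∀ l, l + 1 < ℓ → (n : ℤ) ≤ κ l - κ (l + 1))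
    (c : ℕ → ℤ) (m : ℕ) (hm : m + 1 ≤ n) (hg : good (fun l : Fin ℓ => κ l) c m) (d : ℤ) :
    wg (fun l : Fin ℓ => κ l) c m d = -1 ∨ wg (fun l : Fin ℓ => κ l) c m d = 0 ∨
      wg (fun l : Fin ℓ => κ l) c m d = 1 := by
  obtain ⟨T, -, h2⟩ := exists_tab κ c m hg
  rw [h2]
  by_cases h : ∃ l : Fin ℓ, wl κ T.shape.part l d ≠ 0
  · obtain ⟨l, hl⟩ := h
    rw [Finset.sum_eq_single l]
    · rcases wl_le κ T.shape.part l d with ⟨h, -⟩ | ⟨h, -⟩ | h <;> simp [h]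
    · intro l' _ hne
      by_contra h'
      exact hne (wl_two hκ T.shape h' hl (by simp; omega))
    · intro h; exact absurd (Finset.mem_univ _) h
  · push Not at h
    right; left
    exact Finset.sum_eq_zero fun l _ => h l

theorem comb_pos {ℓ m : ℕ} {κ : ℕ → ℤ} (μ : Multipartition ℓ m) (d : ℤ)
    (h : ∑ l : Fin ℓ, wl κ μ.part l d = 1) : ∃ l : Fin ℓ, wl κ μ.part l d = 1 := by
  by_contra hc
  push Not at hc
  have : ∑ l : Fin ℓ, wl κ μ.part l d ≤ 0 := by
    refine Finset.sum_nonpos fun l _ => ?_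
    rcases wl_le κ μ.part l d with ⟨h, -⟩ | ⟨h, -⟩ | h
    · exact absurd h (hc l)
    · omega
    · omega
  omega

theorem comb_w2 {ℓ n : ℕ} {κ : ℕ → ℤ} (hκ : ∀ l, l + 1 < ℓ → (n : ℤ) ≤ κ l - κ (l + 1))
    (c : ℕ → ℤ) (m : ℕ) (hm : m + 2 ≤ n) (hg : good (fun l : Fin ℓ => κ l) c m) (a : ℤ)
    (ha : wg (fun l : Fin ℓ => κ l) c m a = 1) (ha1 : wg (fun l : Fin ℓ => κ l) c m (a + 1) = 1) :
    False := by
  obtain ⟨T, -, h2⟩ := exists_tab κ c m hg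
  rw [h2] at ha ha1
  obtain ⟨l, hl⟩ := comb_pos T.shape a ha
  obtain ⟨l', hl'⟩ := comb_pos T.shape (a + 1) ha1
  have : l = l' := wl_two hκ T.shape (by rw [hl]; norm_num) (by rw [hl']; norm_num)
    (by simp; omega)
  subst this
  rcases wl_le κ T.shape.part l a with ⟨-, -, h⟩ | ⟨h, -⟩ | h
  · rcases wl_le κ T.shape.part l (a + 1) with ⟨-, h', -⟩ | ⟨h', -⟩ | h'
    · exact h h'
    · omega
    · omega
  · omega
  · omega

theorem content_fin {ℓ n : ℕ} (κ : ℕ → ℤ) (k : ℕ) (h1 : 1 ≤ k) (h2 : k ≤ n) :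
    {z : ℤ | ∃ T : StdTableau ℓ n, z = content κ T k}.Finite := by
  refine ((Finset.range ℓ ×ˢ Finset.range n ×ˢ Finset.range n).image
      (fun x => κ x.1 + (x.2.2 : ℤ) - (x.2.1 : ℤ))).finite_toSet.subset ?_
  rintro z ⟨T, rfl⟩
  obtain ⟨h3, -⟩ := node_spec T h1 h2
  rw [Finset.coe_image]
  refine ⟨T.node k, ?_, rfl⟩
  simp only [Multipartition.diagram, Set.mem_ofPred_eq] at h3
  have e1 : (T.node k).1 < ℓ := by
    by_contra h
    rw [T.shape.comp_bound _ (by omega)] at h3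
    omega
  have e2 : (T.node k).2.1 < n := by
    by_contra h
    rw [T.shape.row_bound _ _ (by omega)] at h3
    omega
  have e3 : (T.node k).2.2 < n := by
    refine h3.trans_le ((csz_col T.shape _ _).trans ?_)
    have := Finset.single_le_sum (f := fun l => csz T.shape l) (fun _ _ => Nat.zero_le _)
      (Finset.mem_range.2 e1)
    exact this.trans T.shape.size.le
  simp [e1, e2, e3]

end Comb
end NB
end Paper

namespace Paper
namespace NB

/-! ### Part 11: the realization in the cyclotomic quiver Hecke algebra -/

section Real
variable (K : Type) [Field K] (n e ℓ : ℕ) [NeZero e] (κ : ℕ → ℤ)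

theorem K_rel {a b : FreeAlgebra K (KLRGen n e)} (h : KLRRel K n e ℓ κ a b) :
    RingQuot.mkAlgHom K (KLRRel K n e ℓ κ) a = RingQuot.mkAlgHom K (KLRRel K n e ℓ κ) b :=
  RingQuot.mkAlgHom_rel K h

theorem K_orth {i j : Fin n → ZMod e} (h : i ≠ j) : KeGen K n e ℓ κ i * KeGen K n e ℓ κ j = 0 := by
  have := K_rel K n e ℓ κ (KLRRel.orth i j h)
  rwa [map_mul, map_zero] at this

theorem K_idem (i : Fin n → ZMod e) :
    KeGen K n e ℓ κ i * KeGen K n e ℓ κ i = KeGen K n e ℓ κ i := by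
  have := K_rel K n e ℓ κ (KLRRel.idem i)
  rwa [map_mul] at this

theorem K_complete : ∑ i : Fin n → ZMod e, KeGen K n e ℓ κ i = 1 := by
  have := K_rel K n e ℓ κ (KLRRel.complete)
  rwa [map_sum, map_one] at this

theorem K_yE (t : Fin n) (i : Fin n → ZMod e) :
    KyGen K n e ℓ κ t * KeGen K n e ℓ κ i = KeGen K n e ℓ κ i * KyGen K n e ℓ κ t := by
  have := K_rel K n e ℓ κ (KLRRel.yE t i)
  rwa [map_mul, map_mul] at this

theorem K_yy (t s : Fin n) :
    KyGen K n e ℓ κ t * KyGen K n e ℓ κ s = KyGen K n e ℓ κ s * KyGen K n e ℓ κ t := by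
  have := K_rel K n e ℓ κ (KLRRel.yy t s)
  rwa [map_mul, map_mul] at this

theorem K_EE (i j : Fin n → ZMod e) :
    KeGen K n e ℓ κ i * KeGen K n e ℓ κ j = KeGen K n e ℓ κ j * KeGen K n e ℓ κ i := by
  by_cases h : i = j
  · rw [h]
  · rw [K_orth K n e ℓ κ h, K_orth K n e ℓ κ (Ne.symm h)]

theorem K_ext {a b : KLR K n e ℓ κ}
    (h : ∀ i, a * KeGen K n e ℓ κ i = b * KeGen K n e ℓ κ i) : a = b := by
  rw [← mul_one a, ← mul_one b, ← K_complete K n e ℓ κ, Finset.mul_sum, Finset.mul_sum]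
  exact Finset.sum_congr rfl fun i _ => h i

/-- The generators of the commutative part. -/
def cgen : Set (KLR K n e ℓ κ) := Set.range (KyGen K n e ℓ κ) ∪ Set.range (KeGen K n e ℓ κ)

theorem cgen_comm : ∀ a ∈ cgen K n e ℓ κ, ∀ b ∈ cgen K n e ℓ κ, a * b = b * a := by
  rintro _ (⟨a, rfl⟩ | ⟨a, rfl⟩) _ (⟨b, rfl⟩ | ⟨b, rfl⟩)
  · exact K_yy K n e ℓ κ a b
  · exact K_yE K n e ℓ κ a b
  · exact (K_yE K n e ℓ κ b a).symm
  · exact K_EE K n e ℓ κ a b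

/-- The specialization. -/
noncomputable def zz : Polynomial ℤ →+* K := Polynomial.eval₂RingHom (Int.castRingHom K) 0

/-- The commutative subalgebra. -/
abbrev CS : Subalgebra K (KLR K n e ℓ κ) := Algebra.adjoin K (cgen K n e ℓ κ)

/-- Its commutative ring structure. -/
noncomputable abbrev CSring : CommRing (CS K n e ℓ κ) :=
  Algebra.adjoinCommRingOfComm K (cgen_comm K n e ℓ κ)

/-- Evaluation of polynomials inside the subalgebra. -/
noncomputable def evS : MvPolynomial (Fin n) (Polynomial ℤ) →+* CS K n e ℓ κ :=
  letI := CSring K n e ℓ κ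
  MvPolynomial.eval₂Hom ((algebraMap K (CS K n e ℓ κ)).comp (zz K))
    (fun t => ⟨KyGen K n e ℓ κ t, Algebra.subset_adjoin (Or.inl ⟨t, rfl⟩)⟩)

/-- Evaluation of polynomials. -/
noncomputable def ev : MvPolynomial (Fin n) (Polynomial ℤ) →+* KLR K n e ℓ κ :=
  (CS K n e ℓ κ).val.toRingHom.comp (evS K n e ℓ κ)

theorem ev_C (s : Polynomial ℤ) :
    ev K n e ℓ κ (MvPolynomial.C s) = algebraMap K (KLR K n e ℓ κ) (zz K s) := by
  letI := CSring K n e ℓ κ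
  have : evS K n e ℓ κ (MvPolynomial.C s) = algebraMap K (CS K n e ℓ κ) (zz K s) :=
    MvPolynomial.eval₂Hom_C _ _ s
  rw [ev, RingHom.comp_apply, this]
  rfl

theorem ev_X (t : Fin n) : ev K n e ℓ κ (MvPolynomial.X t) = KyGen K n e ℓ κ t := by
  letI := CSring K n e ℓ κ
  have : evS K n e ℓ κ (MvPolynomial.X t) =
      ⟨KyGen K n e ℓ κ t, Algebra.subset_adjoin (Or.inl ⟨t, rfl⟩)⟩ :=
    MvPolynomial.eval₂Hom_X' _ _ t
  rw [ev, RingHom.comp_apply, this]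
  rfl

theorem ev_comm (p : MvPolynomial (Fin n) (Polynomial ℤ)) (i : Fin n → ZMod e) :
    ev K n e ℓ κ p * KeGen K n e ℓ κ i = KeGen K n e ℓ κ i * ev K n e ℓ κ p := by
  have h := (CSring K n e ℓ κ).mul_comm (evS K n e ℓ κ p)
    ⟨KeGen K n e ℓ κ i, Algebra.subset_adjoin (Or.inr ⟨i, rfl⟩)⟩
  exact congrArg Subtype.val h

/-- The map on the commutative part. -/
noncomputable def cK : PP (Polynomial ℤ) e n →+* KLR K n e ℓ κ where
  toFun f := ∑ i, ev K n e ℓ κ (f i) * KeGen K n e ℓ κ i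
  map_one' := by simp [K_complete]
  map_zero' := by simp
  map_add' f g := by simp [add_mul, Finset.sum_add_distrib]
  map_mul' f g := by
    rw [Finset.sum_mul_sum]
    refine Finset.sum_congr rfl fun i _ => ?_
    rw [Finset.sum_eq_single i]
    · rw [mul_assoc, ← mul_assoc (KeGen K n e ℓ κ i), ← ev_comm, mul_assoc _ (KeGen K n e ℓ κ i),
        K_idem, ← mul_assoc, Pi.mul_apply, map_mul]
    · intro j _ hj
      rw [mul_assoc, ← mul_assoc (KeGen K n e ℓ κ i), ← ev_comm, mul_assoc _ (KeGen K n e ℓ κ i),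
        K_orth K n e ℓ κ (Ne.symm hj), mul_zero, mul_zero]
    · intro h; exact absurd (Finset.mem_univ _) h

theorem cK_E (f : PP (Polynomial ℤ) e n) (i : Fin n → ZMod e) :
    cK K n e ℓ κ f * KeGen K n e ℓ κ i = ev K n e ℓ κ (f i) * KeGen K n e ℓ κ i := by
  change (∑ i, ev K n e ℓ κ (f i) * KeGen K n e ℓ κ i) * _ = _
  rw [Finset.sum_mul, Finset.sum_eq_single i]
  · rw [mul_assoc, K_idem]
  · intro j _ hj
    rw [mul_assoc, K_orth K n e ℓ κ hj, mul_zero]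
  · intro h; exact absurd (Finset.mem_univ _) h

variable [NeZero n]

theorem cK_Yv (t : ℕ) : cK K n e ℓ κ (Yv (Polynomial ℤ) e n t) = KyGen K n e ℓ κ (pos n t) := by
  refine K_ext K n e ℓ κ fun i => ?_
  rw [cK_E, Yv, ev_X]

theorem cK_cs (s : Polynomial ℤ) :
    cK K n e ℓ κ (cs e n s) = algebraMap K (KLR K n e ℓ κ) (zz K s) := by
  refine K_ext K n e ℓ κ fun i => ?_
  rw [cK_E, cs, ev_C]

theorem cK_ind (i : Fin n → ZMod e) :
    cK K n e ℓ κ (ind (Polynomial ℤ) fun x => x = i) = KeGen K n e ℓ κ i := by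
  refine K_ext K n e ℓ κ fun j => ?_
  rw [cK_E, ind]
  by_cases h : j = i
  · subst h; rw [if_pos rfl, map_one, one_mul, K_idem]
  · rw [if_neg h, map_zero, zero_mul, K_orth K n e ℓ κ (Ne.symm h)]

theorem ev_prod {ι : Type} (s : Finset ι) (q : ι → Prop) [DecidablePred q] (v : ι → Polynomial ℤ)
    (hv : ∀ l, zz K (v l) = 0) (t : Fin n) :
    ev K n e ℓ κ (∏ l ∈ s, if q l then (MvPolynomial.X t - MvPolynomial.C (v l)) else 1) =
      KyGen K n e ℓ κ t ^ (s.filter q).card := by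
  induction s using Finset.induction_on with
  | empty => simp
  | insert a s ha ih =>
    rw [Finset.prod_insert ha, map_mul, ih, Finset.filter_insert]
    by_cases h : q a
    · rw [if_pos h, if_pos h, map_sub, ev_X, ev_C, hv, map_zero, sub_zero,
        Finset.card_insert_of_notMem (fun h' => ha (Finset.mem_filter.1 h').1), pow_succ']
    · rw [if_neg h, if_neg h, map_one, one_mul]

theorem cK_pf (val : ℤ → Polynomial ℤ) (hv : ∀ c, zz K (val c) = 0) (r : ℕ) (C : Finset ℤ) :
    cK K n e ℓ κ (pf e n val r C) = KyGen K n e ℓ κ (pos n r) ^ C.card := by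
  refine K_ext K n e ℓ κ fun i => ?_
  have h := ev_prod K n e ℓ κ C (fun _ => True) val hv (pos n r)
  rw [Finset.filter_true] at h
  rw [cK_E, ← h, pf, Finset.prod_apply]
  simp [Yv, cs]

theorem cK_aP (val : ℤ → Polynomial ℤ) (hv : ∀ c, zz K (val c) = 0) :
    cK K n e ℓ κ (aP e n (fun l : Fin ℓ => (κ l : ZMod e)) (fun l => val (κ l)) 0) = 0 := by
  refine K_ext K n e ℓ κ fun i => ?_
  have h0 : 0 < n := Nat.pos_of_ne_zero (NeZero.ne n)
  have hp : pos n 0 = ⟨0, h0⟩ := Fin.ext (pos_val h0)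
  have h1 : aP e n (fun l : Fin ℓ => (κ l : ZMod e)) (fun l => val (κ l)) 0 i =
      ∏ l ∈ Finset.range ℓ, if (κ l : ZMod e) = i ⟨0, h0⟩ then
        (MvPolynomial.X (pos n 0) - MvPolynomial.C (val (κ l))) else 1 := by
    rw [Finset.prod_range, aP, Finset.prod_apply]
    refine Finset.prod_congr rfl fun l _ => ?_
    simp only [aF, hp]
    simp only [eq_comm]
  rw [cK_E, h1, ev_prod K n e ℓ κ (Finset.range ℓ) (fun l => (κ l : ZMod e) = i ⟨0, h0⟩)
    (fun l => val (κ l)) (fun l => hv _), hp, zero_mul]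
  have := K_rel K n e ℓ κ (KLRRel.cyc h0 i)
  rw [map_mul, map_pow, map_zero] at this
  exact this

end Real
end NB
end Paper

namespace Paper
namespace NB

/-! ### Part 12: verification of the relations and conclusion -/

section Fin12
variable (K : Type) [Field K] (n e ℓ : ℕ) [NeZero e] (κ : ℕ → ℤ) [NeZero n]

/-- The elements `ψ`. -/
noncomputable def pK (r : ℕ) : KLR K n e ℓ κ :=
  if h : r < n - 1 then KpsiGen K n e ℓ κ ⟨r, h⟩ else 0

theorem pK_eq {r : ℕ} (h : r < n - 1) : pK K n e ℓ κ r = KpsiGen K n e ℓ κ ⟨r, h⟩ := dif_pos h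

theorem pL_pos {r : ℕ} (h : r < n - 1) : pL (⟨r, h⟩ : Fin (n - 1)) = pos n r :=
  Fin.ext (pos_val (by omega)).symm

theorem pR_pos {r : ℕ} (h : r < n - 1) : pR (⟨r, h⟩ : Fin (n - 1)) = pos n (r + 1) :=
  Fin.ext (pos_val (by omega)).symm

theorem pM_pos {r : ℕ} (h : r < n - 1) (h' : r + 1 < n - 1) :
    pM (⟨r, h⟩ : Fin (n - 1)) h' = pos n (r + 2) :=
  Fin.ext (pos_val (by omega)).symm

theorem swapSeq_eq {r : ℕ} (h : r < n - 1) (i : Fin n → ZMod e) :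
    swapSeq i ⟨r, h⟩ = i ∘ sw n r := by
  funext t
  simp only [swapSeq, pL_pos, pR_pos, Function.comp, sw, Equiv.swap_apply_def]
  split_ifs <;> rfl

theorem cK_eta (r : ℕ) (i : Fin n → ZMod e) :
    cK K n e ℓ κ (eta (Polynomial ℤ) e n r) * KeGen K n e ℓ κ i =
      (if i (pos n r) = i (pos n (r + 1)) then 1 else 0) * KeGen K n e ℓ κ i := by
  rw [cK_E, eta, ind]
  split_ifs
  · rw [map_one]
  · rw [map_zero]

theorem h1_ind {r : ℕ} (hr : r < n - 1) (i : Fin n → ZMod e) :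
    pK K n e ℓ κ r * cK K n e ℓ κ (ind (Polynomial ℤ) fun x => x = i) =
      cK K n e ℓ κ (act (sw n r) (ind (Polynomial ℤ) fun x => x = i)) * pK K n e ℓ κ r := by
  have h : act (sw n r) (ind (Polynomial ℤ) fun x => x = i) =
      ind (Polynomial ℤ) fun x => x = i ∘ sw n r := by
    rw [act_ind]
    congr 1
    funext x
    refine propext ⟨fun h => ?_, fun h => ?_⟩
    · rw [← h]; funext t; simp [sw]
    · rw [h]; funext t; simp [sw]
  rw [h, cK_ind, cK_ind, pK_eq K n e ℓ κ hr]
  have := K_rel K n e ℓ κ (KLRRel.psiE ⟨r, hr⟩ i)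
  rw [map_mul, map_mul, swapSeq_eq] at this
  exact this

theorem h1_cs (r : ℕ) (s : Polynomial ℤ) :
    pK K n e ℓ κ r * cK K n e ℓ κ (cs e n s) = cK K n e ℓ κ (cs e n s) * pK K n e ℓ κ r := by
  rw [cK_cs]
  exact (Algebra.commutes _ _).symm

theorem h1_Yr {r : ℕ} (hr : r < n - 1) :
    pK K n e ℓ κ r * cK K n e ℓ κ (Yv (Polynomial ℤ) e n (r + 1)) =
      cK K n e ℓ κ (Yv (Polynomial ℤ) e n r) * pK K n e ℓ κ r +
        cK K n e ℓ κ (eta (Polynomial ℤ) e n r) := by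
  refine K_ext K n e ℓ κ fun i => ?_
  rw [add_mul, cK_eta, cK_Yv, cK_Yv, pK_eq K n e ℓ κ hr, ← pL_pos n hr, ← pR_pos n hr]
  by_cases h : i (pL ⟨r, hr⟩) = i (pR ⟨r, hr⟩)
  · have := K_rel K n e ℓ κ (KLRRel.psiyEq ⟨r, hr⟩ i h)
    simp only [map_mul, map_add, map_one] at this
    rw [if_pos h, ← add_mul]
    exact this
  · have := K_rel K n e ℓ κ (KLRRel.psiyNe ⟨r, hr⟩ i h)
    simp only [map_mul, map_add, map_one] at this
    rw [if_neg h, zero_mul, add_zero]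
    exact this

theorem h1_Yl {r : ℕ} (hr : r < n - 1) :
    pK K n e ℓ κ r * cK K n e ℓ κ (Yv (Polynomial ℤ) e n r) =
      cK K n e ℓ κ (Yv (Polynomial ℤ) e n (r + 1)) * pK K n e ℓ κ r -
        cK K n e ℓ κ (eta (Polynomial ℤ) e n r) := by
  rw [eq_sub_iff_add_eq]
  symm
  refine K_ext K n e ℓ κ fun i => ?_
  rw [add_mul, cK_eta, cK_Yv, cK_Yv, pK_eq K n e ℓ κ hr, ← pL_pos n hr, ← pR_pos n hr]
  by_cases h : i (pL ⟨r, hr⟩) = i (pR ⟨r, hr⟩)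
  · have := K_rel K n e ℓ κ (KLRRel.ypsiEq ⟨r, hr⟩ i h)
    simp only [map_mul, map_add, map_one] at this
    rw [if_pos h, ← add_mul]
    exact this
  · have := K_rel K n e ℓ κ (KLRRel.ypsiNe ⟨r, hr⟩ i h)
    simp only [map_mul, map_add, map_one] at this
    rw [if_neg h, zero_mul, add_zero]
    exact this

theorem h1_Yfar {r t : ℕ} (hr : r < n - 1) (ht : t < n) (h1 : t ≠ r) (h2 : t ≠ r + 1) :
    pK K n e ℓ κ r * cK K n e ℓ κ (Yv (Polynomial ℤ) e n t) =
      cK K n e ℓ κ (Yv (Polynomial ℤ) e n t) * pK K n e ℓ κ r := by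
  rw [cK_Yv, pK_eq K n e ℓ κ hr]
  have := K_rel K n e ℓ κ (KLRRel.psiyFar ⟨r, hr⟩ (pos n t) (by rw [pos_val ht]; exact ⟨h1, h2⟩))
  rwa [map_mul, map_mul] at this

/-- The property that an element can be moved past `ψ r`. -/
def H1 (r : ℕ) (f : PP (Polynomial ℤ) e n) : Prop := ∃ g : PP (Polynomial ℤ) e n,
  (Yv (Polynomial ℤ) e n (r + 1) - Yv (Polynomial ℤ) e n r) * g =
    eta (Polynomial ℤ) e n r * (f - act (sw n r) f) ∧
  pK K n e ℓ κ r * cK K n e ℓ κ f = cK K n e ℓ κ (act (sw n r) f) * pK K n e ℓ κ r + cK K n e ℓ κ g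

theorem H1_add {r : ℕ} {f f' : PP (Polynomial ℤ) e n} (h : H1 K n e ℓ κ r f)
    (h' : H1 K n e ℓ κ r f') : H1 K n e ℓ κ r (f + f') := by
  obtain ⟨g, h1, h2⟩ := h
  obtain ⟨g', h1', h2'⟩ := h'
  refine ⟨g + g', ?_, ?_⟩
  · rw [mul_add, h1, h1', map_add]; ring
  · simp only [map_add, mul_add, add_mul, h2, h2']; abel

theorem H1_mul {r : ℕ} {f f' : PP (Polynomial ℤ) e n} (h : H1 K n e ℓ κ r f)
    (h' : H1 K n e ℓ κ r f') : H1 K n e ℓ κ r (f * f') := by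
  obtain ⟨g, h1, h2⟩ := h
  obtain ⟨g', h1', h2'⟩ := h'
  refine ⟨act (sw n r) f * g' + g * f', ?_, ?_⟩
  · rw [map_mul]
    linear_combination (act (sw n r) f) * h1' + f' * h1
  · simp only [map_add, map_mul]
    rw [← mul_assoc, h2, add_mul, mul_assoc, h2', mul_add, mul_assoc]
    abel

theorem H1_cs (r : ℕ) (s : Polynomial ℤ) : H1 K n e ℓ κ r (cs e n s) :=
  ⟨0, by rw [act_cs]; simp, by rw [act_cs, h1_cs]; simp⟩

theorem H1_zero (r : ℕ) : H1 K n e ℓ κ r 0 := ⟨0, by simp, by simp⟩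

theorem H1_ind {r : ℕ} (hr : r < n - 1) (i : Fin n → ZMod e) :
    H1 K n e ℓ κ r (ind (Polynomial ℤ) fun x => x = i) := by
  refine ⟨0, ?_, by rw [h1_ind K n e ℓ κ hr]; simp⟩
  rw [act_ind, mul_zero]
  funext x
  simp only [Pi.mul_apply, Pi.sub_apply, eta, ind, Pi.zero_apply]
  by_cases h : x (pos n r) = x (pos n (r + 1))
  · have e1 : (x ∘ sw n r = i) = (x = i) := by rw [comp_sw_eq h]
    by_cases hx : x = i
    · have hx' : x ∘ sw n r = i := e1 ▸ hx
      rw [if_pos hx, if_pos hx', sub_self, mul_zero]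
    · have hx' : ¬ x ∘ sw n r = i := e1 ▸ hx
      rw [if_neg hx, if_neg hx', sub_self, mul_zero]
  · rw [if_neg h, zero_mul]

theorem H1_Y {r : ℕ} (hr : r < n - 1) {t : ℕ} (ht : t < n) :
    H1 K n e ℓ κ r (Yv (Polynomial ℤ) e n t) := by
  by_cases h1 : t = r
  · subst h1
    refine ⟨-eta (Polynomial ℤ) e n t, ?_, ?_⟩
    · rw [act_Yv' (sw n t) (sw_left t)]; ring
    · rw [act_Yv' (sw n t) (sw_left t), h1_Yl K n e ℓ κ hr, map_neg]; abel
  · by_cases h2 : t = r + 1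
    · subst h2
      refine ⟨eta (Polynomial ℤ) e n r, ?_, ?_⟩
      · rw [act_Yv' (sw n r) (sw_right r)]; ring
      · rw [act_Yv' (sw n r) (sw_right r), h1_Yr K n e ℓ κ hr]
    · have h3 := act_Yv' (k := Polynomial ℤ) (e := e) (sw n r) (sw_ne (by omega) ht h1 h2)
      refine ⟨0, ?_, ?_⟩
      · rw [h3]; simp
      · rw [h3, h1_Yfar K n e ℓ κ hr ht h1 h2]; simp

theorem H1_const {r : ℕ} (hr : r < n - 1) (p : MvPolynomial (Fin n) (Polynomial ℤ)) :
    H1 K n e ℓ κ r (fun _ => p) := by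
  induction p using MvPolynomial.induction_on with
  | C a => exact H1_cs K n e ℓ κ r a
  | add p q hp hq => exact H1_add K n e ℓ κ hp hq
  | mul_X p t hp =>
    have h := H1_mul K n e ℓ κ hp (H1_Y K n e ℓ κ hr t.2)
    have e1 : Yv (Polynomial ℤ) e n t.1 = fun _ => MvPolynomial.X t := by
      funext x
      simp only [Yv, pos_fin]
    rw [e1] at h
    exact h

theorem H1_all {r : ℕ} (hr : r < n - 1) (f : PP (Polynomial ℤ) e n) : H1 K n e ℓ κ r f := by
  have h : f = ∑ i, (fun _ => f i) * (ind (Polynomial ℤ) fun x => x = i) := by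
    funext x
    rw [Finset.sum_apply, Finset.sum_eq_single x]
    · simp [ind]
    · intro i _ hi; simp [ind, Ne.symm hi]
    · intro h; exact absurd (Finset.mem_univ _) h
  rw [h]
  refine Finset.sum_induction _ (H1 K n e ℓ κ r) (fun _ _ => H1_add K n e ℓ κ)
    (H1_zero K n e ℓ κ r) fun i _ => ?_
  exact H1_mul K n e ℓ κ (H1_const K n e ℓ κ hr _) (H1_ind K n e ℓ κ hr i)

theorem ev_th (wt : ZMod e → Polynomial ℤ) (hw : ∀ a, zz K (wt a) = 0) (i j : ZMod e)
    (a b : Fin n) :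
    ev K n e ℓ κ (th (fun a => MvPolynomial.C (wt a)) i j (MvPolynomial.X a) (MvPolynomial.X b)) =
      if j = i + 1 then KyGen K n e ℓ κ a - KyGen K n e ℓ κ b else 1 := by
  rw [th]
  split_ifs
  · rw [map_add, map_sub, ev_X, ev_X, ev_C, hw, map_zero, add_zero]
  · rw [map_one]

theorem K_h2 (he : (1 : ZMod e) ≠ 0) (wt : ZMod e → Polynomial ℤ) (hw : ∀ a, zz K (wt a) = 0)
    {r : ℕ} (hr : r < n - 1) :
    pK K n e ℓ κ r * pK K n e ℓ κ r = cK K n e ℓ κ (Qr e n wt r) := by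
  refine K_ext K n e ℓ κ fun i => ?_
  rw [cK_E, Qr, QQ, pK_eq K n e ℓ κ hr, ← pow_two, ← pL_pos n hr, ← pR_pos n hr]
  by_cases h : i (pL ⟨r, hr⟩) = i (pR ⟨r, hr⟩)
  · rw [if_pos h]
    have := K_rel K n e ℓ κ (KLRRel.quadEq ⟨r, hr⟩ i h)
    simp only [map_mul, map_pow, map_zero] at this
    rw [map_zero, zero_mul]
    exact this
  · rw [if_neg h, mul_comm (th _ _ _ _ _), map_mul, ev_th K n e ℓ κ wt hw, ev_th K n e ℓ κ wt hw]
    by_cases h1 : i (pR ⟨r, hr⟩) = i (pL ⟨r, hr⟩) + 1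
    · by_cases h2 : i (pL ⟨r, hr⟩) = i (pR ⟨r, hr⟩) + 1
      · have := K_rel K n e ℓ κ (KLRRel.quadBoth ⟨r, hr⟩ i h1 h2)
        simp only [map_mul, map_pow, map_sub] at this
        rw [if_pos h1, if_pos h2]
        exact this
      · have := K_rel K n e ℓ κ (KLRRel.quadR ⟨r, hr⟩ i h1 h2)
        simp only [map_mul, map_pow, map_sub] at this
        rw [if_pos h1, if_neg h2, one_mul]
        exact this
    · by_cases h2 : i (pL ⟨r, hr⟩) = i (pR ⟨r, hr⟩) + 1
      · have := K_rel K n e ℓ κ (KLRRel.quadL ⟨r, hr⟩ i h2 h1)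
        simp only [map_mul, map_pow, map_sub] at this
        rw [if_neg h1, if_pos h2, mul_one]
        exact this
      · have := K_rel K n e ℓ κ (KLRRel.quadNone ⟨r, hr⟩ i h h1 h2)
        simp only [map_mul, map_pow, map_sub] at this
        rw [if_neg h1, if_neg h2, one_mul, one_mul]
        exact this

theorem br_both {S : Type} [Ring S] {a b u v w E : S} (h : a * E = (b + u - 2 * v + w) * E) :
    b * E = a * E + (v - u + (w - v) * -1) * E := by
  rw [h, ← add_mul]
  congr 1
  noncomm_ring

theorem br_R {S : Type} [Ring S] {a b E : S} (h : a * E = (b - 1) * E) :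
    b * E = a * E + E := by
  rw [h]
  noncomm_ring

theorem br_L {S : Type} [Ring S] {a b E : S} (h : a * E = (b + 1) * E) :
    b * E = a * E + -1 * E := by
  rw [h]
  noncomm_ring

theorem K_h4 (he : (1 : ZMod e) ≠ 0) (wt : ZMod e → Polynomial ℤ) (hw : ∀ a, zz K (wt a) = 0)
    {r : ℕ} (hr : r + 1 < n - 1) :
    pK K n e ℓ κ (r + 1) * pK K n e ℓ κ r * pK K n e ℓ κ (r + 1) =
      pK K n e ℓ κ r * pK K n e ℓ κ (r + 1) * pK K n e ℓ κ r + cK K n e ℓ κ (Dr e n wt r) := by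
  have hr' : r < n - 1 := by omega
  refine K_ext K n e ℓ κ fun i => ?_
  rw [add_mul, cK_E, Dr, DD, pK_eq K n e ℓ κ hr, pK_eq K n e ℓ κ hr', ← pL_pos n hr',
    ← pR_pos n hr', ← pM_pos n hr' hr]
  by_cases h : i (pM ⟨r, hr'⟩ hr) = i (pL ⟨r, hr'⟩) ∧
      (i (pR ⟨r, hr'⟩) = i (pL ⟨r, hr'⟩) + 1 ∨ i (pL ⟨r, hr'⟩) = i (pR ⟨r, hr'⟩) + 1)
  · obtain ⟨h0, h12⟩ := h
    have hne : i (pL ⟨r, hr'⟩) ≠ i (pR ⟨r, hr'⟩) := by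
      intro h
      rw [h] at h12
      simp [he] at h12
    rw [if_pos ⟨h0.symm, hne⟩, map_add, map_mul, map_mul, ev_th K n e ℓ κ wt hw,
      ev_th K n e ℓ κ wt hw]
    by_cases h1 : i (pR ⟨r, hr'⟩) = i (pL ⟨r, hr'⟩) + 1
    · by_cases h2 : i (pL ⟨r, hr'⟩) = i (pR ⟨r, hr'⟩) + 1
      · have := K_rel K n e ℓ κ (KLRRel.braidBoth ⟨r, hr'⟩ hr i h0 h1 h2)
        simp only [map_mul, map_sub, map_add, map_ofNat] at this
        simp only [if_pos h1, if_pos h2, map_one, map_neg, one_mul]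
        exact br_both this
      · have := K_rel K n e ℓ κ (KLRRel.braidR ⟨r, hr'⟩ hr i h0 h1 h2)
        simp only [map_mul, map_sub, map_one] at this
        simp only [if_pos h1, if_neg h2, map_one, map_zero, one_mul, mul_zero, add_zero]
        exact br_R this
    · have h2 := h12.resolve_left h1
      have := K_rel K n e ℓ κ (KLRRel.braidL ⟨r, hr'⟩ hr i h0 h2 h1)
      simp only [map_mul, map_add, map_one] at this
      simp only [if_neg h1, if_pos h2, map_one, map_zero, map_neg, one_mul, zero_mul, zero_add]
      exact br_L this
  · have := K_rel K n e ℓ κ (KLRRel.braidNone ⟨r, hr'⟩ hr i h)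
    simp only [map_mul] at this
    have h0 : ev K n e ℓ κ (if i (pL ⟨r, hr'⟩) = i (pM ⟨r, hr'⟩ hr) ∧
        i (pL ⟨r, hr'⟩) ≠ i (pR ⟨r, hr'⟩) then
        (if i (pR ⟨r, hr'⟩) = i (pL ⟨r, hr'⟩) + 1 then 1 else 0) *
          th (fun a => MvPolynomial.C (wt a)) (i (pR ⟨r, hr'⟩)) (i (pL ⟨r, hr'⟩))
            (MvPolynomial.X (pR ⟨r, hr'⟩)) (MvPolynomial.X (pL ⟨r, hr'⟩)) +
        th (fun a => MvPolynomial.C (wt a)) (i (pL ⟨r, hr'⟩)) (i (pR ⟨r, hr'⟩))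
            (MvPolynomial.X (pM ⟨r, hr'⟩ hr)) (MvPolynomial.X (pR ⟨r, hr'⟩)) *
          (if i (pL ⟨r, hr'⟩) = i (pR ⟨r, hr'⟩) + 1 then -1 else 0) else 0) = 0 := by
      split_ifs with q1 q2 q3 q4
      · exact absurd ⟨q1.1.symm, Or.inl q2⟩ h
      · exact absurd ⟨q1.1.symm, Or.inl q2⟩ h
      · exact absurd ⟨q1.1.symm, Or.inr q4⟩ h
      · simp
      · simp
    rw [h0, zero_mul, add_zero]
    exact this.symm

/-- The realization. -/
noncomputable def repK (he : (1 : ZMod e) ≠ 0) (wt : ZMod e → Polynomial ℤ)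
    (hw : ∀ a, zz K (wt a) = 0) : KRep (Polynomial ℤ) e n wt (KLR K n e ℓ κ) where
  c := cK K n e ℓ κ
  ψ := pK K n e ℓ κ
  h1 r hr f g hfg := by
    obtain ⟨g', h1, h2⟩ := H1_all K n e ℓ κ (show r < n - 1 by omega) f
    rw [h2, Yv_sub_cancel (show r + 1 < n by omega) (show r < n by omega) (by omega)
      (hfg.trans h1.symm)]
  h2 r hr := K_h2 K n e ℓ κ he wt hw (by omega)
  h3 r s hrs hs := by
    rw [pK_eq K n e ℓ κ (show r < n - 1 by omega), pK_eq K n e ℓ κ (show s < n - 1 by omega)]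
    have := K_rel K n e ℓ κ (KLRRel.psipsiFar ⟨r, by omega⟩ ⟨s, by omega⟩ (Or.inl hrs))
    rwa [map_mul, map_mul] at this
  h4 r hr := K_h4 K n e ℓ κ he wt hw (by omega)

end Fin12

/-- The deformation weights. -/
noncomputable def wtX (e : ℕ) (i : ZMod e) : Polynomial ℤ :=
  if i + 1 = 0 then Polynomial.C (e : ℤ) * Polynomial.X else 0

/-- The deformed contents. -/
noncomputable def valX (e : ℕ) (c : ℤ) : Polynomial ℤ :=
  Polynomial.C (c - c % (e : ℤ)) * Polynomial.X

theorem zz_wtX (K : Type) [Field K] (e : ℕ) (i : ZMod e) : zz K (wtX e i) = 0 := by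
  rw [wtX]
  split_ifs <;> simp [zz]

theorem zz_valX (K : Type) [Field K] (e : ℕ) (c : ℤ) : zz K (valX e c) = 0 := by
  rw [valX]; simp [zz]

/-- The spectral data. -/
noncomputable def sdX (n ℓ e : ℕ) (hn : 1 ≤ n) (he : 2 ≤ e) (κ : ℕ → ℤ)
    (hκ : ∀ l, l + 1 < ℓ → (n : ℤ) ≤ κ l - κ (l + 1)) :
    SD (Polynomial ℤ) e n (wtX e) (fun l : Fin ℓ => κ l) where
  val := valX e
  hv1 c := by
    have hc : ((c : ZMod e) + 1 = 0) ↔ (e : ℤ) ∣ c + 1 := by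
      rw [← ZMod.intCast_zmod_eq_zero_iff_dvd]; push_cast; rfl
    have he0 : (0 : ℤ) < e := by omega
    have h1 := Int.emod_nonneg c he0.ne'
    have h2 := Int.emod_lt_of_pos c he0
    rw [wtX, valX, valX]
    by_cases h : (e : ℤ) ∣ c + 1
    · rw [if_pos (hc.2 h), ← add_mul, ← Polynomial.C_add]
      congr 2
      rw [Int.emod_eq_zero_of_dvd h]
      have h3 : (c % e + 1) % e = 0 := by
        rw [Int.emod_add_emod]; exact Int.emod_eq_zero_of_dvd h
      have h4 : c % e + 1 = e := by
        obtain ⟨q, hq⟩ := Int.dvd_of_emod_eq_zero h3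
        have : q = 1 := by nlinarith
        rw [hq, this, mul_one]
      omega
    · rw [if_neg (fun h' => h (hc.1 h')), add_zero]
      congr 2
      have h3 : (c + 1) % e = c % e + 1 := by
        rw [← Int.emod_add_emod]
        refine Int.emod_eq_of_lt (by omega) ?_
        by_contra h4
        refine h (Int.dvd_of_emod_eq_zero ?_)
        rw [← Int.emod_add_emod, show c % e + 1 = (e : ℤ) by omega, Int.emod_self]
      omega
  hv2 c d h1 h2 := by
    rw [ZMod.intCast_eq_intCast_iff] at h1
    rw [valX, valX] at h2
    have h3 := mul_right_cancel₀ Polynomial.X_ne_zero h2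
    have h4 := Polynomial.C_injective h3
    have h5 : c % e = d % e := h1
    omega
  he := by
    haveI : Fact (1 < e) := ⟨he⟩
    exact one_ne_zero
  inj l l' h := by
    by_contra hne
    have := kabs hκ hne
    simp only at h
    rw [h, sub_self, abs_zero] at this
    omega
  w1 c m hm hg d := comb_w1 hκ c m hm hg d
  w2 c m hm hg a := comb_w2 hκ c m hm hg a

theorem main (n ℓ e : ℕ) (he : 2 ≤ e) [NeZero e] (κ : ℕ → ℤ)
    (hκ : ∀ l, l + 1 < ℓ → (n : ℤ) ≤ κ l - κ (l + 1)) (K : Type) [Field K]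
    (i : Fin n → ZMod e) (r : Fin n) :
    KyGen K n e ℓ κ r ^ (Set.ncard {z : ℤ | ∃ T : StdTableau ℓ n, resSeq e κ T = i ∧
        z = content κ T (r.1 + 1) - ((i r).val : ℤ)}) * KeGen K n e ℓ κ i = 0 := by
  have hn : 0 < n := by have := r.2; omega
  haveI : NeZero n := ⟨hn.ne'⟩
  have hfin : {z : ℤ | ∃ T : StdTableau ℓ n, resSeq e κ T = i ∧
      z = content κ T (r.1 + 1)}.Finite :=
    (content_fin (ℓ := ℓ) (n := n) κ (r.1 + 1) (by omega) (by have := r.2; omega)).subset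
      (by rintro z ⟨T, -, h⟩; exact ⟨T, h⟩)
  have hcard : Set.ncard {z : ℤ | ∃ T : StdTableau ℓ n, resSeq e κ T = i ∧
        z = content κ T (r.1 + 1) - ((i r).val : ℤ)} = hfin.toFinset.card := by
    rw [← Set.ncard_eq_toFinset_card _ hfin]
    have : {z : ℤ | ∃ T : StdTableau ℓ n, resSeq e κ T = i ∧
        z = content κ T (r.1 + 1) - ((i r).val : ℤ)} = (fun z : ℤ => z - ((i r).val : ℤ)) ''
        {z : ℤ | ∃ T : StdTableau ℓ n, resSeq e κ T = i ∧ z = content κ T (r.1 + 1)} := by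
      ext z
      constructor
      · rintro ⟨T, h1, h2⟩; exact ⟨_, ⟨T, h1, rfl⟩, h2.symm⟩
      · rintro ⟨_, ⟨T, h1, rfl⟩, h2⟩; exact ⟨T, h1, h2.symm⟩
    rw [this]
    exact Set.ncard_image_of_injective _ (sub_left_injective)
  let Γ : Ctx (Polynomial ℤ) (FractionRing (MvPolynomial (Fin n) (Polynomial ℤ))) e n :=
    { wt := wtX e
      φ := algebraMap _ _
      inj := IsFractionRing.injective _ _ }
  let D : SD (Polynomial ℤ) e n Γ.wt (fun l : Fin ℓ => κ l) := sdX n ℓ e hn he κ hκ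
  have hmem := spec_mem Γ D i r.2 hfin.toFinset (by
    intro c hg hc
    obtain ⟨T, h1, -⟩ := exists_tab κ c n hg
    rw [Set.Finite.mem_toFinset]
    refine ⟨T, ?_, (h1 r.1 r.2).symm⟩
    funext t
    rw [resSeq, h1 t.1 t.2, hc t.1 t.2, pos_fin])
  have h0 := transfer Γ (repK K n e ℓ κ D.he (wtX e) (zz_wtX K e)) (by omega)
    (cK_aP K n e ℓ κ (valX e) (zz_valX K e)) hmem
  change cK K n e ℓ κ _ = 0 at h0
  rw [map_mul, cK_ind] at h0
  have h1 := cK_pf K n e ℓ κ (valX e) (zz_valX K e) r.1 hfin.toFinset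
  rw [pos_fin] at h1
  change cK K n e ℓ κ (pf e n (valX e) r.1 hfin.toFinset) * _ = 0 at h0
  rw [h1] at h0
  rw [hcard]
  exact h0

end NB
end Paper

namespace Paper

/-- in the cyclotomic quiver Hecke algebra `R_n^Λ(K)` over a field
containing an element of quantum characteristic `e`, one has `y_r^{d_r(i)} e(i) = 0`,
where `d_r(i)` is the number of distinct values of `c_r(T) - î_r` over `T ∈ Std(i)`. -/
theorem y_nilpotency_bound (n ℓ e : ℕ) (hℓ : 1 ≤ ℓ) (he : 2 ≤ e) [NeZero e]
    (κ : ℕ → ℤ) (hκ : ∀ l, l + 1 < ℓ → (n : ℤ) ≤ κ l - κ (l + 1))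
    (K : Type) [Field K] (ξ : Kˣ)
    (hξ1 : qint (ξ : K) (e : ℤ) = 0)
    (hξ2 : ∀ k : ℕ, 1 ≤ k → k < e → qint (ξ : K) (k : ℤ) ≠ 0)
    (i : Fin n → ZMod e) (r : Fin n) :
    KyGen K n e ℓ κ r ^
        (Set.ncard {z : ℤ | ∃ T : StdTableau ℓ n, resSeq e κ T = i ∧
          z = content κ T (r.1 + 1) - ((i r).val : ℤ)}) *
      KeGen K n e ℓ κ i = 0 :=
  NB.main n ℓ e he κ hκ K i r

end Paper
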